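/- Let G be a connected finite simple graph with no K_8-minor, having a vertex s of degree at most 7 with N[s] a proper subset of V(G). If every edge of G that is not an edge of the induced subgraph G[N[s]] belongs to at least 6 triangles, then G contains an induced subgraph isomorphic to K_{2,2,2,2,2}. -/

import Mathlib

open SimpleGraph

/-- `H` is a minor of `G`: there is a family of nonempty, pairwise disjoint,
connected branch sets in `G`, one for each vertex of `H`, with an edge of `G`
between the branch sets corresponding to each edge of `H`. -/
def SimpleGraph.MinorOf {W V : Type} (H : SimpleGraph W) (G : SimpleGraph V) : Prop :=
  ∃ f : W → Set V,
    (∀ w, (f w).Nonempty) ∧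
    (∀ w, (G.induce (f w)).Connected) ∧
    (∀ w₁ w₂, w₁ ≠ w₂ → Disjoint (f w₁) (f w₂)) ∧
    (∀ w₁ w₂, H.Adj w₁ w₂ → ∃ v₁ ∈ f w₁, ∃ v₂ ∈ f w₂, G.Adj v₁ v₂)


/-- The complete multipartite graph `K_{2,2,2,2,2}` with five parts of size 2. -/
def K22222 : SimpleGraph (Σ _ : Fin 5, Fin 2) :=
  SimpleGraph.completeMultipartiteGraph fun _ : Fin 5 => Fin 2

namespace TriangleMinor

/-- `S` is nonempty and cannot be split into two nonempty parts with no edge between them. -/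
def Conn {V : Type} (G : SimpleGraph V) (S : Set V) : Prop :=
  S.Nonempty ∧ ∀ T : Set V, (∃ a ∈ S, a ∈ T) → (∃ b ∈ S, b ∉ T) →
    ∃ a ∈ S, ∃ b ∈ S, a ∈ T ∧ b ∉ T ∧ G.Adj a b

/-- There is an edge between `A` and `B`. -/
def Touch {V : Type} (G : SimpleGraph V) (A B : Set V) : Prop :=
  ∃ a ∈ A, ∃ b ∈ B, G.Adj a b

/-- The open neighbourhood of a vertex set. -/
def nbs {V : Type} (G : SimpleGraph V) (D : Set V) : Set V :=
  {v | v ∉ D ∧ ∃ d ∈ D, G.Adj d v}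

/-- `C` is a component of the graph obtained by deleting `X`. -/
def IsComp {V : Type} (G : SimpleGraph V) (X C : Set V) : Prop :=
  Conn G C ∧ Disjoint C X ∧ nbs G C ⊆ X

section
variable {V : Type} {G : SimpleGraph V}

lemma Touch.symm {A B : Set V} (h : Touch G A B) : Touch G B A := by
  obtain ⟨a, ha, b, hb, hab⟩ := h
  exact ⟨b, hb, a, ha, hab.symm⟩

lemma Touch.mono {A B A' B' : Set V} (h : Touch G A B) (hA : A ⊆ A') (hB : B ⊆ B') :
    Touch G A' B' := by
  obtain ⟨a, ha, b, hb, hab⟩ := h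
  exact ⟨a, hA ha, b, hB hb, hab⟩

lemma Conn.connected {S : Set V} (h : Conn G S) : (G.induce S).Connected := by
  obtain ⟨⟨x, hx⟩, hS⟩ := h
  rw [connected_iff_exists_forall_reachable]
  refine ⟨⟨x, hx⟩, ?_⟩
  by_contra! hcon
  obtain ⟨⟨y, hy⟩, hxy⟩ := hcon
  obtain ⟨a, ha, b, hb, haT, hbT, hab⟩ := hS
    {v | ∃ hv : v ∈ S, (G.induce S).Reachable ⟨x, hx⟩ ⟨v, hv⟩}
    ⟨x, hx, hx, Reachable.refl _⟩ ⟨y, hy, fun ⟨_, h⟩ => hxy h⟩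
  obtain ⟨ha', hr⟩ := haT
  refine hbT ⟨hb, hr.trans (Adj.reachable ?_)⟩
  exact hab

lemma conn_of_connected {S : Set V} (h : (G.induce S).Connected) : Conn G S := by
  obtain ⟨⟨x, hx⟩⟩ := h.nonempty
  refine ⟨⟨x, hx⟩, ?_⟩
  rintro T ⟨a, ha, haT⟩ ⟨b, hb, hbT⟩
  obtain ⟨p⟩ := h.preconnected ⟨a, ha⟩ ⟨b, hb⟩
  obtain ⟨d, -, h1, h2⟩ := p.exists_boundary_dart {v | (v : V) ∈ T} haT hbT
  exact ⟨d.fst, d.fst.2, d.snd, d.snd.2, h1, h2, d.adj⟩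

lemma conn_univ (h : G.Connected) : Conn G Set.univ := by
  obtain ⟨x⟩ := h.nonempty
  refine ⟨⟨x, trivial⟩, ?_⟩
  rintro T ⟨a, -, haT⟩ ⟨b, -, hbT⟩
  obtain ⟨p⟩ := h.preconnected a b
  obtain ⟨d, -, h1, h2⟩ := p.exists_boundary_dart T haT hbT
  exact ⟨d.fst, trivial, d.snd, trivial, h1, h2, d.adj⟩

lemma conn_singleton (x : V) : Conn G {x} := by
  refine ⟨⟨x, rfl⟩, ?_⟩
  rintro T ⟨a, rfl, ha⟩ ⟨b, rfl, hb⟩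
  exact absurd ha hb

lemma Conn.union_of_common {A B : Set V} (hA : Conn G A) (hB : Conn G B)
    (h : (A ∩ B).Nonempty) : Conn G (A ∪ B) := by
  refine ⟨hA.1.inl, ?_⟩
  rintro T ⟨a, ha, haT⟩ ⟨b, hb, hbT⟩
  obtain ⟨c, hcA, hcB⟩ := h
  have key : ∀ S, S ⊆ A ∪ B → Conn G S → (∃ a ∈ S, a ∈ T) → (∃ b ∈ S, b ∉ T) →
      ∃ a ∈ A ∪ B, ∃ b ∈ A ∪ B, a ∈ T ∧ b ∉ T ∧ G.Adj a b := by
    intro S hS hC h1 h2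
    obtain ⟨p, hp, q, hq, h⟩ := hC.2 T h1 h2
    exact ⟨p, hS hp, q, hS hq, h⟩
  by_cases hc : c ∈ T
  · rcases hb with hb | hb
    · exact key A Set.subset_union_left hA ⟨c, hcA, hc⟩ ⟨b, hb, hbT⟩
    · exact key B Set.subset_union_right hB ⟨c, hcB, hc⟩ ⟨b, hb, hbT⟩
  · rcases ha with ha | ha
    · exact key A Set.subset_union_left hA ⟨a, ha, haT⟩ ⟨c, hcA, hc⟩
    · exact key B Set.subset_union_right hB ⟨a, ha, haT⟩ ⟨c, hcB, hc⟩

lemma conn_pair {x y : V} (h : G.Adj x y) : Conn G {x, y} := by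
  refine ⟨⟨x, by simp⟩, ?_⟩
  rintro T ⟨a, ha, haT⟩ ⟨b, hb, hbT⟩
  refine ⟨a, ha, b, hb, haT, hbT, ?_⟩
  rcases ha with rfl | rfl <;> rcases hb with rfl | rfl
  · exact absurd haT hbT
  · exact h
  · exact h.symm
  · exact absurd haT hbT

lemma Conn.union_of_touch {A B : Set V} (hA : Conn G A) (hB : Conn G B)
    (h : Touch G A B) : Conn G (A ∪ B) := by
  obtain ⟨a, ha, b, hb, hab⟩ := h
  have h1 := hA.union_of_common (conn_pair hab) ⟨a, ha, by simp⟩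
  have h2 := h1.union_of_common hB ⟨b, by simp, hb⟩
  convert h2 using 1
  ext v
  simp only [Set.mem_union, Set.mem_insert_iff, Set.mem_singleton_iff]
  constructor
  · tauto
  · rintro ((h | rfl | rfl) | h) <;> tauto

lemma Conn.insert {A : Set V} (hA : Conn G A) {x : V} (h : ∃ a ∈ A, G.Adj x a) :
    Conn G (insert x A) := by
  obtain ⟨a, ha, hxa⟩ := h
  exact (conn_singleton x).union_of_touch hA ⟨x, rfl, a, ha, hxa⟩

/-- The component of `v` in the graph obtained by deleting `X`. -/
lemma exists_isComp {X : Set V} {v : V} (hv : v ∉ X) : ∃ C, IsComp G X C ∧ v ∈ C := by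
  let C : Set V := ⋃₀ {A | Conn G A ∧ Disjoint A X ∧ v ∈ A}
  have hvC : v ∈ C := ⟨{v}, ⟨conn_singleton v, by simpa using hv, rfl⟩, rfl⟩
  have hC : Conn G C := by
    refine ⟨⟨v, hvC⟩, ?_⟩
    rintro T ⟨a, ⟨A, hA, haA⟩, haT⟩ ⟨b, ⟨B, hB, hbB⟩, hbT⟩
    have h := (hA.1.union_of_common hB.1 ⟨v, hA.2.2, hB.2.2⟩).2 T
      ⟨a, Or.inl haA, haT⟩ ⟨b, Or.inr hbB, hbT⟩
    obtain ⟨p, hp, q, hq, h⟩ := h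
    have hs : A ∪ B ⊆ C := Set.union_subset (Set.subset_sUnion_of_mem hA)
      (Set.subset_sUnion_of_mem hB)
    exact ⟨p, hs hp, q, hs hq, h⟩
  have hdis : Disjoint C X := by
    rw [Set.disjoint_sUnion_left]
    exact fun A hA => hA.2.1
  refine ⟨C, ⟨hC, hdis, ?_⟩, hvC⟩
  rintro w ⟨hwC, d, hd, hdw⟩
  by_contra hw
  refine hwC ⟨insert w C, ⟨hC.insert ⟨d, hd, hdw.symm⟩, ?_, Or.inr hvC⟩, Or.inl rfl⟩
  rw [Set.disjoint_insert_left]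
  exact ⟨hw, hdis⟩

lemma IsComp.subset_of_conn {X C J : Set V} (hC : IsComp G X C) (hJ : Conn G J)
    (hJX : Disjoint J X) (h : (J ∩ C).Nonempty) : J ⊆ C := by
  by_contra hn
  obtain ⟨b, hb, hbC⟩ := Set.not_subset.1 hn
  obtain ⟨a, ha, haC⟩ := h
  obtain ⟨p, hp, q, hq, hpC, hqC, hpq⟩ := hJ.2 C ⟨a, ha, haC⟩ ⟨b, hb, hbC⟩
  exact Set.disjoint_left.1 hJX hq (hC.2.2 ⟨hqC, p, hpC, hpq⟩)

lemma IsComp.eq_of_inter {X C C' : Set V} (hC : IsComp G X C) (hC' : IsComp G X C')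
    (h : (C ∩ C').Nonempty) : C = C' :=
  Set.Subset.antisymm (hC'.subset_of_conn hC.1 hC.2.1 h)
    (hC.subset_of_conn hC'.1 hC'.2.1 (by rwa [Set.inter_comm]))

lemma IsComp.mem_of_adj {X C : Set V} (hC : IsComp G X C) {a b : V} (ha : a ∈ C)
    (hab : G.Adj a b) (hb : b ∉ X) : b ∈ C := by
  by_contra h
  exact hb (hC.2.2 ⟨h, a, ha, hab⟩)

end

section
variable {U W V : Type}

/-- A minor model given by connected, disjoint, pairwise touching branch sets. -/
lemma minorOf_of_conn {H : SimpleGraph W} {G : SimpleGraph V} (f : W → Set V)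
    (hc : ∀ w, Conn G (f w)) (hd : ∀ w₁ w₂, w₁ ≠ w₂ → Disjoint (f w₁) (f w₂))
    (ht : ∀ w₁ w₂, H.Adj w₁ w₂ → Touch G (f w₁) (f w₂)) : H.MinorOf G :=
  ⟨f, fun w => (hc w).1, fun w => (hc w).connected, hd, ht⟩

lemma conn_biUnion {H : SimpleGraph W} {G : SimpleGraph V} (g : W → Set V)
    (hc : ∀ w, Conn G (g w)) (ht : ∀ w₁ w₂, H.Adj w₁ w₂ → Touch G (g w₁) (g w₂))
    {S : Set W} (hS : Conn H S) : Conn G (⋃ w ∈ S, g w) := by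
  obtain ⟨⟨w₀, hw₀⟩, hS⟩ := hS
  obtain ⟨x₀, hx₀⟩ := (hc w₀).1
  refine ⟨⟨x₀, Set.mem_biUnion hw₀ hx₀⟩, ?_⟩
  rintro T ⟨a, ha, haT⟩ ⟨b, hb, hbT⟩
  simp only [Set.mem_iUnion] at ha hb
  obtain ⟨i, hi, hai⟩ := ha
  obtain ⟨j, hj, hbj⟩ := hb
  by_contra hcon
  push Not at hcon
  have hmem : ∀ {w v}, w ∈ S → v ∈ g w → v ∈ ⋃ w ∈ S, g w :=
    fun hw hv => Set.mem_biUnion hw hv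
  have hall : ∀ w ∈ S, ∀ x ∈ g w, x ∈ T → ∀ y ∈ g w, y ∈ T := by
    intro w hw x hx hxT y hy
    by_contra hyT
    obtain ⟨p, hp, q, hq, h1, h2, h3⟩ := (hc w).2 T ⟨x, hx, hxT⟩ ⟨y, hy, hyT⟩
    exact hcon p (hmem hw hp) q (hmem hw hq) h1 h2 h3
  obtain ⟨p, hp, q, hq, h1, h2, h3⟩ := hS {w | ∃ x ∈ g w, x ∈ T} ⟨i, hi, a, hai, haT⟩
    ⟨j, hj, fun ⟨x, hx, hxT⟩ => hbT (hall j hj x hx hxT b hbj)⟩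
  obtain ⟨x, hx, hxT⟩ := h1
  obtain ⟨y, hy, z, hz, hyz⟩ := ht p q h3
  exact hcon y (hmem hp hy) z (hmem hq hz) (hall p hp x hx hxT y hy)
    (fun hzT => h2 ⟨z, hz, hzT⟩) hyz

lemma minorOf_trans {K : SimpleGraph U} {H : SimpleGraph W} {G : SimpleGraph V}
    (g : W → Set V) (hc : ∀ w, Conn G (g w))
    (hd : ∀ w₁ w₂, w₁ ≠ w₂ → Disjoint (g w₁) (g w₂))
    (ht : ∀ w₁ w₂, H.Adj w₁ w₂ → Touch G (g w₁) (g w₂)) (hK : K.MinorOf H) :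
    K.MinorOf G := by
  obtain ⟨f, -, hf, hfd, hft⟩ := hK
  refine minorOf_of_conn (fun u => ⋃ w ∈ f u, g w)
    (fun u => conn_biUnion g hc ht (conn_of_connected (hf u))) ?_ ?_
  · intro u₁ u₂ hu
    simp only [Set.disjoint_iUnion_left, Set.disjoint_iUnion_right]
    intro i hi j hj
    apply hd
    rintro rfl
    exact Set.disjoint_left.1 (hfd _ _ hu) (by assumption) (by assumption)
  · intro u₁ u₂ hu
    obtain ⟨i, hi, j, hj, hij⟩ := hft u₁ u₂ hu
    exact (ht i j hij).mono (Set.subset_biUnion_of_mem hi) (Set.subset_biUnion_of_mem hj)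

lemma minorOf_induce {K : SimpleGraph U} {G : SimpleGraph V} {S : Set V}
    (h : K.MinorOf (G.induce S)) : K.MinorOf G := by
  refine minorOf_trans (fun w : S => {(w : V)}) (fun w => conn_singleton _) ?_ ?_ h
  · intro a b hab
    simpa [Subtype.ext_iff] using hab
  · intro a b hab
    exact ⟨a, rfl, b, rfl, hab⟩

/-- A list of connected, pairwise disjoint and pairwise touching sets. -/
def Bags (G : SimpleGraph V) (l : List (Set V)) : Prop :=
  (∀ A ∈ l, Conn G A) ∧ l.Pairwise fun A B => Disjoint A B ∧ Touch G A B

lemma Bags.minorOf {G : SimpleGraph V} {l : List (Set V)} (h : Bags G l) {n : ℕ}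
    (hn : l.length = n) : (⊤ : SimpleGraph (Fin n)).MinorOf G := by
  subst hn
  have key : ∀ i j : Fin l.length, i ≠ j →
      Disjoint (l.get i) (l.get j) ∧ Touch G (l.get i) (l.get j) := by
    intro i j hij
    have hp := List.pairwise_iff_get.1 h.2
    rcases lt_or_gt_of_ne hij with hlt | hlt
    · exact hp i j hlt
    · exact ⟨(hp j i hlt).1.symm, (hp j i hlt).2.symm⟩
  exact minorOf_of_conn l.get (fun w => h.1 _ (List.get_mem l w)) (fun i j hij => (key i j hij).1)
    (fun i j hij => (key i j hij).2)

lemma Bags.cons {G : SimpleGraph V} {l : List (Set V)} (h : Bags G l) {A : Set V}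
    (hA : Conn G A) (hB : ∀ B ∈ l, Disjoint A B ∧ Touch G A B) : Bags G (A :: l) :=
  ⟨by simpa using ⟨hA, h.1⟩, List.pairwise_cons.2 ⟨hB, h.2⟩⟩

end

/-- The closed neighbourhood of a vertex. -/
def cn {V : Type} (G : SimpleGraph V) (s : V) : Set V := {v | v = s ∨ G.Adj s v}

/-- The configuration excluded by the main theorem. -/
structure Inst {V : Type} (G : SimpleGraph V) (s : V) : Prop where
  free : ¬ (⊤ : SimpleGraph (Fin 8)).MinorOf G
  noK : IsEmpty (K22222 ↪g G)
  deg : (G.neighborSet s).ncard ≤ 7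
  far : ∃ u, u ∉ cn G s
  tri : ∀ u v, u ∉ cn G s → G.Adj u v → 6 ≤ (G.commonNeighbors u v).ncard
  nbr : ∀ u, u ∉ cn G s → ∃ v, G.Adj u v

/-- There is no instance on fewer vertices than `n`. -/
def NoInst (n : ℕ) : Prop :=
  ∀ (W : Type) [Finite W] (H : SimpleGraph W) (t : W), Nat.card W < n → ¬ Inst H t

lemma K22222_degree (w : Σ _ : Fin 5, Fin 2) : (K22222.neighborSet w).ncard = 8 := by
  have h : K22222.neighborSet w =
      ((Finset.univ.filter fun v : Σ _ : Fin 5, Fin 2 => w.1 ≠ v.1 : Finset _) : Set _) := by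
    ext v
    simp [K22222]
  rw [h, Set.ncard_coe_finset]
  clear h
  revert w
  decide

section
variable {V : Type} {G : SimpleGraph V}

lemma ncard_neighborSet_le_of_embedding {W : Type} {H : SimpleGraph W} [Finite V] (φ : H ↪g G)
    (w : W) : (H.neighborSet w).ncard ≤ (G.neighborSet (φ w)).ncard := by
  refine Set.ncard_le_ncard_of_injOn φ ?_ φ.injective.injOn (Set.toFinite _)
  intro v hv
  exact φ.map_rel_iff.2 hv

/-- Replace everything outside `D ∪ nbs G D` by a single vertex joined to `nbs G D`. -/
def collapse (G : SimpleGraph V) (D : Set V) : SimpleGraph (Option ↥(D ∪ nbs G D)) where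
  Adj x y := match x, y with
    | some a, some b => G.Adj a b
    | none, some b => (b : V) ∈ nbs G D
    | some a, none => (a : V) ∈ nbs G D
    | none, none => False
  symm := ⟨by
    rintro (_ | a) (_ | b) h
    · exact h
    · exact h
    · exact h
    · exact G.symm.symm _ _ h⟩
  loopless := ⟨by
    rintro (_ | a) h
    · exact h
    · exact G.loopless.irrefl _ h⟩

lemma collapse_minor {D E : Set V} (hE : Conn G E)
    (hED : Disjoint E D) (hEN : Disjoint E (nbs G D))
    (hN : ∀ b ∈ nbs G D, ∃ e ∈ E, G.Adj b e) {U : Type} {K : SimpleGraph U}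
    (h : K.MinorOf (collapse G D)) : K.MinorOf G := by
  refine minorOf_trans (fun w => match w with
    | none => E
    | some v => {(v : V)}) ?_ ?_ ?_ h
  · rintro (_ | v)
    · exact hE
    · exact conn_singleton _
  · have key : ∀ v : ↥(D ∪ nbs G D), (v : V) ∉ E := by
      rintro ⟨v, hv | hv⟩ hvE
      · exact Set.disjoint_left.1 hED hvE hv
      · exact Set.disjoint_left.1 hEN hvE hv
    rintro (_ | v) (_ | w) hvw
    · exact absurd rfl hvw
    · simpa using key w
    · simpa using key v
    · simpa [Subtype.ext_iff] using hvw
  · rintro (_ | v) (_ | w) hvw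
    · exact hvw.elim
    · obtain ⟨e, he, hbe⟩ := hN _ hvw
      exact ⟨e, he, _, rfl, hbe.symm⟩
    · obtain ⟨e, he, hbe⟩ := hN _ hvw
      exact ⟨_, rfl, e, he, hbe⟩
    · exact ⟨_, rfl, _, rfl, hvw⟩

lemma collapse_degree [Finite V] (D : Set V) :
    ((collapse G D).neighborSet none).ncard ≤ (nbs G D).ncard := by
  have h : (collapse G D).neighborSet none = some '' {x : ↥(D ∪ nbs G D) | (x : V) ∈ nbs G D} := by
    ext (_ | x)
    · simp [collapse]
    · simp [collapse]
  rw [h, Set.ncard_image_of_injective _ (Option.some_injective _)]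
  exact Set.ncard_le_ncard_of_injOn Subtype.val (fun x hx => hx) Subtype.val_injective.injOn
    (Set.toFinite _)

theorem eight_le_ncard_nbs [Finite V] {s : V} (hI : Inst G s) (hs : NoInst (Nat.card V))
    {D E : Set V} (hD : D.Nonempty) (hDs : Disjoint D (cn G s)) (hE : Conn G E)
    (hED : Disjoint E D) (hEN : Disjoint E (nbs G D))
    (hN : ∀ b ∈ nbs G D, ∃ e ∈ E, G.Adj b e)
    {p q : V} (hpq : p ≠ q) (hp : p ∉ D ∪ nbs G D) (hq : q ∉ D ∪ nbs G D) :
    8 ≤ (nbs G D).ncard := by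
  by_contra! hlt
  have hmem : ∀ d ∈ D, ∀ v, G.Adj d v → v ∈ D ∪ nbs G D := by
    intro d hd v hdv
    by_cases hv : v ∈ D
    · exact Or.inl hv
    · exact Or.inr ⟨hv, d, hd, hdv⟩
  have hcard : Nat.card (Option ↥(D ∪ nbs G D)) < Nat.card V := by
    rw [Finite.card_option, Nat.card_coe_set_eq]
    have h1 : ((D ∪ nbs G D) ∪ {p, q}).ncard ≤ Nat.card V := by
      rw [← Set.ncard_univ]
      exact Set.ncard_le_ncard (Set.subset_univ _)
    rw [Set.ncard_union_eq (by simp [hp, hq]), Set.ncard_pair hpq] at h1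
    omega
  have hfar : ∀ u, u ∉ cn (collapse G D) none → ∃ d, ∃ h : d ∈ D ∪ nbs G D,
      u = some ⟨d, h⟩ ∧ d ∈ D := by
    rintro (_ | ⟨d, hd⟩) hu
    · exact absurd (Or.inl rfl) hu
    · refine ⟨d, hd, rfl, ?_⟩
      rcases hd with h | h
      · exact h
      · exact absurd (Or.inr h) hu
  refine hs _ (collapse G D) none hcard ⟨?_, ?_, ?_, ?_, ?_, ?_⟩
  · exact fun h => hI.free (collapse_minor hE hED hEN hN h)
  · refine ⟨fun φ => ?_⟩
    have hne : ∀ w, ∃ x, φ w = some x := by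
      intro w
      rcases hw : φ w with _ | x
      · have h1 := ncard_neighborSet_le_of_embedding φ w
        rw [K22222_degree, hw] at h1
        have h2 := collapse_degree (G := G) D
        omega
      · exact ⟨x, rfl⟩
    choose f hf using hne
    refine hI.noK.false ⟨⟨fun w => (f w : V), ?_⟩, ?_⟩
    · intro a b hab
      apply φ.injective
      rw [hf, hf, Subtype.ext hab]
    · intro a b
      have := φ.map_rel_iff (a := a) (b := b)
      rw [hf, hf] at this
      exact this
  · exact (collapse_degree D).trans (by omega)
  · obtain ⟨d, hd⟩ := hD
    refine ⟨some ⟨d, Or.inl hd⟩, ?_⟩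
    rintro (h | h)
    · cases h
    · exact h.1 hd
  · intro u v hu huv
    obtain ⟨d, hdS, rfl, hd⟩ := hfar u hu
    rcases v with _ | ⟨v, hv⟩
    · exact absurd hd huv.1
    refine (hI.tri d v (Set.disjoint_left.1 hDs hd) huv).trans ?_
    have hsub : G.commonNeighbors d v ⊆ Subtype.val ''
        {x : ↥(D ∪ nbs G D) | some x ∈ (collapse G D).commonNeighbors (some ⟨d, hdS⟩)
          (some ⟨v, hv⟩)} := by
      rintro w ⟨h1, h2⟩
      exact ⟨⟨w, hmem d hd w h1⟩, ⟨h1, h2⟩, rfl⟩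
    refine (Set.ncard_le_ncard hsub).trans ((Set.ncard_image_le).trans ?_)
    refine Set.ncard_le_ncard_of_injOn some ?_ (Option.some_injective _).injOn (Set.toFinite _)
    exact fun x hx => hx
  · intro u hu
    obtain ⟨d, hdS, rfl, hd⟩ := hfar u hu
    obtain ⟨v, hv⟩ := hI.nbr d (Set.disjoint_left.1 hDs hd)
    exact ⟨some ⟨v, hmem d hd v hv⟩, hv⟩

end

section
variable {V : Type} {G : SimpleGraph V} [Finite V] {s : V}

/-- A neighbour of `s` has a neighbour outside the closed neighbourhood of `s`. -/
lemma exists_adj_far (hI : Inst G s) (hs : NoInst (Nat.card V)) {y : V} (hy : G.Adj s y) :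
    ∃ h, h ∉ cn G s ∧ G.Adj y h := by
  by_contra! hcon
  have hsub : nbs G (cn G s)ᶜ ⊆ G.neighborSet s := by
    rintro v ⟨hv, d, hd, hdv⟩
    rcases Set.notMem_compl_iff.1 hv with rfl | h
    · exact absurd (Or.inr hdv.symm) hd
    · exact h
  have h8 := eight_le_ncard_nbs hI hs (D := (cn G s)ᶜ) (E := {s}) hI.far
    disjoint_compl_left (conn_singleton s)
    (by simp [cn]) ?_ (fun b hb => ⟨s, rfl, (hsub hb).symm⟩) hy.ne ?_ ?_
  · have := (Set.ncard_le_ncard hsub).trans hI.deg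
    omega
  · rw [Set.disjoint_singleton_left]
    intro h
    exact G.loopless.irrefl s (hsub h)
  · rintro (h | h)
    · exact h (Or.inl rfl)
    · exact G.loopless.irrefl s (hsub h)
  · rintro (h | ⟨-, d, hd, hdy⟩)
    · exact h (Or.inr hy)
    · exact hcon d hd hdy.symm

lemma eight_le_ncard_nbs_of_mem (hI : Inst G s) (hs : NoInst (Nat.card V)) {E : Set V}
    (hE : Conn G E) (hsE : s ∈ E) {p : V} (hp : p ∈ E) (hps : p ≠ s) {v : V}
    (hv : v ∉ E ∪ nbs G E) : 8 ≤ (nbs G E).ncard := by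
  have hsub : nbs G (E ∪ nbs G E)ᶜ ⊆ nbs G E := by
    rintro w ⟨hw, d, hd, hdw⟩
    rcases Set.notMem_compl_iff.1 hw with h | h
    · exact absurd (Or.inr ⟨fun hdE => hd (Or.inl hdE), w, h, hdw.symm⟩) hd
    · exact h
  have hE' : ∀ x ∈ E, x ∉ (E ∪ nbs G E)ᶜ ∪ nbs G (E ∪ nbs G E)ᶜ := by
    rintro x hx (h | h)
    · exact h (Or.inl hx)
    · exact (hsub h).1 hx
  refine (eight_le_ncard_nbs hI hs (D := (E ∪ nbs G E)ᶜ) (E := E) ⟨v, hv⟩ ?_ hE ?_ ?_ ?_ hps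
    (hE' _ hp) (hE' _ hsE)).trans (Set.ncard_le_ncard hsub)
  · rw [Set.disjoint_left]
    rintro x hx (rfl | h)
    · exact hx (Or.inl hsE)
    · by_cases hxE : x ∈ E
      · exact hx (Or.inl hxE)
      · exact hx (Or.inr ⟨hxE, s, hsE, h⟩)
  · rw [Set.disjoint_left]
    exact fun x hx h => h (Or.inl hx)
  · rw [Set.disjoint_left]
    exact fun x hx h => (hsub h).1 hx
  · intro b hb
    obtain ⟨-, d, hd, hdb⟩ := hsub hb
    exact ⟨d, hd, hdb.symm⟩

omit [Finite V] in
lemma IsComp.disjoint_cn {u : V} (hu : u ∉ cn G s) {C : Set V} (hC : IsComp G (cn G u) C)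
    (hsC : s ∉ C) : Disjoint C (cn G s) := by
  have hsu : s ∉ cn G u := by
    rintro (rfl | h)
    · exact hu (Or.inl rfl)
    · exact hu (Or.inr h.symm)
  rw [Set.disjoint_left]
  rintro c hc (rfl | h)
  · exact hsC hc
  · exact hsC (hC.mem_of_adj hc h.symm hsu)

omit [Finite V] in
lemma IsComp.nbs_subset {u : V} {C : Set V} (hC : IsComp G (cn G u) C) :
    nbs G C ⊆ G.neighborSet u := by
  intro b hb
  rcases hC.2.2 hb with rfl | h
  · obtain ⟨-, d, hd, hdb⟩ := hb
    exact absurd (Or.inr hdb.symm) (Set.disjoint_left.1 hC.2.1 hd)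
  · exact h

lemma IsComp.eight_le (hI : Inst G s) (hs : NoInst (Nat.card V)) {u : V} (hu : u ∉ cn G s)
    {C : Set V} (hC : IsComp G (cn G u) C) (hsC : s ∉ C) : 8 ≤ (nbs G C).ncard := by
  have hsu : s ∉ cn G u := by
    rintro (rfl | h)
    · exact hu (Or.inl rfl)
    · exact hu (Or.inr h.symm)
  have huN : u ∉ nbs G C := fun h => G.loopless.irrefl u (hC.nbs_subset h)
  have huC : u ∉ C := fun h => Set.disjoint_left.1 hC.2.1 h (Or.inl rfl)
  refine eight_le_ncard_nbs hI hs hC.1.1 (hC.disjoint_cn hu hsC) (conn_singleton u)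
    (Set.disjoint_singleton_left.2 huC) (Set.disjoint_singleton_left.2 huN)
    (fun b hb => ⟨u, rfl, (hC.nbs_subset hb).symm⟩) (p := u) (q := s) ?_ ?_ ?_
  · rintro rfl
    exact hu (Or.inl rfl)
  · rintro (h | h)
    · exact huC h
    · exact huN h
  · rintro (h | h)
    · exact hsC h
    · exact hsu (hC.2.2 h)

end

/-! A certificate checker for graphs on at most eleven vertices.  A partial graph is a pair of
numbers `e`, `n` whose bits at position `16 * i + j` record that `ij` is a known edge or a known
nonedge.  The bit of `T` at position `M` says that the vertex set `M` is too large to consist of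
nonneighbours of one vertex. -/

def row (e i : ℕ) : ℕ := Nat.mod (Nat.shiftRight e (Nat.mul 16 i)) 2048

def bt (i : ℕ) : ℕ := Nat.shiftLeft 1 i

def addPair (e i j : ℕ) : ℕ :=
  Nat.lor e (Nat.lor (bt (Nat.add (Nat.mul 16 i) j)) (bt (Nat.add (Nat.mul 16 j) i)))

def crowded (T M : ℕ) : Bool := Nat.beq (Nat.mod (Nat.shiftRight T M) 2) 1

/-- Evaluate `x` before passing it on. -/
noncomputable def force {α : Type} (x : ℕ) (k : ℕ → α) : α :=
  Nat.rec (motive := fun _ => α) (k 0) (fun x _ => k (Nat.succ x)) x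

/-- `p` holds for all members of `l`. -/
noncomputable def allB {α : Type} (p : α → Bool) (l : List α) : Bool :=
  List.rec (motive := fun _ => Bool) true (fun a _ ih => p a && ih) l

/-- The numbers below `k` satisfying `p`. -/
noncomputable def selB (p : ℕ → Bool) (k : ℕ) : List ℕ :=
  Nat.rec (motive := fun _ => List ℕ) [] (fun v ih => bif p v then v :: ih else ih) k

/-- The data of a bag `{a, b}`: its vertices, the known neighbours of its vertices, and the
known nonneighbours of `a` and of `b`. -/
inductive Bag where
  | mk (B N R R' : ℕ)

noncomputable def touchB (T : ℕ) (p q : Bag) : Bool :=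
  Bag.rec (motive := fun _ => Bool) (fun B N R R' =>
    Bag.rec (motive := fun _ => Bool) (fun B₂ _ Q Q' =>
      !(Nat.beq (Nat.land N B₂) 0) || crowded T (Nat.lor R B₂) || crowded T (Nat.lor Q B)
        || crowded T (Nat.lor R' B₂) || crowded T (Nat.lor Q' B)) q) p

noncomputable def sepB (p q : Bag) : Bool :=
  Bag.rec (motive := fun _ => Bool) (fun B _ _ _ =>
    Bag.rec (motive := fun _ => Bool) (fun B₂ _ _ _ => Nat.beq (Nat.land B B₂) 0) q) p

noncomputable def withBag {α : Type} (e n a b : ℕ) (k : Bag → α) : α :=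
  force (Nat.lor (bt a) (bt b)) fun B => force (Nat.lor (row e a) (row e b)) fun N =>
  force (Nat.lor (row n a) (bt a)) fun R => force (Nat.lor (row n b) (bt b)) fun R' =>
    k (.mk B N R R')

noncomputable def okPairs (T e n : ℕ) (l : List (ℕ × ℕ)) : List Bag → Bool :=
  List.rec (motive := fun _ => List Bag → Bool) (fun _ => true) (fun p _ ih acc =>
    withBag e n p.1 p.2 fun c => allB (fun q => sepB c q && touchB T c q) acc && ih (c :: acc)) l

noncomputable def okBag (k T e n x : ℕ) (p : ℕ × ℕ) : Bool :=
  Nat.blt p.1 k && Nat.blt p.2 k && !(Nat.beq p.1 x) && !(Nat.beq p.2 x) &&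
    (Nat.beq p.1 p.2 ||
      withBag e n p.1 p.1 fun c => withBag e n p.2 p.2 fun c' => touchB T c c')

noncomputable def leafOK (k T e n x : ℕ) (l : List (ℕ × ℕ)) : Bool :=
  Nat.blt x k && Nat.beq (List.rec (motive := fun _ => ℕ) 0 (fun _ _ ih => Nat.succ ih) l) 6 &&
    allB (okBag k T e n x) l && okPairs T e n l []

def twinRow (e i p : ℕ) : Bool :=
  Nat.beq (Nat.lor (row e i) (Nat.lor (bt i) (bt p))) (Nat.lor (row e p) (Nat.lor (bt i) (bt p)))

/-- `i` and `p` are interchangeable, and `p ≠ j`. -/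
def twin (e n i j p : ℕ) : Bool := twinRow n i p && twinRow e i p && !(Nat.beq p j)

noncomputable def addAll (e p : ℕ) (l : List ℕ) : ℕ :=
  List.rec (motive := fun _ => ℕ) e
    (fun q _ ih => bif Nat.beq p q then ih else addPair ih p q) l

noncomputable def addProd (e : ℕ) (l l' : List ℕ) : ℕ :=
  List.rec (motive := fun _ => ℕ) e (fun p _ ih => addAll ih p l') l

/-- Add the edge `ij` and all edges equivalent to it under exchanging twins. -/
noncomputable def addOrbit (k e n i j : ℕ) : ℕ :=
  addProd e (selB (twin e n i j) k) (selB (twin e n j i) k)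

noncomputable def pairsOf (r s : ℕ) : List (ℕ × ℕ) :=
  Nat.rec (motive := fun _ => ℕ → List (ℕ × ℕ)) (fun _ => [])
    (fun _ ih s => force (Nat.mod s 16) fun a => force (Nat.mod (Nat.div s 16) 16) fun b =>
      (a, b) :: ih (Nat.div s 256)) r s

noncomputable def maskOf (x : ℕ) (l : List (ℕ × ℕ)) : ℕ :=
  List.rec (motive := fun _ => ℕ) (bt x) (fun p _ ih => Nat.lor ih (Nat.lor (bt p.1) (bt p.2))) l

noncomputable def withSingles (k M : ℕ) (l : List (ℕ × ℕ)) : List (ℕ × ℕ) :=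
  Nat.rec (motive := fun _ => List (ℕ × ℕ)) l
    (fun v ih => bif Nat.beq (Nat.land M (bt v)) 0 then (v, v) :: ih else ih) k

noncomputable def bagsOf (k x r s : ℕ) : List (ℕ × ℕ) :=
  force (maskOf x (pairsOf r s)) fun M => withSingles k M (pairsOf r s)

/-- The known nonedges are exactly those of the table `h`, and all other pairs are edges. -/
noncomputable def excOK (k T n : ℕ) (h : List ℕ) : Bool :=
  allB (fun i => Nat.beq (row n i) (h.getD i 0) && allB (fun j => (h.getD i 0).testBit j ||
    Nat.beq i j || crowded T (Nat.lor (Nat.lor (row n i) (bt i)) (Nat.lor (bt j) (bt j))))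
      (List.range k)) (List.range k)

/-- Read a certificate from the stream `s`; the result is the unread part of the stream. -/
noncomputable def run (k T r : ℕ) (h : List ℕ) (f s e n : ℕ) : Option ℕ :=
  Nat.rec (motive := fun _ => ℕ → ℕ → ℕ → Option ℕ) (fun _ _ _ => none)
    (fun _ ih s e n => force s fun s => force e fun e => force n fun n =>
      bif Nat.beq (Nat.mod s 16) 15 then
        force (Nat.mod (Nat.div s 16) 16) fun i => force (Nat.mod (Nat.div s 256) 16) fun j =>
          bif Nat.blt i k && Nat.blt j k && !(Nat.beq i j) then
            Option.rec (motive := fun _ => Option ℕ) none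
              (fun s' => ih s' (addOrbit k e n i j) n) (ih (Nat.div s 4096) e (addPair n i j))
          else none
      else bif Nat.beq (Nat.mod s 16) 14 then
        bif excOK k T n h && !(Nat.beq (h.length) 0) then some (Nat.div s 16) else none
      else force (Nat.mod s 16) fun x => bif leafOK k T e n x (bagsOf k x r (Nat.div s 16)) then
        some (Nat.div s (Nat.pow 16 (Nat.add (Nat.mul 2 r) 1)))
      else none) f s e n

/-- A certificate whose top part is given explicitly and whose subtrees are packed in numbers. -/
inductive Cert where
  | pk (s : ℕ)
  | br (i j : ℕ) (t t' : Cert)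

noncomputable def Cert.ok (k T r : ℕ) (h : List ℕ) (c : Cert) : ℕ → ℕ → Bool :=
  Cert.rec (motive := fun _ => ℕ → ℕ → Bool)
    (fun s e n => Option.isSome (run k T r h 200 s e n))
    (fun i j _ _ ih ih' e n => force e fun e => force n fun n =>
      Nat.blt i k && Nat.blt j k && !(Nat.beq i j) &&
      ih e (addPair n i j) && ih' (addOrbit k e n i j) n) c

lemma force_eq {α : Type} (x : ℕ) (k : ℕ → α) : force x k = k x := by
  cases x <;> rfl

lemma allB_eq_true {α : Type} {p : α → Bool} {l : List α} :
    allB p l = true ↔ ∀ a ∈ l, p a = true := by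
  induction l with
  | nil => simp [allB]
  | cons a l ih =>
    have : allB p (a :: l) = (p a && allB p l) := rfl
    simp [this, ih]

lemma mem_selB {p : ℕ → Bool} {k v : ℕ} : v ∈ selB p k ↔ v < k ∧ p v = true := by
  induction k with
  | zero => simp [selB]
  | succ k ih =>
    have : selB p (k + 1) = bif p k then k :: selB p k else selB p k := rfl
    rw [this]
    cases hp : p k
    · simp only [cond_false, ih]
      grind
    · simp only [cond_true, List.mem_cons, ih]
      grind

lemma nat_blt {a b : ℕ} : Nat.blt a b = true ↔ a < b := by
  change Nat.ble (a + 1) b = true ↔ _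
  rw [Nat.ble_eq]
  rfl

lemma nat_beq {a b : ℕ} : Nat.beq a b = true ↔ a = b := by
  rw [Nat.beq_eq]

lemma testBit_bt (i j : ℕ) : (bt i).testBit j = decide (i = j) := by
  have : bt i = 2 ^ i := by
    show 1 <<< i = _
    rw [Nat.shiftLeft_eq, one_mul]
  rw [this, Nat.testBit_two_pow]

lemma testBit_row (e i j : ℕ) : (row e i).testBit j = (decide (j < 11) && e.testBit (16 * i + j)) := by
  have : row e i = (e >>> (16 * i)) % 2 ^ 11 := rfl
  rw [this, Nat.testBit_mod_two_pow, Nat.testBit_shiftRight]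

/-- The pair `ij` is recorded in `e`. -/
def KN (e i j : ℕ) : Prop := (row e i).testBit j = true

lemma kn_addPair {e i j x y : ℕ} (hi : i < 11) (hj : j < 11) :
    KN (addPair e i j) x y ↔ KN e x y ∨ (x = i ∧ y = j) ∨ (x = j ∧ y = i) := by
  have h : addPair e i j = e ||| (bt (16 * i + j) ||| bt (16 * j + i)) := rfl
  simp only [KN, testBit_row, h, Nat.testBit_or, testBit_bt, Bool.and_eq_true, Bool.or_eq_true,
    decide_eq_true_eq]
  constructor
  · rintro ⟨h1, h2 | h2 | h2⟩
    · exact Or.inl ⟨h1, h2⟩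
    · right; left; omega
    · right; right; omega
  · rintro (⟨h1, h2⟩ | ⟨rfl, rfl⟩ | ⟨rfl, rfl⟩)
    · exact ⟨h1, Or.inl h2⟩
    · exact ⟨hj, by simp⟩
    · exact ⟨hi, by simp⟩

/-- A graph on the numbers below `k` with at most `m` nonneighbours per vertex. -/
structure Good (k m : ℕ) (A : ℕ → ℕ → Prop) : Prop where
  symm : ∀ x y, A x y → A y x
  irrefl : ∀ x, ¬ A x x
  bound : ∀ i < k, ∀ s : Finset ℕ, (∀ j ∈ s, j < k ∧ ¬ A i j) → s.card ≤ m

/-- The graph `A` completes the partial graph `e`, `n`. -/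
structure Cons (k : ℕ) (A : ℕ → ℕ → Prop) (e n : ℕ) : Prop where
  edge : ∀ x y, KN e x y → A x y
  edge_symm : ∀ x y, KN e x y → KN e y x
  non : ∀ x y, KN n x y → ¬ A x y ∧ x < k ∧ y < k
  non_symm : ∀ x y, KN n x y → KN n y x

/-- The bags `p` and `q` are disjoint and touch. -/
def Link (A : ℕ → ℕ → Prop) (p q : ℕ × ℕ) : Prop :=
  (p.1 ≠ q.1 ∧ p.1 ≠ q.2 ∧ p.2 ≠ q.1 ∧ p.2 ≠ q.2) ∧
    (A p.1 q.1 ∨ A p.1 q.2 ∨ A p.2 q.1 ∨ A p.2 q.2)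

/-- There are six bags of size at most two avoiding one vertex. -/
def HasModel (k : ℕ) (A : ℕ → ℕ → Prop) : Prop :=
  ∃ x < k, ∃ l : List (ℕ × ℕ), l.length = 6 ∧
    (∀ p ∈ l, p.1 < k ∧ p.2 < k ∧ p.1 ≠ x ∧ p.2 ≠ x ∧ (p.1 = p.2 ∨ A p.1 p.2)) ∧
    l.Pairwise (Link A)

/-- The complement of `A` is given by the table `h` up to relabelling. -/
def IsExc (k : ℕ) (h : List ℕ) (A : ℕ → ℕ → Prop) : Prop :=
  h ≠ [] ∧ ∃ π : Equiv.Perm ℕ, (∀ i, π i < k ↔ i < k) ∧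
    ∀ i < k, ∀ j < k, A (π i) (π j) ↔ ¬ (i = j ∨ (h.getD i 0).testBit j = true)

def Concl (k : ℕ) (h : List ℕ) (A : ℕ → ℕ → Prop) : Prop := HasModel k A ∨ IsExc k h A

/-- The table `T` marks only sets of more than `m` elements. -/
def Marks (T m : ℕ) : Prop :=
  ∀ M < 2048, crowded T M = true → m < ((Finset.range 11).filter fun j => M.testBit j = true).card

section
variable {k m T e n : ℕ} {h : List ℕ} {A : ℕ → ℕ → Prop}

lemma row_lt (e i : ℕ) : row e i < 2 ^ 11 := Nat.mod_lt _ (by norm_num)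

lemma bt_lt {i : ℕ} (hi : i < 11) : bt i < 2 ^ 11 := by
  show 1 <<< i < _
  rw [Nat.shiftLeft_eq, one_mul]
  exact Nat.pow_lt_pow_right (by norm_num) hi

lemma adj_of_crowded (hT : Marks T m) (hk : k ≤ 11) (hA : Good k m A) (hc : Cons k A e n)
    {a c d : ℕ} (ha : a < k) (hck : c < k) (hd : d < k)
    (h : crowded T (Nat.lor (Nat.lor (row n a) (bt a)) (Nat.lor (bt c) (bt d))) = true) :
    A a c ∨ A a d := by
  by_contra! hcon
  change crowded T ((row n a ||| bt a) ||| (bt c ||| bt d)) = true at h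
  have hlt : ((row n a ||| bt a) ||| (bt c ||| bt d)) < 2 ^ 11 :=
    Nat.or_lt_two_pow (Nat.or_lt_two_pow (row_lt _ _) (bt_lt (by omega)))
      (Nat.or_lt_two_pow (bt_lt (by omega)) (bt_lt (by omega)))
  refine absurd (hA.bound a ha _ ?_) (not_le.2 (hT _ hlt h))
  intro j hj
  simp only [Finset.mem_filter, Nat.testBit_or, testBit_bt, Bool.or_eq_true,
    decide_eq_true_eq] at hj
  rcases hj.2 with (h1 | rfl) | rfl | rfl
  · exact ⟨(hc.non _ _ h1).2.2, (hc.non _ _ h1).1⟩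
  · exact ⟨ha, hA.irrefl _⟩
  · exact ⟨hck, hcon.1⟩
  · exact ⟨hd, hcon.2⟩

/-- The data of the bag `p`. -/
def bagOf (e n : ℕ) (p : ℕ × ℕ) : Bag :=
  .mk (Nat.lor (bt p.1) (bt p.2)) (Nat.lor (row e p.1) (row e p.2))
    (Nat.lor (row n p.1) (bt p.1)) (Nat.lor (row n p.2) (bt p.2))

lemma withBag_eq {α : Type} (a b : ℕ) (f : Bag → α) :
    withBag e n a b f = f (bagOf e n (a, b)) := by
  simp only [withBag, force_eq, bagOf]

lemma testBit_of_land {x y : ℕ} (h : Nat.land x y ≠ 0) :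
    ∃ j, x.testBit j = true ∧ y.testBit j = true := by
  obtain ⟨j, hj⟩ := Nat.exists_testBit_of_ne_zero h
  change (x &&& y).testBit j = true at hj
  rw [Nat.testBit_and, Bool.and_eq_true] at hj
  exact ⟨j, hj⟩

lemma touch_of_touchB (hT : Marks T m) (hk : k ≤ 11) (hA : Good k m A) (hc : Cons k A e n)
    {p q : ℕ × ℕ} (hp : p.1 < k ∧ p.2 < k) (hq : q.1 < k ∧ q.2 < k)
    (h : touchB T (bagOf e n p) (bagOf e n q) = true) :
    A p.1 q.1 ∨ A p.1 q.2 ∨ A p.2 q.1 ∨ A p.2 q.2 := by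
  simp only [touchB, bagOf, Bool.or_eq_true, Bool.not_eq_true', ← Bool.not_eq_true, nat_beq] at h
  rcases h with (((h | h) | h) | h) | h
  · obtain ⟨j, h1, h2⟩ := testBit_of_land h
    change (row e p.1 ||| row e p.2).testBit j = true at h1
    change (bt q.1 ||| bt q.2).testBit j = true at h2
    simp only [Nat.testBit_or, testBit_bt, Bool.or_eq_true, decide_eq_true_eq] at h1 h2
    have h1' := h1.imp (hc.edge _ _) (hc.edge _ _)
    rcases h2 with rfl | rfl <;> tauto
  · have := adj_of_crowded hT hk hA hc hp.1 hq.1 hq.2 h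
    tauto
  · have := (adj_of_crowded hT hk hA hc hq.1 hp.1 hp.2 h).imp (hA.symm _ _) (hA.symm _ _)
    tauto
  · have := adj_of_crowded hT hk hA hc hp.2 hq.1 hq.2 h
    tauto
  · have := (adj_of_crowded hT hk hA hc hq.2 hp.1 hp.2 h).imp (hA.symm _ _) (hA.symm _ _)
    tauto

lemma sep_of_sepB {p q : ℕ × ℕ} (h : sepB (bagOf e n p) (bagOf e n q) = true) :
    p.1 ≠ q.1 ∧ p.1 ≠ q.2 ∧ p.2 ≠ q.1 ∧ p.2 ≠ q.2 := by
  simp only [sepB, bagOf, nat_beq] at h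
  change (bt p.1 ||| bt p.2) &&& (bt q.1 ||| bt q.2) = 0 at h
  have key : ∀ j, ¬ ((p.1 = j ∨ p.2 = j) ∧ (q.1 = j ∨ q.2 = j)) := by
    intro j hj
    have := congrArg (fun x => x.testBit j) h
    simp only [Nat.testBit_and, Nat.testBit_or, testBit_bt, Nat.zero_testBit,
      Bool.and_eq_false_iff, Bool.or_eq_false_iff, decide_eq_false_iff_not] at this
    tauto
  have h1 := key p.1
  have h2 := key p.2
  refine ⟨?_, ?_, ?_, ?_⟩ <;> intro h <;> simp_all

lemma Link.symm (hA : Good k m A) {p q : ℕ × ℕ} (h : Link A p q) : Link A q p := by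
  obtain ⟨⟨h1, h2, h3, h4⟩, h5⟩ := h
  refine ⟨⟨h1.symm, h3.symm, h2.symm, h4.symm⟩, ?_⟩
  rcases h5 with h | h | h | h <;> have := hA.symm _ _ h <;> tauto

lemma pairwise_of_okPairs (hT : Marks T m) (hk : k ≤ 11) (hA : Good k m A) (hc : Cons k A e n)
    (l : List (ℕ × ℕ)) (hl : ∀ p ∈ l, p.1 < k ∧ p.2 < k) (l' : List (ℕ × ℕ))
    (hl' : ∀ p ∈ l', p.1 < k ∧ p.2 < k)
    (h : okPairs T e n l (l'.map (bagOf e n)) = true) :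
    l.Pairwise (Link A) ∧ ∀ p ∈ l, ∀ q ∈ l', Link A p q := by
  induction l generalizing l' with
  | nil => simp
  | cons p l ih =>
    have h1 : (allB (fun q => sepB (bagOf e n p) q && touchB T (bagOf e n p) q)
        (l'.map (bagOf e n)) && okPairs T e n l ((p :: l').map (bagOf e n))) = true := by
      have : okPairs T e n (p :: l) (l'.map (bagOf e n)) =
        withBag e n p.1 p.2 fun c => allB (fun q => sepB c q && touchB T c q)
          (l'.map (bagOf e n)) && okPairs T e n l (c :: l'.map (bagOf e n)) := rfl
      rw [this, withBag_eq] at h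
      exact h
    rw [Bool.and_eq_true, allB_eq_true] at h1
    obtain ⟨h1, h2⟩ := h1
    have hp := hl p (by simp)
    obtain ⟨h3, h4⟩ := ih (fun p hp => hl p (by simp [hp])) (p :: l')
      (by simpa using ⟨hp, fun a b hab => hl' (a, b) hab⟩) h2
    refine ⟨List.pairwise_cons.2 ⟨fun q hq => (h4 q hq p (by simp)).symm hA, h3⟩, ?_⟩
    intro r hr q hq
    rcases List.mem_cons.1 hr with rfl | hr
    · have := h1 _ (List.mem_map_of_mem hq)
      rw [Bool.and_eq_true] at this
      exact ⟨sep_of_sepB this.1, touch_of_touchB hT hk hA hc hp (hl' q hq) this.2⟩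
    · exact h4 r hr q (by simp [hq])

lemma hasModel_of_leafOK (hT : Marks T m) (hk : k ≤ 11) (hA : Good k m A) (hc : Cons k A e n)
    {x : ℕ} {l : List (ℕ × ℕ)} (h : leafOK k T e n x l = true) : HasModel k A := by
  have hlen : ∀ l : List (ℕ × ℕ),
      (List.rec (motive := fun _ => ℕ) 0 (fun _ _ ih => Nat.succ ih) l : ℕ) = l.length := by
    intro l
    induction l with
    | nil => rfl
    | cons a l ih => simp [ih]
  simp only [leafOK, Bool.and_eq_true, nat_blt, nat_beq, hlen, allB_eq_true] at h
  obtain ⟨⟨⟨hx, hl⟩, hb⟩, hp⟩ := h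
  have hb' : ∀ p ∈ l, p.1 < k ∧ p.2 < k ∧ p.1 ≠ x ∧ p.2 ≠ x ∧ (p.1 = p.2 ∨ A p.1 p.2) := by
    intro p hp
    have := hb p hp
    simp only [okBag, Bool.and_eq_true, nat_blt, Bool.or_eq_true, nat_beq, withBag_eq,
      Bool.not_eq_true', ← Bool.not_eq_true] at this
    obtain ⟨⟨⟨⟨h1, h2⟩, h3⟩, h4⟩, h5⟩ := this
    refine ⟨h1, h2, h3, h4, h5.imp_right fun h => ?_⟩
    simpa using touch_of_touchB hT hk hA hc (p := (p.1, p.1)) (q := (p.2, p.2)) ⟨h1, h1⟩ ⟨h2, h2⟩ h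
  exact ⟨x, hx, l, hl, hb', (pairwise_of_okPairs hT hk hA hc l
    (fun p hp => ⟨(hb' p hp).1, (hb' p hp).2.1⟩) [] (by simp) hp).1⟩

lemma isExc_of_excOK (hT : Marks T m) (hk : k ≤ 11) (hA : Good k m A) (hc : Cons k A e n)
    (h0 : h ≠ []) (hx : excOK k T n h = true) : IsExc k h A := by
  simp only [excOK, allB_eq_true, Bool.and_eq_true, Bool.or_eq_true, nat_beq,
    List.mem_range] at hx
  refine ⟨h0, Equiv.refl _, fun _ => Iff.rfl, fun i hi j hj => ?_⟩
  obtain ⟨h1, h2⟩ := hx i hi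
  constructor
  · rintro h3 (rfl | h4)
    · exact hA.irrefl _ h3
    · rw [← h1] at h4
      exact (hc.non i j h4).1 h3
  · intro h3
    rcases h2 j hj with (h4 | h4) | h4
    · exact absurd (Or.inr h4) h3
    · exact absurd (Or.inl h4) h3
    · simpa using adj_of_crowded hT hk hA hc hi hj hj h4

lemma kn_swap {e i p : ℕ} (hs : ∀ x y, KN e x y → KN e y x) (ht : twinRow e i p = true)
    {x y : ℕ} (hxy : x ≠ y) (h : KN e x y) : KN e (Equiv.swap i p x) (Equiv.swap i p y) := by
  have hrow : ∀ y, y ≠ i → y ≠ p → (KN e i y ↔ KN e p y) := by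
    intro y h1 h2
    rw [twinRow, nat_beq] at ht
    change row e i ||| (bt i ||| bt p) = row e p ||| (bt i ||| bt p) at ht
    have := congrArg (fun x => x.testBit y) ht
    simp only [Nat.testBit_or, testBit_bt] at this
    simpa [KN, h1.symm, h2.symm] using this
  rw [Equiv.swap_apply_def, Equiv.swap_apply_def]
  split_ifs <;> grind

lemma Cons.swap (hA : Good k m A) (hc : Cons k A e n) {i p : ℕ} (h1 : twinRow e i p = true) (h2 : twinRow n i p = true) :
    Cons k (fun x y => A (Equiv.swap i p x) (Equiv.swap i p y)) e n where
  edge x y hxy := by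
    rcases eq_or_ne x y with rfl | hne
    · exact absurd (hc.edge _ _ hxy) (hA.irrefl _)
    · exact hc.edge _ _ (kn_swap hc.edge_symm h1 hne hxy)
  edge_symm := hc.edge_symm
  non x y hxy := by
    refine ⟨?_, (hc.non _ _ hxy).2⟩
    rcases eq_or_ne x y with rfl | hne
    · exact hA.irrefl _
    · exact (hc.non _ _ (kn_swap hc.non_symm h2 hne hxy)).1
  non_symm := hc.non_symm

lemma swap_lt {i p : ℕ} (hi : i < k) (hp : p < k) (x : ℕ) : Equiv.swap i p x < k ↔ x < k := by
  rw [Equiv.swap_apply_def]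
  split_ifs <;> grind

lemma Good.swap (hA : Good k m A) {i p : ℕ} (hi : i < k) (hp : p < k) :
    Good k m (fun x y => A (Equiv.swap i p x) (Equiv.swap i p y)) where
  symm x y h := hA.symm _ _ h
  irrefl x := hA.irrefl _
  bound x hx s hs := by
    rw [← Finset.card_map (Equiv.swap i p).toEmbedding]
    refine hA.bound _ ((swap_lt hi hp x).2 hx) _ ?_
    intro j hj
    obtain ⟨y, hy, rfl⟩ := Finset.mem_map.1 hj
    exact ⟨(swap_lt hi hp y).2 (hs y hy).1, (hs y hy).2⟩

lemma Concl.of_swap {i p : ℕ} (hi : i < k) (hp : p < k)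
    (hc : Concl k h (fun x y => A (Equiv.swap i p x) (Equiv.swap i p y))) : Concl k h A := by
  rcases hc with ⟨x, hx, l, hl, h1, h2⟩ | ⟨h0, π, h1, h2⟩
  · refine Or.inl ⟨Equiv.swap i p x, (swap_lt hi hp x).2 hx,
      l.map (Prod.map (Equiv.swap i p) (Equiv.swap i p)), by simpa using hl, ?_, ?_⟩
    · intro q hq
      obtain ⟨r, hr, rfl⟩ := List.mem_map.1 hq
      have := h1 r hr
      simpa [swap_lt hi hp] using this
    · rw [List.pairwise_map]
      refine h2.imp fun {a b} hab => ?_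
      simpa [Link] using hab
  · refine Or.inr ⟨h0, π.trans (Equiv.swap i p), fun j => ?_, fun a ha b hb => h2 a ha b hb⟩
    rw [Equiv.trans_apply, swap_lt hi hp, h1]

lemma kn_addAll {e p x y : ℕ} (hp : p < 11) {l : List ℕ} (hl : ∀ q ∈ l, q < 11) :
    KN (addAll e p l) x y ↔
      KN e x y ∨ ∃ q ∈ l, p ≠ q ∧ ((x = p ∧ y = q) ∨ (x = q ∧ y = p)) := by
  induction l with
  | nil => simp [addAll]
  | cons q l ih =>
    have h1 : addAll e p (q :: l) =
      bif Nat.beq p q then addAll e p l else addPair (addAll e p l) p q := rfl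
    have ih := ih fun q hq => hl q (by simp [hq])
    rw [h1]
    by_cases h : p = q
    · rw [nat_beq.2 h, cond_true, ih]
      simp [h]
    · rw [Bool.eq_false_iff.2 (fun hh => h (nat_beq.1 hh)), cond_false,
        kn_addPair hp (hl q (by simp)), ih]
      simp only [List.mem_cons, exists_eq_or_imp]
      rw [or_assoc]
      exact or_congr_right ⟨fun hh => hh.elim Or.inr fun hh => Or.inl ⟨h, hh⟩,
        fun hh => hh.elim (fun hh => Or.inr hh.2) Or.inl⟩

lemma kn_addProd {e x y : ℕ} {l l' : List ℕ} (hl : ∀ q ∈ l, q < 11) (hl' : ∀ q ∈ l', q < 11) :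
    KN (addProd e l l') x y ↔ KN e x y ∨
      ∃ p ∈ l, ∃ q ∈ l', p ≠ q ∧ ((x = p ∧ y = q) ∨ (x = q ∧ y = p)) := by
  induction l with
  | nil => simp [addProd]
  | cons p l ih =>
    have h1 : addProd e (p :: l) l' = addAll (addProd e l l') p l' := rfl
    rw [h1, kn_addAll (hl p (by simp)) hl', ih fun q hq => hl q (by simp [hq])]
    simp only [List.mem_cons, exists_eq_or_imp]
    rw [or_assoc]
    exact or_congr_right or_comm

lemma concl_of_branch (hk : k ≤ 11) {i j : ℕ} (hi : i < k) (hj : j < k) (hij : i ≠ j)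
    (h1 : ∀ A, Good k m A → Cons k A e (addPair n i j) → Concl k h A)
    (h2 : ∀ A, Good k m A → Cons k A (addOrbit k e n i j) n → Concl k h A)
    (hA : Good k m A) (hc : Cons k A e n) : Concl k h A := by
  have hmem : ∀ {i j p}, p ∈ selB (twin e n i j) k → p < k ∧ twinRow n i p = true ∧
      twinRow e i p = true ∧ p ≠ j := by
    intro i j p hp
    simpa [mem_selB, twin, and_assoc, nat_beq, ← Bool.not_eq_true] using hp
  by_cases hall : ∀ p ∈ selB (twin e n i j) k, ∀ q ∈ selB (twin e n j i) k, p ≠ q → A p q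
  · have hkn : ∀ {x y}, KN (addOrbit k e n i j) x y ↔ KN e x y ∨
        ∃ p ∈ selB (twin e n i j) k, ∃ q ∈ selB (twin e n j i) k,
          p ≠ q ∧ ((x = p ∧ y = q) ∨ (x = q ∧ y = p)) := fun {x y} =>
      kn_addProd (fun q hq => (hmem hq).1.trans_le hk) fun q hq => (hmem hq).1.trans_le hk
    refine h2 A hA ⟨?_, ?_, hc.non, hc.non_symm⟩
    · intro x y hxy
      rcases hkn.1 hxy with h | ⟨p, hp, q, hq, hpq, ⟨rfl, rfl⟩ | ⟨rfl, rfl⟩⟩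
      · exact hc.edge _ _ h
      · exact hall _ hp _ hq hpq
      · exact hA.symm _ _ (hall _ hp _ hq hpq)
    · intro x y hxy
      rw [hkn] at hxy ⊢
      rcases hxy with h | ⟨p, hp, q, hq, hpq, h⟩
      · exact Or.inl (hc.edge_symm _ _ h)
      · exact Or.inr ⟨p, hp, q, hq, hpq, by tauto⟩
  · push Not at hall
    obtain ⟨p, hp, q, hq, hpq, hApq⟩ := hall
    obtain ⟨hpk, hp1, hp2, hpj⟩ := hmem hp
    obtain ⟨hqk, hq1, hq2, hqi⟩ := hmem hq
    refine Concl.of_swap hi hpk (Concl.of_swap hj hqk (h1 _ ((hA.swap hi hpk).swap hj hqk) ?_))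
    have hc' := (hc.swap hA hp2 hp1).swap (hA.swap hi hpk) hq2 hq1
    have hkey : ¬ A (Equiv.swap i p (Equiv.swap j q i)) (Equiv.swap i p (Equiv.swap j q j)) := by
      rw [Equiv.swap_apply_of_ne_of_ne hij hqi.symm, Equiv.swap_apply_left,
        Equiv.swap_apply_left, Equiv.swap_apply_of_ne_of_ne hqi hpq.symm]
      exact hApq
    refine ⟨hc'.edge, hc'.edge_symm, ?_, ?_⟩
    · intro x y hxy
      rcases (kn_addPair (by omega) (by omega)).1 hxy with h | ⟨rfl, rfl⟩ | ⟨rfl, rfl⟩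
      · exact hc'.non _ _ h
      · exact ⟨hkey, hi, hj⟩
      · exact ⟨fun h => hkey (hA.symm _ _ h), hj, hi⟩
    · intro x y hxy
      rw [kn_addPair (by omega) (by omega)] at hxy ⊢
      have := hc.non_symm x y
      tauto

lemma concl_of_run (hT : Marks T m) (hk : k ≤ 11) {r : ℕ} (f : ℕ) : ∀ s e n s',
    run k T r h f s e n = some s' → ∀ A, Good k m A → Cons k A e n → Concl k h A := by
  induction f with
  | zero => intro s e n s' hr; cases hr
  | succ f ih =>
    intro s e n s' hr A hA hc
    have h1 : run k T r h (f + 1) s e n = bif Nat.beq (Nat.mod s 16) 15 then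
          bif Nat.blt (Nat.mod (Nat.div s 16) 16) k && Nat.blt (Nat.mod (Nat.div s 256) 16) k &&
              !(Nat.beq (Nat.mod (Nat.div s 16) 16) (Nat.mod (Nat.div s 256) 16)) then
            Option.rec (motive := fun _ => Option ℕ) none
              (fun s' => run k T r h f s' (addOrbit k e n (Nat.mod (Nat.div s 16) 16)
                (Nat.mod (Nat.div s 256) 16)) n) (run k T r h f (Nat.div s 4096) e
                  (addPair n (Nat.mod (Nat.div s 16) 16) (Nat.mod (Nat.div s 256) 16)))
          else none
      else bif Nat.beq (Nat.mod s 16) 14 then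
        bif excOK k T n h && !(Nat.beq (h.length) 0) then some (Nat.div s 16) else none
      else bif leafOK k T e n (Nat.mod s 16) (bagsOf k (Nat.mod s 16) r (Nat.div s 16)) then
        some (Nat.div s (Nat.pow 16 (Nat.add (Nat.mul 2 r) 1)))
      else none := by
      have h2 : run k T r h (f + 1) s e n = force s fun s => force e fun e => force n fun n =>
          bif Nat.beq (Nat.mod s 16) 15 then
            force (Nat.mod (Nat.div s 16) 16) fun i => force (Nat.mod (Nat.div s 256) 16) fun j =>
              bif Nat.blt i k && Nat.blt j k && !(Nat.beq i j) then
                Option.rec (motive := fun _ => Option ℕ) none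
                  (fun s' => run k T r h f s' (addOrbit k e n i j) n)
                  (run k T r h f (Nat.div s 4096) e (addPair n i j))
              else none
          else bif Nat.beq (Nat.mod s 16) 14 then
            bif excOK k T n h && !(Nat.beq (h.length) 0) then some (Nat.div s 16) else none
          else force (Nat.mod s 16) fun x =>
            bif leafOK k T e n x (bagsOf k x r (Nat.div s 16)) then
              some (Nat.div s (Nat.pow 16 (Nat.add (Nat.mul 2 r) 1)))
            else none := rfl
      rw [h2]
      simp only [force_eq]
    rw [h1] at hr
    generalize Nat.mod (Nat.div s 16) 16 = i at hr
    generalize Nat.mod (Nat.div s 256) 16 = j at hr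
    rcases ht : Nat.beq (Nat.mod s 16) 15 with _ | _
    · rw [ht, cond_false] at hr
      rcases ht : Nat.beq (Nat.mod s 16) 14 with _ | _
      · rw [ht, cond_false] at hr
        rcases hl : leafOK k T e n (Nat.mod s 16) (bagsOf k (Nat.mod s 16) r (Nat.div s 16))
          with _ | _
        · rw [hl] at hr; cases hr
        · exact Or.inl (hasModel_of_leafOK hT hk hA hc hl)
      · rw [ht, cond_true] at hr
        rcases hl : (excOK k T n h && !(Nat.beq (h.length) 0)) with _ | _
        · rw [hl] at hr; cases hr
        · rw [Bool.and_eq_true] at hl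
          refine Or.inr (isExc_of_excOK hT hk hA hc ?_ hl.1)
          rintro rfl
          exact absurd hl.2 (by simp)
    · rw [ht, cond_true] at hr
      rcases hg : (Nat.blt i k && Nat.blt j k && !(Nat.beq i j)) with _ | _
      · rw [hg] at hr; cases hr
      · rw [hg, cond_true] at hr
        simp only [Bool.and_eq_true, nat_blt, Bool.not_eq_true', ← Bool.not_eq_true, nat_beq] at hg
        obtain ⟨⟨hi, hj⟩, hij⟩ := hg
        rcases hr1 : run k T r h f (Nat.div s 4096) e (addPair n i j) with _ | s1
        · rw [hr1] at hr; cases hr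
        · rw [hr1] at hr
          exact concl_of_branch hk hi hj hij (ih _ _ _ _ hr1) (ih _ _ _ _ hr) hA hc

lemma Cert.concl (hT : Marks T m) (hk : k ≤ 11) {r : ℕ} (c : Cert) : ∀ e n,
    c.ok k T r h e n = true → ∀ A, Good k m A → Cons k A e n → Concl k h A := by
  induction c with
  | pk s =>
    intro e n hok A hA hc
    obtain ⟨s', hs'⟩ := Option.isSome_iff_exists.1 hok
    exact concl_of_run hT hk _ _ _ _ _ hs' A hA hc
  | br i j t t' ih ih' =>
    intro e n hok A hA hc
    have h1 : Cert.ok k T r h (.br i j t t') e n = (Nat.blt i k && Nat.blt j k &&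
        !(Nat.beq i j) && t.ok k T r h e (addPair n i j) &&
          t'.ok k T r h (addOrbit k e n i j) n) := by
      have h2 : Cert.ok k T r h (.br i j t t') e n = force e fun e => force n fun n =>
          Nat.blt i k && Nat.blt j k && !(Nat.beq i j) && t.ok k T r h e (addPair n i j) &&
            t'.ok k T r h (addOrbit k e n i j) n := rfl
      rw [h2]
      simp only [force_eq]
    rw [h1] at hok
    simp only [Bool.and_eq_true, nat_blt, Bool.not_eq_true', ← Bool.not_eq_true, nat_beq] at hok
    obtain ⟨⟨⟨⟨hi, hj⟩, hij⟩, h2⟩, h3⟩ := hok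
    exact concl_of_branch hk hi hj hij (ih _ _ h2) (ih' _ _ h3) hA hc

lemma cons_zero : Cons k A 0 0 := by
  have : ∀ x y, ¬ KN 0 x y := by
    intro x y h
    rw [KN, testBit_row] at h
    simp at h
  exact ⟨fun x y h => absurd h (this x y), fun x y h => absurd h (this x y),
    fun x y h => absurd h (this x y), fun x y h => absurd h (this x y)⟩

end

set_option maxRecDepth 100000 in
theorem concl_8 {A : ℕ → ℕ → Prop} (hA : Good 8 2 A) :
    Concl 8 [2, 1, 8, 4, 32, 16, 128, 64] A :=
  Cert.concl (T := 32317006071311007300714876688669951960444102669715484032130345427524655138867890893197201411522913463688717960921898019494119559150490921095088152386448280710318450446268407511633591722075539194702809692695116208601753153385228164337821560864123264960681501748541853077591091207097830333535654176465561556266554081122782598459970197254359305046603757786447094372854931633640376410719479682913048092338197396955764545455672431981566918996822004871380600306136971753943836597052321752937670246012047628951588763948334492950572887496603132752461382215527057441500512722865735561853826357969553581445296441524964460914816)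
    (r := 1) (by unfold Marks; decide +kernel) (by norm_num) (
.pk 79885903183506043948570505247) 0 0 (by decide +kernel) A hA cons_zero
set_option maxRecDepth 100000 in
theorem concl_9 {A : ℕ → ℕ → Prop} (hA : Good 9 3 A) :
    Concl 9 [6,5,3,48,40,24,384,320,192] A :=
  Cert.concl (T := 32317006071311007300714876688669951960444102669715484032130345427524655138867611798085573559146505641014799895848991311371956247257387566633375267744243137848884257960921268805606350887706952661165676501956076125927614541022182042818502888717384054774597045597787060770683101045224337186399012677143234198332470842845947144869336060551500352416895393676969484983969738850256642639631200294012127346836383140250101103646154313460638100785562136449267980617363656972810469965799307536140143669204172430151481343100573628908995270843320708740646659603822966391115812493455224516916017848787241355844569512400629914435584)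
    (r := 2) (by unfold Marks; decide +kernel) (by norm_num) (
.pk 22163345861303428595357083652793319391920079304769686478266817094035459920377087148583062512565937275407054573939098425335621734851823546663902760959078347940059853769449007123352064224488540674578482348418436434178198079603456985537350756574851341379248342926133803271324085636130717275843472907532210534380989200961902497275634366378276410229991782209477054972728311179512512735449554577641918856584503180902675941769146399) 0 0 (by decide +kernel) A hA cons_zero
theorem concl_7 {A : ℕ → ℕ → Prop} (hA : Good 7 1 A) :
    Concl 7 [] A :=
  Cert.concl (T := 32317006071311007300714876688669951960444102669715484032130345427524655138867890893197201411522913463688717960921898019494119559150490921095088152386448283120630877367300996091750197750389652106796057638384067568276792218642619756161838094338476170470581645852036305042887575891541065808607552399123930385521734564076182110829912044267485667021494378337432091400804375578173293516902959351017550115541769580704823489838590463999939561383487229281910850182593813093441549861343357624874829883919839101870859639036178314442646402864246505683078843164736995736053252949708097212065710111880028117439211145488363463573224)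
    (r := 0) (by unfold Marks; decide +kernel) (by norm_num) (
.pk 0) 0 0 (by decide +kernel) A hA cons_zero

set_option maxRecDepth 100000 in
theorem concl_10 {A : ℕ → ℕ → Prop} (hA : Good 10 4 A) :
    Concl 10 [14,49,193,769,322,642,532,292,152,104] A :=
  Cert.concl (T := 32317006071311007300714876688669951960349131524534694890719727167731149054537945344510801971731627726710414708069022731412848849777322047281527437828154225564103011869079484215750880630717618694742330856093761402399056783636853777175685208910128510198173947795416814557145734057364102313603135528998155725008071592665534451385986866124530208075171627408776299197505126356088436157204198524062424976364072855753481477408612361092985692916584811341098758960326401004047079919534393314299433502073047037998769558792181400523846418887258787007973044516901856142783804269983036988084291396761558806435058235428702986960896)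
    (r := 3) (by unfold Marks; decide +kernel) (by norm_num) (
.br 1 0
(.br 0 2
(.br 0 3
(.br 2 1
(.br 1 3
(.pk 427390087506087452429057488636779085767472273302684351788289553747333160747907660640724900955262689706624811817494896722397506556794103756583390589610495936565035713886591544878221845861509455811492215190823760447)
(.br 1 4
(.br 2 4
(.pk 281675424272091343668177294841575801906534153465954026996898741543309473297831931509962142087331930945094184311452495)
(.br 2 5
(.pk 4411069772723762497259017402211014604744293482582992360525173587600727836100011737301605687281797562364138261025386720544475934488363850811733891607975281792982185239358263070490000561178352534429450569281790831330284921368621672076751154199295722823134165908920281673197969906215967406341028287299850656126706592824053710498035582616631590716723064231649903865922833649623078273787826843900728374481413531689161785502255831587565294396738339857438778711130324071247)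
(.pk 727356329986778301024494920431723456712218800000318427510863894695894626034987600713846796278275189872930995547997656661345241402558730351440611378882599107549347727623957644717196439607821973089459109942411749216416683637320681881072463)))
(.pk 244871303129854659213099060205291426818797219288782456920430684617453175895105487026688300690552981472919345162346140718375630096474270069823)))
(.br 1 4
(.br 1 5
(.br 4 2
(.br 2 5
(.pk 232987529254965671742825465558611401448758319653799034524076389622712368357956407913957524575)
(.br 4 3
(.pk 196100139571813719883216217967653705958735137534531558222207255770431)
(.br 4 5
(.pk 215606270305954007047014936981034543909911511335547560927937912118434246326154079)
(.pk 11390484383218315159524893019396841818184234796865304115262481608484123755151723165118628702629638944648684381845172982502352285592871796466881225764749389956057680144982006447543679268890523540128618458369969399058904294972228078061946084431837365927319992018523220283194731530891251707203971679258141850961848167865611521203833412355968241028966476817126335671705152329220202811574826530930583463866892681972566380169146565248354076928740761093020010511185659779233195536627715694467243390779233849980163456179806131274952742234772765879065342337673818145041229935777631433068871218735))))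
(.br 5 4
(.pk 418850715544666544834352290501011572425358286825521603806364667530015788173380685705656598099497288387870697640236500242845749305750884212831122513317850829245773391)
(.pk 468582457542000688211717674677602660663419460839052724832506528198459887670144527561230846992931038219416613574968996957851821980931569222933651430449977131716101861879076879481246966650548639412641317549841267572003692497466818648679294395447321422411495564082994660378076831671248744386120606298019923225778597888289264232211360893881052952935818619469166045392689554485716708428193910464124694225079456809549199824807382447118577795892297211325877292783160716361771415295789219193693361588049638433070104046655697604226424436271)))
(.br 4 2
(.pk 2270623568847868998446576768512950141484701141329557720353369391336489803474557741488427351077077286121594260918144204174606470304250159483308047387264510547628751619256692319823899516054246343938287165978461585601292912090522136924896930419188599529809665062768821466618472214614712075840514514241011992241785284946713000484661188634031832059999168327250128593052641569070975742799)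
(.br 2 5
(.br 2 6
(.pk 2609248968267390818584896445799504178482282951176709479884110293491314920524801492910676339356202165549937949845303819306256466502991496971268598569655252696680795447707673477701556708808309505389626238788041721403341839622071421170639679208830724324410714426244874345234431692436296356574552895218185255302226633874195311300740365916529313019278326322969113484397993549644477756255)
(.pk 1708227313768626256319128685254959782548749590600351374132633557644475370777457707356674474338816774331296083794592168494965054306125968495097036345986250974056163512931855418372524111820046272478644544672501413117284476670247870477989629034877791057891463326576844388912159426024343878453280879746849182309759163635956469204027148437098158486367))
(.pk 144994046797861458865652467299663))))
(.pk 116034275273110600946247533302711166785877087)))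
(.br 2 1
(.pk 9006412749388090373796904246529367954657267246006975990633386334682370019795597616119385666697626834042086875839209075742405345140160107926768076411883982645231500224645411855163062626691474700566863012534006463856942947437446429197466000140308119164731339008328202309365768226801794541476253913721736676049923460770603229245903202966686938077512046693346544870064672295497892087457459120477632535937250698264792347628868693054898996669642951117838311413375552291297680410314527191052963901118004359412296738348170970512501225248623456784398693176053559790816623218613703093525765476367104900002591)
(.br 1 3
(.br 1 4
(.br 3 2
(.pk 4011844587573129601975268842117339165515645127335537438305685501625888556086025114119679040559033475024932411123546665304105537621459296943794915710844330692878017686381418220035280632798493578361509515326825826060790942807423226833474661104379105746254741021748991722066752705561659854720088703224125240554994244247507966819840137434069555755779657228000252632656883531015745519629805780957573209159380131511491917473792950747196760872564361606974469167)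
(.br 4 3
(.pk 975275109259334154907790099400783623521847115524196738275428122122334985727728163199087800686528061763608255142904324841516590634582143103194627590380680548511285266771126000198941188357187780548857630352392705178642390949687867305825473851947972891859659529381792475051327)
(.br 2 5
(.pk 5863317436330821332309379154161724517985997908189056244111774340907160832257844903173325050177037096455040737817361816846167689880539902408283729021332912796821505495377613816863892717949431166036485302923698812615325861431837508392380410886590779916597861683191992651181539241409765127673605505331687035375653542391254077706125767630926621336221672029074600223603454000821373163043504729274027308510916866660239788839546011978777888132600469448508058385753156945693998747624207809179822628332916569647)
(.pk 374410859667105270932439590121006409675530890942035538701667094998229306651343627276301837051491225455590686902501295091931656198313038902250559726941503))))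
(.br 3 2
(.pk 398275910659334339175316190623255116863853968020429229164693599637329958831624187393616414265725715185845345112635598702169139466081524379551278295262826033719430787113624726250915260768562430704088111)
(.br 2 4
(.pk 7793685680722478605209768136150446203692245536095934573941523695635242313113408744409256324749395029018652464433468419547971192216786752941731598657997156993822770411680417336085184091587093996572659835826037096907843790696894779194235094011346271090965232135229955228923197627705159190785529552919340300554347143847407409978293907045456359001528985754455359036885250580254024064224293758908900124526005300181051644910776746090234108549629493173569998580797593439013501825238478688839787944079327528400729256602251542273358129087628244271)
(.pk 250638768407137592204359779762621435753791661255657188583182887652077358724819881286892329155151923298195722732879409321903319475382593516607))))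
(.pk 227954631915143354725286025863984644415432379520939205602623666706465878144674256429107338034914766661209259448999134316928955215))))
(.pk 3569960925107156474182738138914942897832126572816469836431129765726831223260471979237307385402403613873050937357519128032061935230193302742185389871319232992450089649243309269005544901927274963358979658989242883003903495110638790776153128118527963063088258979826165377582407312833687411543955255131961887573479471275430968491570527067851640073835506683350211699226284326081896763371785237379651489125830946980357507153424097614160913912246125186196927674218300601867521684075071))
(.pk 88285446)) 0 0 (by decide +kernel) A hA cons_zero

set_option maxRecDepth 100000 in
theorem concl_11 {A : ℕ → ℕ → Prop} (hA : Good 11 5 A) :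
    Concl 11 [] A :=
  Cert.concl (T := 32317006071311007298962968278724916210082515580895929761650881136684823971249031118387977090749533038750676238228477401545025201624749994691311188151146740313868691144689150962686625964762550680557295843572413240088541755102479301239526124752845665573560596774402445077707368583795509951029779052936333933280201583416403610985060576333206265735010510216606196232714570364398506457012992744122686319253409543027336874341524709176917439182445609059345810094916065100555156025689428647517193605589000143296780460311041785750668690197895731821193015418186520544416774603619288230108462541072395830558451558271423602491392)
    (r := 4) (by unfold Marks; decide +kernel) (by norm_num) (
.br 1 0
(.br 0 2
(.br 0 3
(.br 0 4
(.br 2 1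
(.br 1 3
(.br 1 4
(.br 3 2
(.pk 607553720493588348608309522327930711087900144819435593870056160167464603211230867159360420736317325245890822383340639120102105627295658562029404645972976259845727421122738046954207766550404205511666826329920509635612694100341588533139602951434428630564222695079347555455675791815602136548678691505539512817061046940220590677697468807178359921343392766151514955366953972783)
(.br 2 5
(.br 2 6
(.br 3 5
(.pk 42296261165880171530254783983553764077188681586464404578092514550610765467218249944998826280636761846902645207364934660634533951496844256347821927138060601687689567757428464052699939997200381932425423055903131383504229971348607516845682216846167485463452532513963088686756283258344182467460044391443774982345431720378413008586110736308390752327095952441519864085435103349767631062901885551363419462901515269573541188888910206875763395130725525005785714874019973829403534514796317651986140571942525091206467755039234422417942678385558136088197280459012939576895)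
(.pk 691428018180702836742507049448355932855184616982684743377072756806711754647847717631476106282003110490351852155617065860108705546054483633953726420577221489258953072862415656448179492348892654732510180871028078399))
(.pk 48135364903406620405696235814747933902157372309541211322073871023443976269813010380776908358785273734282658868805138981526359841542530708111120475452253937439999819044404853061044312706881944973244924260959827318488466468488419591140727722040886282390684498061680178511644621413114872535968196732262247514550552004228784282682440232835117016545621230730158949496659632690324503741433887887642893481279))
(.pk 35284981001)))
(.br 1 5
(.br 3 2
(.br 2 4
(.pk 343863219746031933385584663106639252702053515701286766935710998613084224964311736149300745343628342753381593834262994530158653130503354811657153029318149434479176045894014570028639366876874770449207671981840978885058885418381730174128608952709014015979284486332447895833430842819622361747621812696127)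
(.br 2 5
(.pk 194619661398640151165216657990015982446204934879760400906644565373075574408845993570129864871579199874938747328705321705778662604710119589750417926509254800805442055708439718668441512490153407398639214582860077315238690264839487)
(.br 2 6
(.pk 1666557544542329698215706764281734302916324946658567686580389596467916818125651221674375542646560227911592387826016684217266773690260546477524892471808581262327629446373271515100465941761082055465601342624034059182514462265391356572181783226478167194755163479277412034858529783079931027350680959716010594520370524998607790662406963510305049089097874397262515173339108419255267209261267197785444730160232385130054308641958392324428280910083794609610293700254142383922342676852321329416152172935992282393393934262487536565322249475639361071664333356272769066674636947453246626296651991661587342033360815652777711108783123821660145569253480158493427626803471910460279489254848063)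
(.pk 17548040948330510723220264166448385771093617166468471868996607416869865835775780318679104571634783))))
(.br 2 4
(.br 2 5
(.pk 150266505606140908676077757355957713078146691842137243607137170755591124155379598060139025285686094464677399773999972699484894523654050601791806444527460840394329533720987352358217816841095881476311989621505243667711535686110941540343384684534912022124894263598774636495801867077406953115994545960080349882525827480295808948745066828079491440866639487065578941051976138330807819647795884842240149966261046989292491134959614913445969284549530481619503166521301156151173734957579065215731678357028930327757932170652533760539635275651774577357615951)
(.br 2 6
(.br 4 3
(.pk 54780571391342505910407680639748854003379750904629755319683354155915050157877129116080697111995874647873535455222950485909622536464510114030826076169254199504751321600092310473014304507262053038550507649385618866655422221809328607580064642623)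
(.br 3 6
(.pk 1896629946189527851924067789163825212637916554902102072026777211732380194305596756975102441532557582728882207436404647713041361945303458553748893864072479962824033577471680438006119505127892699520434036137073907635572088196964686899946645105662436871625199612867685356578191413046403812064292272386912012508562059840854684611070485133809401321547194315096887365693501057338285214343662958977261177483808343343873139411783117830587922347048713061439493859768881923262166813648688880339434512128115627192090734381888831)
(.br 4 5
(.pk 2174885235028831295122745077813758283469866307107198001411908356272379859803046671282457759675021407628658259412703099042665845488160435435468153275224884717534228267040864204318691259412418257411232731403459884790223922448615904993861542534864427779845772940862342438630917996633630816773214458084505984584970782228620436939568005842294935614686099804649039)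
(.pk 943238143110903913550255536694190251200275180627220532994919616725586786061012632381066045268245282825279463551599744631215342950976356310495041601486858174965544573612698002037154427306807816196763181018838521797380988606982130127132475851965849112684714110926985458361062132406559225478937213810625306964893205355032567372921578043836370412808169173577700575728446102036609313851342763208268745574059478257888286146250939105935466085280312589831621101104551923870854473610093809029077986073494410990461753209948365544748953126799847579776215900870364972317661410678506205905353616374804547484479911231))))
(.pk 37165475159527344125051875385546517904008868977943355865903616838652191667230689062202013321256700246498177197129109685752151485027299444878754828854921421245293211837725891553581473644275401228239673832043610734536128898069249693023546774588107325336569631159228092464339703230273679159100741077054885459469833324724168482825056459007149547937459713033194846767267329564115948782699132273617382103390942590199332879578752291715269196178066337974165533624279194292187012317851272457914634733321178397598905032065788897617665278926235594336023515942389279448813041150563205966584752216758801316893984878146357134840267963706811513856427731148540894261998597159973783602695365635464105120683629124618887904187201327788879)))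
(.br 2 5
(.br 2 6
(.br 5 3
(.pk 8727047444652502632800338959431272087640113501088760855385035914347154422841403253416194451464939233138671027261448682266594325824236292727774416844606811494294862270578886629711541823)
(.br 3 6
(.pk 7668405104368569052486815418883645721668203642861892372087214849949034705786706974284520827378128576414638674856446803440245752257303285935266623407578715719774069301188615667191876727170632225524786435706979036177180648016433245429861990271622464487167285936419467844929856224165807299345785621932874010504004812344624530798371165432253445951)
(.pk 74731015708719075428402423846317765974864864705051416221104398620973082484461848586456613377982730724729258198862425612516757940954999452532200355661697924577762565510204213074642794910383363647717522521740806675583317514016890244519728421865020954142347352813824366196737144143800446824286466532515414342949642561392412130388768892780283209916381212981196603830693259685895802127161241216857083368280867585761965847921235440742647020568549620288404960870363108952756799957564724579689097195592778302151083356178189501709404948146452834576236105496280782347039299131804911281094063794601782390283515891181270914352691894831016178783)))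
(.pk 1073454375837552028442636393401423130108658464679403105674981792966669126660574533769981163235200489184771200670332709915603988005062670876814035114440878281346428772599239537415595287884849691043379461581421527213824663726707288874364014381355314005573887439179815280107829715733543523003191089972439518601839877856615556874377985748242335973847162285423564161940757519893032416495166693430760822667243585244372719989121471104486943731896152927))
(.br 2 6
(.br 2 7
(.br 3 6
(.pk 3350850026654761613398553622817787213101661074186244182361380892698328537083615107364844287323662461404250226346274143459315695075735857035050405761172290959474725877883449541432190126142920486225156720644718593524590976939732008893148629199493054904416605366854961093044471599554882129646701814059465062218503320195244478253867786061252519981402030476610853885160930576136119521394262478402915534472037064950363572132301606157122554361595709716771570982665178673537996912952198171228516677313692022519569715309888613685767931326897970327184940999980188903991350660333063384298278934279999)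
(.br 3 8
(.br 3 9
(.pk 52610650147335480347811363431431035092676116244588509616748053106282542928655340915862059037767760330972669597379103294976865518566008935544530735021621059188173704248965815161244257101920827085523554150634166804834573169612066813323809229740039401546009060911092284962386318452426292674753117730534152494947799245920318543602109640210987584264029301575582142896759466831829375514397431627071343425594028912348962482274042274969113194296067491123278781729197372756807216569334036374127856863239487573771359322380048657174387082690405906687638963126695295775839)
(.pk 385862084375039236858929112304223816095497349761591748297763446281447041894168697882097996580998711946826913331537915718200003907294239449108939232880284463082109442189022472873225155887115544670087431590065240507629617125175497255258930776631597502064927236625180321540332308993448307675523860198495))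
(.pk 218390200299219404997381401027698893700338611541975940772035612970419622986617705471324540873817528116770684333318384319746060738961995848339334705913558371527805761317568418745137008518174214795441938734339121706991557789676639)))
(.br 3 6
(.pk 1221572820676519798696701787136393800816628120857387081526992504850478111530945377332254398293968145513637027076786885479737195792818651028483123910536241290554575084732307352905046061611632433544896056337308972716894441775189756939437162032169348851370593009701539309742994881063089983)
(.br 3 7
(.pk 1058473313954480311730330025278383751246696267636894331838683774864033528354775923690550039538002835245982916672428598587561229273014600707134213178261288078618349176474266919396525281961553954965342479972660674664438497440095978668495929871236653511607374369256788993826177527678608345212827048484567787803630677472385712532891745642155645623890774753008990638161317545652509850877430727791478750966679567939787078496452985002840621631741377139974920683381968357623080674775229664051879026509142073822427860942417239813424251025219364262717913051137171041605833631377666555798569322291736302161681053759)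
(.pk 4340164012817063234243393017634732391620215851234334948130548306945291169054767573209378974790503875519526854870031067692409084325056879427697808651817016659854342744687830953576263819709494832371073286486585961757862690558009684133844417480029710832954525872570985935967))))
(.pk 17548040948330510723220264166448385771093617166468471868996607416869865835775780318679104571634783)))))
(.br 3 2
(.pk 21034913491051431218258551356895320831152840464464658758612052587471910438362885007954261591089312743591577143532846501303913094450180769628134467460277840713275374065395364278238428164398319668700133937621333213270819997452225933012906373545901382661288430954643312445323925236456606565260176700907262679971412034063560230840686239699763634145931857367929324285604677334671721997683051166099220036420131711159859334827229539932611470978232768980635675587828765059617825480320190036029278074555762740213794470373026297135562174305569173545047602889257178882905719344337138289753004360031371883284904469224722936498946997374350303524177301834298415)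
(.br 2 4
(.br 2 5
(.pk 37165475159527344125051875385546517904008868977943355865903616838652191667230689062202013321256700246498177197129109685752151485027299444878754828854921421245293211837725891553581473644275401228239673891144299476994747545583024210379381391394009859699899905880566666672295196249628425106300065208738981872544665886966830603167080286089804249975892020957290309575254326815662262457354141286242602270693380474786050146273504518675707475537131873671716476145631532785235586951262394390163851085940022335146674546898768877799017903844178830762894341528223023550189395315380868691946555883170438606677357424303985017030424339781123577858651583040716265703072767407625162247651272499148574232740561349488395205886523378758479)
(.pk 4340164012817543715320443510369349415055816919834351774726884358453830473316605156146945142750669421847620727673683522413012577539946983765737726181275524012301372895327245386042109301774031649957648237968297147021625777888324876950141780368734231192393757795855977673551))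
(.br 2 5
(.br 2 6
(.br 3 5
(.pk 48135358988295991389978647444729974785371972097062115303504339957633037580136868454511854217609688504851728853261824483456277607432484157139649043554398651383372554520336688697375692978942937264881998391557920226129563573577520844490537671679297536268554487975453297783822169303461787315761920349985639064997390883571861412482907684821543218360914265650109425996902617101134543753428695231533795440191)
(.pk 23604743521297678489111098936110278033816489173378968093807492566860664236768225902723754566522726837381062807125805090956409282897334825963624166589891694769687781663984434623258962480747370463268111342363693464958663818525271894634998883610857105117464908596333919288375398919205772428651600987222047499429552280653822219773422869679376173169189128868528285280881144805311819158234651501252918460167558687059906908367872627709125080385711694838401854207076885963949843519975558046439231057020046230043088482147629379073062463217488515864013908541034797037869165332563665058380575100884481811203039912095611107409361629607037751230479344433624895))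
(.br 3 5
(.pk 8727047444650570364039047925704189670639906864310800610890542780894798886234077865028806458161618968570915203491209706400470337542957922886254998008878915848583679707420396779263620671)
(.pk 943238143110799491671800224256035750070761145161840596517760238953666508062002717397956032857409293586146751888880600368325193479570647943142853774921036738532716669402947853856233869972994395024899210050294291768060227656170307574492423656827188285699569435932037603915238847841639990038277495687337501935279232203591915295061385746846015363435105034878371437940698580829004273753645166755543889375999892958640438462153461705339132147615270962376539088591317510696498076459981465041479964413097217138408141651075257602031323153150423174637453330585595541936717920881710715664834172263754603921820350015)))
(.pk 786881370649832753952187995820257361689554721307948367))))))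
(.br 1 5
(.br 1 6
(.br 2 5
(.br 2 6
(.br 6 5
(.pk 5014176368029612431359178462345989780352146639300616463872457154107949729676327727069503705483845603952642421599)
(.br 5 3
(.pk 42296255968297993150767967522469913259242173402939777511535079635470446370028373868633754978329317557103163150967306608465580379944492493472932077000957929526227675664318220783212367177645998655940782364115151077850500684384177239130651359850648736939908480786898823830661722323669630715883641350021856185761082852333713380960018519764488772052421078080253213620292712028233951854802462041087615178732651022748240539647289984731376218667133440997840973908422385873232106794396484834809296195406670860203948755444111303787438906002647292674198420009363111867487)
(.pk 701904697290407688384222445416960267692014977187523265883890414933307747564411807466294903966741563555312604102595925916368626092529094296783219318434178330564890367556266435551893275284296487534063541900011763551)))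
(.br 2 7
(.br 5 3
(.br 5 4
(.pk 1581264629966095283194368925826757852649253428418994321093611848066064846101690233623341572149345474161852469379406825741611855)
(.br 5 6
(.pk 122769990245163567470453009285072136577704484367074303101809211053350947500236974561435001136810955435905814682730094033884256281800658325853519199484506991)
(.pk 265482183591109221352952129380231625000757596557193407566792863899933321464327124677309926030304201602315353112916897746276873837777829984269576183051418073250708895645882690264975881090615091812931570428201715499937095818378067619382748415788413005031910618299319895487415318425081453992971173567470365792486429162935152382280617883334110626828092072078145472923429970591097128026908946971560341222401058000106033404781430263387498823094414762644209342090489410968627789515034656282852621037798871868032529049971435971560155676090968190553379285587385054746038498111289427325452517596698302706420320134663689783998303)))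
(.br 5 6
(.pk 23394528999401214679779856058696999867122032815641907724855315519864324163703457001134042539718891925654232439590699565222784825561781840786061590606460641114101411746727920022035359839567616836790852813606186055452121669315496086797511315075936265325692090160407376258479301265101934078127163023181770843287320371060256827350553579920369555504845692510371824819629438961337868611173420002777244436542741023300810657972017186589897381402597136901107620816804259107255236242364224353335135)
(.br 5 7
(.pk 2108360280920287287187048856057137582229644479505968358381961741341777993104613257596988635853990010944882446710366370931085388705542854178931894651577256069496849892205913312029179559934229900585725648258886044656828592478283809007327856245019930272699812359579410056526663951889260109459390652510471680763587611409758999954789263946467787272751422446762079)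
(.br 5 8
(.pk 3811539400776671812024185294323235916815844664075665595218607412234636982779306010599794621724758189455655171901255123170858244682465698598570000815763902667928937482592985057655736036868045248873285610270274219527112641470086287903135657546206623480416451457315667102345499904719924023235040163479137501509818494028919335093178684533530594601329926707890482196223648149035813060582556085120749249336330702953928355371411988838321044848032753310046582089113613141453855762560814036017027439684421326596773581809971196225368988652561754287932726184078163180380412587643784073695814389004639)
(.pk 2793997627583083050380238857171883291766963735491292229724698093661101906728438183056228691407348938021329994587198553312625956053373942720394160211990512349478021297372164576110778604995922325926767)))))
(.br 5 3
(.pk 42293751922802756154675363588873982450550553119032775510802013256074599236874890419953529638153714745364328775792796303714666841816566635685405133450469463970396919973979488744167709978964267806495003886274471284478171984564109377496254422985227156607263050169196236112127995153966546671209955244346591335283742966273163129866692477146379102796614371335486812936050180450356581375256774784602065803220384232741633001033261245196919125181148752328447900886858855870944046748858917601256190486528640405119402956890397640830974736366406241359194454068762326135903)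
(.br 5 6
(.pk 701904697290407688384240267450618729644514613210907133224694113855087542925369021327691072369364782275289663163159435899139163467278679970658725444887431545143426431622325779604248919994509295995710296037594167135)
(.pk 170915358534418135058026616734406995408385358804546951665693694375320800035673384526481537833297761951611263619642150267862041051876627600469776222815295277505105643427573297997804365415298773062188190114284505029211312020203616449601870985976490455392301438037143656242719648039288557455736250704195410702093707072167682057396117400755371072946006801952414723114406403080729365513047949224489082714094012141296038489655613968725128601216676261678430984887537204559077498120405703489542880668048883721483669092184452604361042453808844464554637151)))))
(.br 2 7
(.br 2 8
(.br 5 3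
(.br 3 6
(.pk 145108069606624072845558108549512144260340263927835977902107024157757935901542162714484291781659273901574820052326247599276904639402183092234165771242535101319901735887437677606240618408701239564565309158840643236210901917590902506488485479361471507328913346377321787182927981520299143523385457044421729014881869194402249439318190672747021278730782154029002510582108931790317442673233174924818781533584516503023872180889623358252037301141376901990427585182237062271013076325205357423027454519608726015068351803715481303339802498316767088617816901783760584362687462050717745881299744804508719360412180921476944052319212322277025196717510007937260940991342954540211764392983279331052001597810387850519639871)
(.br 3 7
(.br 3 8
(.pk 764698859493269983679683889778608733388952122380511634212670580448613080665795987079412244002828814182185313217994223277855860610745784557798434590846990072724069237138368688957799207818640296595998327614539691391)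
(.br 3 4
(.pk 30147715054842807552610191672609337869460962167182013424378495564266385535928577717737707705160420371437885179611581155638868959232186088962572469394217253205526612605499617704107052692812302846224523120576826125793796264366774980509399327502250482714440773938519009254053918086717909935002821405970688955918469712736042108646495)
(.pk 2099709343775942558352012874326468395538442921829723397506370667542804438330360001297832101038812026826418107940559820345461585464419327734869309429512406971298811868473047519970013327447845691579969502080926908509330391745619087443456660632469698590625407599750950750461891280834891718014794249473941504589677081561536501657344585129137824002609014230149397731007036270398694754085741128874384691784435828253888788314048968829970876316031514166461359824846300076101124223476451789320075754601542456768333579405490495)))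
(.br 5 4
(.pk 677228572852122299040408920939397215161735791242232984248705591636559886659685744895696395286683488634794847940200079081736082612836838719739224486322825083018730574075993463149395124435811656303215460145957685063906378908239689041328007310216351673649484229014696403311703361628265488691913407560304154182173827044689693656093417002663970107987795181267925047904968374111)
(.br 5 7
(.pk 17069453265768128222833765393348813726543559842899114642484208953218862017785317789391113743139740390301093174335073050883680675647793301209589954380286019190088166924739886782365090397190665642723444473426120552253973709329155227153070752644332678328940639)
(.pk 42293751922802756154675300522126416681641621998651207345065408929211542732764595038262475606654325033613743668525720812987627726982444986900529380234709428549272092555348726571158896475970536056665999309901446112569372359291550239153702439196102078807296803011252282435237760732453402942094644862105102456090277283609666572636255298866447680798150381312210741937643458448088461556167515035567275468820128980709737603633103930366510693305884098947621758948137869485986512007086283060293309120035702033383775468619213332109353275438637760441253597921512567075903)))))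
(.pk 26308417926367525967357011430147383935469738061591545640562205203262902697297859222923543948662658589820074078395349137825167111145204837424572841670414321206024213902561352563719491432920345611090295992934551985603395448837170962516369289747915254533852101780718599842876311266105791805768326700707977352263981892715798975996150751715886552700173549803452741032563539082622304877792499427352559425461736175188081218518199315104890411300578519717549401726725068116287271585626021978960767))
(.br 5 3
(.br 3 6
(.pk 6598927409263046870521974653944512608917075068810513799808573722446951771391263266825598315279894758063657851934803039449926168317464432142704576569253383941192291502475602618397230256717726541659087028960478439770987078847282159156595252193643047491595227713672475507010905475394635375945999520558777465112031157317069392185641475082955256521510064426329553084390883905067354923367055788020545557079686561018840940250688805397223742834416963046245194959935317659061111178808592688461805947807270897498828986587454328463787208995546295140385436958435066051229689442655105265630990241485014376714000470401804643995161312170477407841674586150083471986974977947455)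
(.br 3 7
(.pk 41705997927162121066973548849411098117191790142184689596885197325853449033956827847907148531643927287753354307939384408655708147712580245167559931192320169925423555507592938133009694796210448125236961769873350708021552019413023638751989741394693591314713711677480254805595244598513057341329109447159241191493087741534864091958854606311730451466287794533394272792279435373734967002728787980651986163977197891290794508703396618271909380086350569599225579110034300872489954663301983594291502316435755167163081832331331358929858868464660550075114682510823550883078282137883010363175304717333027850025866721835225617544160347338061468141601422039249494696431078442123778820305574461146344031830636885189729264283884011779135)
(.br 5 4
(.pk 343652674464693194812594091759995140231855269566175485805914838624284006768432957481249540838296241097486947623592442658833712390346323626584278710198568357117750686142050603873461015469444708703321468295663653931694550400073869037842753473773239562086454964817442619690472427825243131000950167193752045078871424023521480780322642122915078361648244538825173734568941119156740222749382747585958234861931434751002118595100934620154691303848585011252737320941407)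
(.br 5 7
(.pk 107138065921176695239956885136542233332899417555750455035191178636724444085845615682500425700226816987865379215276409962717251650864235688110395596372408150389420520112891715586725312811769868910501173018513167708083870075156883280592691047645337598260347541121314013975568113773273766959905633224954230277650511455)
(.pk 42293751922877675178213819767211992163928767826891630093227079930356508608060022420721948879869305745293587333133957282039882635162997350657460464306472974003759698308049834901682570646173837736410650930499159822520455962445937520022472730321864447291761225418625277848980503976082652412014924360886085804146470732445446708337358318806128345985147224576837923603677460700189031084494817984501703541716502893234669195197369563708005454187198844269330177589759202560723760683932262975666978257044687887652051484631847008764142424378727342062504588218493340742719)))))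
(.pk 107877298975646042041257376056226701210975207531908698972600864999587817103916290541541593554202958996288270111535909219765494110333684029420555748441341839331010356850960137548065565507555377242083362546858432719771101790512319257492011821648529200818901224281546293500941716884566662217843449194509796837719274367)))
(.br 5 3
(.br 3 6
(.pk 174903719428984138596711043407231699215799745748614150628563023930962639108424823530249536193861006696476069866441112488038032577187172513587556795671576974021254093984009475644308960153513211649429418173884602937598866882708459222208547624527227400910400067267304938185449581467735455922785584411419196850952298139193543960482942330656819996894605218892578341193225474380838623332660287)
(.br 5 4
(.pk 616797742195401025642026030210475393498843279473393572870533253772392484078346493706999087804736192674843239927183597030778196663896367005673918093530916745302999819201858018496722679035294199136189255262901730088094761356009864710997121190214574517067635341415239724043405872354783786215765745620195265097254423798206631654724892746973323343210237199295956863734740612703)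
(.br 3 4
(.pk 1221611402117350871043756849945371363901533344264595703124627000354211033946505257130381093700111919027960130736737728749616243784741429070601374156341246807998981605466630568457040920861648026497874340826206704342592708813582941407655140067603897397327339766534347983831765522709804863)
(.pk 6737783407965967102478860021760105990781167061349297897755470332084676952905305432461563868474854132052599802808935617134656843137424930141494409278564976600721705388011865741872702813306270737734981075256160246037309783924211664016760871773484300211489891957884129377348509569824012072445105603184306501658907331603535091041659281835388976881501049799982322861918651319152179234797117509735810622684287751037071792084385372808019231133863266314834158034615115307762324667938385110885883278609433884255))))
(.pk 109352776726679078081374178601220690287770763319476063034593101016734016149464712206199937812925904382280997741140336070320133257526461307914769405673552955489410123102416528377770980109031574156080513615841057405496315958664933879740377056336278368647798263364820213350675623718488423789820939983873040795825337167))))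
(.br 2 5
(.br 2 6
(.br 5 3
(.pk 42296255968297993150767967522469913259242173402939777511535079635470447121949016792308416361864421941727645433494296247470185263296141901388558551643554474965375998205856003784174367369788358603971241805857680798584799281095793354003911914199305518750358961933486015062678868124822654808100278352675574977816925748015121896734406521945271108925200502096217466439317489390006673933559315415942922569091512920688867254401439244996956451743510449465337170334683414487947833773052701506065578388513202267867487101364918715834785326497119809169249691779956708013151)
(.br 5 6
(.pk 701904697290407688384240267450618729644513647076526364851002332069626113645600110077165336792811623272987303567195602926158231671708430304506781281697237540922453809040405535586295848911134067931969423697874712415)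
(.pk 170915358534418135058026616734406995408385358804546951665693694375320800035673384526481537833297761951611263619642150267862041051876627600469776222815295277505084827880808550163942073764981225584139800414151094962122336392687873287111634561937074255124784025841031671682579359578395703955332812601252333914069513516393799752373047206808666321836108405659405726450528006547307251137886494822158523094040547185546288007891818901456420332577268743193759765411365624225664135423672289972176967117198903980077737605541159594846745316144474521455687519)))
(.pk 5965844346841935489654399587602471569860131602959787004990510780395776803402389114927610995190908228985665399621994165045108277700155375121674271362593776966874922810566165510429446690675351042614486421768040259245704240835963662353178975841117839825132456344084467023909837381261930481059437089779100185326849448608551331448517120553219669874819393600505125991134244162838108722349058962990496475143730789470958166340984578000102249635290192579747715218148087660989931093961894787892626169414532728818702049151102478797908323153179002905498807505907564989361149940658164448363835398133452216906047700016120523759074988515252423799082578797727649085493688529759))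
(.br 2 6
(.br 2 7
(.br 5 3
(.br 3 6
(.br 3 7
(.pk 2719092067877282904632250868376803403241762905277078994416151083025956989973226151949200184557781452138027842711105019060724094702190830031385232577970100959717037572290241140998284800917828613305711)
(.br 3 4
(.pk 8663337091296228111857463160019560034361468877501562206451665316356537770219806299257038828300486127606365920323010799410919818857097636751873834884940652373576929046359319311240675408785830255269487140482382730269258948996811275987461940057593440162061169998933500870825261898579172837342595355948361595405680335776639599086617278132972221535)
(.pk 54017509237562359250357403960456021174133062955592371365529264546553510088246442067365747776219617977690851289950363275645926520666792172102911282300549367043126774395580750489923280297645900151302876175603905382654393668979810285685965586295878349952332486457288831138655928762200899484364890192040199083136370591554354118080857131157821357469500719420420863750481820231328615221679286079402540464191)))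
(.br 5 4
(.pk 380630226009554443859539568031874375189379088731621952740205751173282839987041053278282776976482892125202740494006856655857796599633209995659899395092085507503678357504842052414013947416729224804281843332998008012842368849058848334503754377078095678829722408874077085429504884034297929242934669407839)
(.pk 936090240889828172554770425777304839987792139147921703682256999825375234803668430916755643997983822128332571604750125059318906905548690959054843325773534336661120069949654326323219833152360434059176674163387568485221500787617569664576679415195334671050410631535254539944103620332027059079861433036333129202096769234844745602967789965118303116011062161756245777939296299520192294160172775176607532752485092322330880880216562569633027269131663184160133447024639487540297204927055690314428157159896218739889886807566102794025692487590315430949425602689063883223746472496779556437464627814038335826448217695)))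
(.br 6 3
(.br 3 7
(.pk 1188229745666211522256266211133309624655106416552011547827697883843101261082007610744808590602602819373249209818894074852546130389997777462447692339263895663302478686355629194883447955914717794205710601991350554102420777418231212998950483813514772753733027488926444297792821411438520353101814892627501811961051933150379918470459516670516967083422189643662709415600174614738614735065758622719662559569485296284112748666055527719758508519149990975)
(.br 6 4
(.pk 770619160443339216406083117568518892640439652330069144946015426159895708211002244479952991835425902319313744483709622264062269259371265351993883836424074785854353092629805109673030594796089594148671205914638087535)
(.pk 529807309100916983996098739901317011046488395009297629605386674924710100895101592944516217743093315691341680097828449426086799213543506178921574615769520104489733297811042414738654246828683807425228273427664471826585410806295319643263961646534237316320311420231198536058608042552418048104827002773915938927812278108280428186414568147853079684643428379354076460562585979109888900107078073539211594221351437112942377369077842334988045641314763874767988063690831963067886040769666190477800733084100644888252391760785253409706252629359)))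
(.pk 1549575450482983666774687953562954339654585979657633638041391299634758088531220747217062631835040702486768041676617993151706479)))
(.br 5 3
(.br 3 6
(.pk 943238027200843683207122796475427456828399188164624058431549212319684685497706104538933983951115776098363444887046455536346013463308503599784487614249028740980996553248505305412215646263237370677146151358397629273234496393515643913822503340733306066265819195401062688249641208513376940814636098095553576527377618860450160048115057341143161404238089441282609610940776730382092923240145876600198268660954585802783046095338108413501078002385963974463890835958720510271745271956474575274412345478179639263683727141793501046749020472761726781167803115023030369692765902038882169289546022066125678613537092671)
(.br 5 4
(.pk 616797742195401025642026030210475393498842417336947565074468389687286287844645370213017253563628658360485851936437183189083401232176886424823110505236002692259275610903364586791954947861314847583085028949060744320042352286328407161217527978892836500189401297912842208992899760081421829927549977932989306968119568650591232326448928746296390253359012741998610296561407030879)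
(.br 5 6
(.pk 1221647414305772298846960183587148096969265096527219291636002340918892186037345756914430773843237053084418913891626384739874874853694643453318438367407894193059177688583747540880763081638417921119362006376428465139924494716460897221202626543083184609314223017505952818462362811180185439)
(.pk 6738182325428324073881929420175655480686258973105209101635523525696469229515807569740884774519703880808453937143409769995994041591336456207536762932119773790017542985243962446118202035942449601758124994894520553801683039431538220209925320241023170975911780143302829340014424305576355218641613550441124840769461199614398558387263794565635765783924000775691916481314327432011513672231762951974305142492959970332097986398089551692289682241851213761661154395594037505496321384529284829736678940523650872383))))
(.br 6 3
(.br 6 4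
(.pk 196099895143229665834177242180718224998522438561256923127780988625069078296876949785474466012941289900035211285744821351886486850575452730069065336520515037054047004679896258198541705677348568891202967887727708024873441538930031)
(.pk 943236275292747386217255911622447017079726092901925619269507702776322440500923619222538714813543934367765054876757492049798369662766953854827340096062687760812647333792722815425887476151601052650419864218603080053360122822235286994598857330357628306220649041004357166851499906756416191612485947400237716988789425508604632320896699588391363761665441926349055902193959915203693331127495722750299734617415616685390743607177362844362537074858626304543907922089523502228582438899182830881778762816806539508207877601419625844202923390475605087997867382362051154351491158585775850379505582932772659265669625199))
(.pk 21034913491086498483527282694376721867512126421000860331926100272817714108521786821812675693979325113211497847428004664333143112464070944242239426082027844251803687969848243251656722887387494671299480694179433990022581868740301046833113965262901168141866562698419467021973261889247272287864538337296199412525202410877221582138516446371107491204703921760824341009910090991181733765686298307326308854061113916282972324124617291306080914972100979192975937395097416492948775671508801006497145788606859994588239866162182709635133997128049938530314676804046894063105584221728912300472819581633138442081213088468414498143785415119372920857850624783807855))))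
(.br 5 3
(.pk 533853804329778849284926388917817433843052905528824793651361423464335374414556037813507134842171722757530601616599634173222690549151769351770120336764225917215923720725771432673560569828636701806411146794527109687419875309338181681695940917248323219863727040423126455976754417397438417551174602939640843016531334626888959828998944106250659814215092518979028834975544801909388104964202066830269572265696310626086314326578599722803927153626142712865164459142896781916603085818772277734460634369528720391476496584056852358128866817119)
(.pk 21034913491088836261079439928777141510875593275826664846567573168816992834281749464575568839881868323224736837067972633009423679605948718914786146701803735640059033493749093921433599164320881298938122753539638946594431520077533034456756699451241579154397488292053825499952949782332255194604243097288334506902990973755269416137117719675022345573651217181187633210986855628575368989855316481339528944518144853109505155405965401205493764941097187032635751472972372492079344522471793299903238850712584974406049606818415381857036553458817905187900996464995502821742672700257171780400174775993477710964256339659576164335759428530445282752262181547668303)))))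
(.pk 943238143110799491671800224256035750070761144672981786575626127118859839662406601512673689249830735409211704797521808149655392989758413986137290718105444870375435725606133404119908614941536938437978446777625158308387210885719206523690742891386716757514224908234045758527481525757524027895127627248606508608255432440296336048614479949376973892957241277811383289365681229536071245176553138023406129361827294469352997828876654797561279008707077636559388767371575647699562382661937897950859456463202801434419987474112564332241032597047442515671742548292653052965060153890073503815998760618806863762851885903)))
(.br 1 5
(.br 1 6
(.br 1 7
(.br 5 2
(.br 2 6
(.br 2 7
(.pk 1368599800049125147848004342102150001152120107954073547306887419474449185622504885491889468602828727514589277800861608128941469525904126523302888992557593038083083380167624940609899692592248551029666019572675255824353941046199741838780038983920931126641911595506410919204892435223371040237327782212647715655519718239471215215985243610260070887292159292061737975085205077342734365950021395133231257288848126094609247782921007568757917963817186671)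
(.br 2 8
(.br 6 5
(.pk 1539204640713975469967085753762547343784939322192526255984818234037653749406238440776791865619259714600509335721078499791270751)
(.br 5 3
(.br 5 4
(.pk 22102663699926300885344569183493399783576206110948244514323177364163549669646140516495921749881711)
(.br 5 7
(.pk 19070079385568668190429650323921431035508938214930337213908588705286789813020493200608950376948368359008547568713705274565905970033885092585429877630761987196334670061311860133038974290096097360737026368978918343392381297648811126737607557604458194881737583)
(.br 5 8
(.pk 19070050747101851397572587665030072105964742533268539296055646610352125973192930741446738939554781513506938068457012589615417578985853322042804741583565119689181805595229172141264114607431301423801808746340656285728541769190344553516537498972398517846537071)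
(.pk 2099596177824872297843675377849518722349104799387342769626076765055206995580564498211478734331416100766869582926590247058525522048593031710265409648738082033053809816328092335713519039201120027674237459792941970753437468371531895832830427186745102798374789783307211994049044018569297740515859892187696873683537099570444399756862051777462126250150232850525370654064909765226442984223698378423808738571956233695097830803095184526160664656232474891427391495588916105187566101403287780301497376256956233524151600557783391))))
(.pk 69020323178052020235122542162108396013590394212147214753909246019508930887478015839)))
(.br 6 5
(.pk 4827026880973608312721812452049085574809361509133128644354995221345405658926620750143286137481878947338149884767)
(.pk 5786178249709884937225335737460168060209301905635607686487402163654888303457811092770398099373522127224327488526929135267335729666191480604840339198659184249383280700895258756918043225490986957414534667847368274568626863377621305370678310482521616560739841644591123078291392494721824200157525395993737366268780636945311575051297189660543789227905394958982757656336381769707216166802145647001294796438672280902168851289040247034754103530816466800197432990407592236625322519822924785840979100376998991782655230814128091254931890609506962305706904087604764734612884622035820478170064423630637871247534308560854245157013315250507865084486761228684501554713952908127))))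
(.br 5 3
(.br 5 4
(.pk 31477367063024578514798494169024087599962058421063590291135648241810198204316676837644865834864300262680685635969281323930013672194171347652374024015386107655790374680127)
(.br 5 6
(.pk 15203719590324256656207653758797066865642424745009355316771215578142214891544394568658678512941300769225240419267900973048723512145726984105699593044474225568022885919333167628979725709624316645376612641221090845629056819165534652547572844865428525579824829349179511275020950534661418701572103619120668069289282909112781647860942369779735176654847095068571714913367789775365712131411835606417183753553250099370652527)
(.br 5 8
(.br 3 6
(.pk 212800778760024829076013251099081335586731063029622350789209939939932816424956232150299191003646771741086112502400490121663832677372906793155199549579839190457396803499939538489950128678684436329501185885325825447471007944193409392640754957475846154540952260167653129877117376005377308468193792220529495007772968084720849263872278006004416373349957335541808350309379547304001498895611711)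
(.pk 41332198452631749655115798036756063623522295829863203267407830482361428973974492901511403651432707419871571438634710101919959852669156877033967980246715334952013112127183205921994317869614251317638878446239336532944620659958778278567530410869141154713683433347560781739460850861555317936616593018520041258176976036829730328081106667090457420269311207283546669286436068372270159761468434321991397888758998517806935297138082819874738868010115789536111233966577782330414327144213928288489192416622435390205548307305886109173632718947112486638720890897094977714223))
(.pk 6584599102420890083700037348874781112766933319729448531852587148287050891685384398803589735734583998478034984306005385383298931208033638573944532412471797555052052843127887917481540100711761753391578510294695256578734173034322159060244645241363936370634377745817879644710853444446486912713643019650965876477325198780775638265614759105770088996001655204468927278933667582951949403536778960771252000163035312488950450517013239035994446828947500425630740729809940599026839774192688311808501459879579612735))))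
(.br 5 6
(.br 5 7
(.pk 107874039296258905187696913090817601289362535654724384401786007115391634076917162720711335922982326581468192168706848737000125178525998096024119431531383232327455435449345155567830054276465460698597166026252357441624210197668775343155823042849477217275121358953806944022743380673388175080783735908045222577909986943)
(.pk 6734232752823056359669716607146712379902474965777463403763611471744791145259957877525613513663112780441728684683673958508218940405167078477915740266083152985127352572997353375675716263074672018909151631867402120570618329112841834509263035636617914206054019297449508989139857921934058058592722206538775946285273815602154940087254602945330052306454723509277805122847424299835102853761314286062457151338648923093441425955738420679367352274604672392731091623611198029870503931015432221180809297641039091166434414738756251000512802175272163453928137269061355504237012954663661901324749448146059428847750881825622310120071280108314362196444297827504757448739449665631))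
(.br 2 8
(.br 2 9
(.br 5 8
(.pk 7458665690828497505503089899841805526260922488124464906768103069135900212224029623271410288339975659307425983657760309366865864179044835510641674320908536641037725654263366627388815663304438098932972087467426935350278726984244367747712323899516337874271334208497473960364971309481019337691568196961602137355408793696714011404815180502005810014903646071172424420509499567220079278819286166527992708820113895612247420785313696987962457340714663253470047049961807021084694913304774509203259516078778874207)
(.br 5 10
(.br 6 3
(.br 3 7
(.pk 4936285847539755184746965662689959926075124645845997979803751927591700625866192983755455066815109900880731258375937692735327656718766100581685258950522745661417296585047640907990907317539492266344117326487987606969237772124715807981089037565469771147501598992494198585407)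
(.pk 339064316638244514504751218672093720300100490176446597402191541679258264299774349430411272130415307116891659207371010619518598395136361415901814750541656488548150159766020114918837753775481341270446652897779121247216451666786854173622979984369024663798750108416699267912534292394708419740334268128321924934955638415876628853008858348389327904169909614951235022873818098801472229870904362002527309429526584028198629464071824613762876796460274468731300460361791))
(.pk 40132617738))
(.pk 19064517740662747037968136163072133537975528468879430201503595368404246437113763099770172514320920694884291359321750072458527416744641248214573839944241947337044952646429377853582579418976480024564545093000504751349297671239253848787785385857725774477652847)))
(.br 5 8
(.pk 9660191163424789387665065783630486552711169554429327409293166610484303532812123323541731774038097953273592121096246355553186427570483577546096561047318428403605989232980306159489055071)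
(.br 5 9
(.br 5 10
(.br 6 3
(.br 3 7
(.pk 4771838697351193253582822920854372799326018981268373672908638094387566374813688050204895730236281253911003806641138094574073952800387488080249561869788789568171752793326000718397849803925427260803754520415788859824744281804530879268974788137249494095085131034937247987775)
(.pk 95438120629286877449778537337214283158820361728860503002372922660031044631633269536667924147275221154280982349629243944056312177672758017401850268052750423275926809890392739459703464298563953248830750331236213921052674452590753561749017060749125089135405811158529712579628055283602522443376280044855413150531159460820097850675883992207291012505096067687130599930754363354806876572602817886807148591576919996881707330191335607207378295324705767893501914562303471235672307775))
(.pk 39063070218))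
(.pk 2668728335737803675006426507897782709057319504236945856635845638488464194679783783989485448745121867806294605721030469121057857219738702598561159658712483738924548528169841726816393796324282563356492883260264456592594654349764664577918116053968673798234847444007580947843269443395309374870884708943913094122566751210306994714046670910763857078687826804208495))
(.pk 1549737295641447681936064033422976925030714945604615671470442420712309227264739574199835879334082319585305636640346808763282287))))
(.pk 27228339765479337981851526769629023759477425181066230262257957263679544536235170936524141820813386816678673797805850171556524116914297388091436188457566881454742459956495028033309660617416707726037803947628398172442313135306418316403604131758831328351426521260993382676490426549004510394539267585674596290307590166624089426429057494784250849387816423086722953997605168763848022290814888710159527607393049596959624955290526459032065638098650461143170191301569355652440984120560674210707551)))))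
(.pk 61892902320071283687405109362892495806458690859925976713492935466902802594620898078943592940072090070116388014040831535039762078717168120091101155226834940149312012006129263140493686900717471296859613864301360607395015666192082039997849793903))
(.br 5 2
(.br 2 6
(.br 2 7
(.br 6 5
(.pk 4827026880973610440365149013900671868060780906965034381393222815931464395458029063727517066230520169135240311647)
(.pk 5786178249709887487640715825493200232466698581697312454604820300823792750650280952076928684991756718845555010117795215879126705419779594397468190130363371271608316985644348271362013429957150963517143255871196913266423015831077594823424176064563873783138697197572908860670231778542827764704693142210619123202667211175642380861687772776695246920649658876921663231333022705409652388196371281192772646813448143229899498303912253003768383619286510130992175039426202270505410643080481247713438864184276854762746299034574985682951553035077885205497282666383460081829141132713599918043260017108835582592866148641904459674549751958755880696889504830204341409895110013791))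
(.pk 152543378858253780855637449363907022155566311369278202112724688354496962060619132174589327961419107430191382261264651911648009140483881632172340882645236038406853295709473385185869538474580269876032376790487965340155796310404695834904018711490352737867506182847167828449875858129460928254190517334731025647411145910988385683226666955784337828534064416117387397764564384499397497734232796594435415140459198110381850148782259529307017603533980123457090540036610541819201096820752670677806498053957224749623796521496107107135405189698687180859635055))
(.br 5 3
(.br 5 4
(.pk 55615693602159358834243452025694686383655849275120705703302084470275147894786947782565246691087118343574203158048893146262075817601029478469255343674731142100374657775615930072896333827429926821809511106157712207379331978501860057773411399231)
(.br 5 6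
(.pk 1221647414307808913724247028983597263693608831782047770525210724497523270951157623406768912462995167750101560555867945982640523765678801338508154605617471118849128175546990133961558099527594107179555109546369302584858522920655859742610079707204570053658657781915196188480070628323816303)
(.br 5 7
(.br 3 6
(.pk 173618213358802820522069663356320360748261012314693271757790809074932736295774088790754372901551254921819255853224702570743247555289539541381252914051877078564886188482121762223531389405432158593831618196340008013162027593300772255539581230330509147661439476404773205565243108120872442680002291346499880737983612198878067732800803851297063739605628156598472527369957059181239532568180543)
(.pk 85042782694258347090068990613961982136410272728582954769100690246726116772856092768904274190602267115652118898112071108930069259411548618541726948853346919895739510925852465524823537302656367331691947393237123287012772275059740049765425928000621168693569837761958929062947735299049824350305301135474757500144409329793464752964892345571334304645691588115104644017486833942837559364469309322200694807276590027232118666139738185493745117224902299924331745579025547572466087727))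
(.pk 607517677119348429956596394038221647091667996965254777572179642579166546938840895874324824022675907357615420685420349500975130514563491525284660239454548781443516257596806408196708269382682238893354095493210195537862926449306911962585960296054167015142138870185843489986440262908491582214370983952729199224594406575105009282059601079570775939219726336854325052276594701887))))
(.br 5 6
(.pk 533554772732443957313654811940691942403513804072487333526922522405598343160175190582143676576658462972076632437984767293807484931074801775260755755006891773761842944486395569688005358403235163414508918130438278291729555776451265177090899984391145123441142763198749484370023004213091143005050039798434490496551797737645904549186628376595136197823470618384926992317704669610248403590708198164704448645499467920718586388446738589020433828645575750091992034427481706607014719462359396720293793754035249718635388383146545959338143211240594819952948018325993186743017192986422146396712727263439647028900045183484864070162475701346595449956051089343460099794132955628008245100078298799324890855263)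
(.br 2 7
(.br 2 8
(.br 5 7
(.pk 110086237676230171331030055971188616389908187670173014785400373370829006903227960675121505726453932329216117332892406408613819930159820544473995669980833445484240133541212885224678885203086874936381369696142159295701388300172083116002012376942375490665392024737969667538605347144579396299581407249406060941543012447)
(.br 5 9
(.br 5 10
(.br 6 3
(.pk 145108099243673446165872290204266829889180278836054005255292707259437088647990053694133056029158727861581694100005629566010709159950362108614281842340518743223570051279368833302818237111307445299609980575560193938555534796975738388468245736027265090314823350783090397996182551755307859944667733363458910438732733347910802650986344334135350844977281529733128185454547720593454038259381693348253469182389599991102193325351275812814269696201966539818981147902343001491575927822176553808259141079090211583441007241174519084983647457717832594872547246063035702218599346827707068771054722749172218449497473123670779090613317492809338447088708016198894833076957137018719003880739015993849291193232234648296486719)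
(.pk 17063002031037310458712562918569388706692961152245695230424208802353823341596193064031983390196330974165169007657852190615628304749967989693877813707502878027718972214701851554594041270802099682599261652796913072972623680590119821856921811238663438087746431))
(.pk 19064548498144014295669598519453500665200627487268501069224530400322828459844098541056599236632558420317820220165331599317335704216101438561523135757638189378147138348600085356522884104485102544547035725766389828118326335376910468757452741929392796219994991))
(.pk 19560469657912217489765939924112114330362379211928813626537616715058753414916382741186297078215535)))
(.pk 23925423477213820879317792415757251039419219994240760582274454318901615743739624920984520545778983501416925566328462933478892903631610172216149313805891669934024288358166672769015904813202920541065144551266196705331254850758564481923585664977600801168389915847682532009707567963700220269974951913741021160159111781013842476784051923035147584091767059524291416961734070896988864714004344239050004929097253735771823744954187597470700710365270651391105379587675508008975057047817960081222489975310235635556744094079649176568305540410462325188442608607271907672809819805973894683485139225954090753279917595231316209240391582133692410640345916055615327))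
(.pk 1389520110517402543541044693728459745769830472689831959626572286905790260895980804359400043856677910790164487575762894966788068485066817108043484527517543821515672948224521040636435371859534994872154097415697508372600922695388074485463438870371704441770311566114458003983677140632991583)))))
(.br 6 5
(.pk 21353641711130342389542200377807675213806852573200975362057349378375262784042669047701179582445142407158353904994227405730156187994078870630769682835828656031333358153936145072372287989013096281106689189989064048144317111516640439491501999391835048417214101848568736839567827742327308999570799049737960726081572414459931437286114792347437611825107791188929622341461706540879249733475376407525989313592437834776961082539140989283512245369426426437308654131213036421040237082279623677348145600433294740298154835374913816177147379029931409733652749314526432716339622143778788002297490593816226260918240618988017840454842462177015436722613321682253663)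
(.pk 17421360516904809068797938355401267983097554838264468803344289671707074191943714438923363602161156479211074286881354781698644849560376522696378878937225136280490743486710312280430297355084090317221479709190972068500700933002516950987398389165550846079072047))))
(.br 5 2
(.br 5 3
(.br 5 4
(.pk 397300228403594847086178300129728872551509619664481887913859945988951176780703446494015912588449899583662219934832508390425292021162449237551)
(.pk 74731015708702529121291745586454801849037920360062402375195367029385525957860272268133481201921189078132533867681200886937662189141869593412888871083528621628082320435743871880946271936519326845882873025454811689155773780122168904863490351050766906272276053774054504905585717127717621479987182136837292037979048222955399361492763779470974740518292023201466231383359110621663967415809883524140958383678002738509869882852778655215251582815091223554755092264768229239094797877587108948866244516423057766839026462417729146997627336026995717389037153981801254096229564820370756030287042834680871001431917789116775373861685057570392438367))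
(.br 2 6
(.br 2 7
(.br 5 6
(.pk 62308236704509435733634023504405946845783801950128372221255546483357658455150243967822171819019911420987059466044773737127362995923287323558842425247335870068925101023069810140457443883027821720390138568428960034704655418315956214981129140063)
(.pk 27227628377670786624866264188206199386930488779906457937096963768652071183851489876853882338108021950901328730729246251309835871230699309896496818536138765892079562326594367665617501715462467814156697700177519352865337447810087021609260488060071846108875602530178057055217065909279414695686442991322236587634391191973492879470172124787777033155021742646952616583630289211356264208168331492594016616984456785329023171293778867191643207880083353470165544207451699724383871529289570164537439))
(.pk 15410721199212029476433250455279583084858043326916778447521587894447750884087642845917024300264661444082509143318047027284398886639602025380993675917223226504729088446015311460746507743135320319927546995890615712805778147912485876437970203201909675161515275080268893018978042235939330160138941469920044411864282555589012712424115084005236265900279743434610834182967377489263041652783825701677573647312011798118790751))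
(.pk 55615693602049863907246959062014537988770496924947177507562021121457514577672748974650692122567328329773663296317848434628681240547170851701564747050356401187105874918850126095819092190231817042426533615218694590056975434566625730785287992927)))
(.br 2 6
(.br 2 7
(.br 2 8
(.br 6 3
(.br 3 7
(.pk 332167266045703137183605936957187736462213732895316569439237644421263898222879232579188383995596556114743475852488727827455552848045064912099963897983989075190935535425257879471585414796572429534549585547190605335389356977711367586637196917823575048790415108430225984763900715600755986069055715123516444660003573441324165122563381144047178978899840845673565588661854464282079854951940512775307956942574113825629222518109296291681487165041870609751510035724351)
(.pk 26671270321722325966897395345730938230942709467644052734123164954189275255744609451773912435330689315790169008640547394277405899233204746092837034017868618354049829677897440715902718778423599379826988326082072180069170764662049361671206136860617744908491373542774364903709095734784047391984298068266951492635875989062791120857931209929887154892296888217736641109857156627398352662251933170024623951304475991932730237393124076155019118586950479412168473169003606198286505978984962433938543))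
(.pk 864750343827714314111119864229563068377801736741844335))
(.br 6 3
(.br 3 7
(.pk 1352267808551935994654343798718997007773972225704779915236577000346635131390987689299822622707459732703237916904649557668909187951263326089305498309906824394271262886152161716385118552379022155824233501392585707502244091402892431249058695940341450698354100292989381018834867845027330111)
(.pk 529807309100916983996098739901317011046488395009297629605386674924710100895101592944516217743093315691341680097828449426086799213543506178921574615769520104489733297811042414738654246828683807425228273427664471826585410806295319643263961646534237316320311420231724629897964432465718689739565449206461954660687647415770324148187547520305658525048493744170325274663986527649737033641234285339717381984284369076758428711222503986443385280215361845695198108235332336565543904020582690345530815218594999568810673533990526274571196626031))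
(.pk 877028624249965728504540449400521368761592982009148783)))
(.br 6 3
(.pk 1896626190447162835178605114685585331666686613730169874729250990011993600052170717250935608613295343710324038040946066353425513805458908189467999023683865505520152051807878372459986280006071237276738437150146984055509075902524632318144206439919238623696672037302874163897993622414882773176259882876009590657925591492251063406851968005333170574843013673186391322162601443770705563946440807973709361906912619669258530677652821033081474118679023103186424499277577672310884530029869547992872286365855078604403929681163375)
(.pk 219888483640775494639047818579773363503617598723891058767179449127758130157762683783558754513620220159803827842574537603303632793834644646925996539945362492342445527965595038384643256026209530370925128772732986548984379021325679)))
(.pk 35284981001))))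
(.pk 35284981001)))
(.br 2 1
(.br 1 3
(.br 1 4
(.br 3 2
(.pk 21034913491049102532554543575945530587337651174068997807539105114571894847283323756699595963453647817079658455016032168412493020094151787115217256793465846944449140006496251850393055342738180829399957954008283282679375549871208556846158862570265061799962786608588122449934054967380578764454123084750408641594028859145739114527123698141965560328637069607388232829836389968686657642762733905355696834524085018298033355426326333854189978958198108635501077387568812709388848513504700986232286105446285003990986764579773741123742921773362768129377313935026276790227422036817335232049321852952961574586291664071478114236642690408915236486216196043306031)
(.br 2 4
(.br 2 5
(.pk 37165475159531458556552792918811334233446125298241615746293319160242721009664740865819022528555836215055102731983571737247748230590151889010506736302267151040964387235207757717284905170742059288169198797145393784398348646812335094209334724699017213235620065840648745500607016137841383428873723661662653054207951517311613301421341685249090215048564235249838755630984051802160918971733637211518303116351613934560849576102213463248643514565447745635196789861259896248459310981923847213722931514640911014248131981895514865208131254299630910891737911894100896275360095570313938443118489380992986692795867341008365196714992880827488267636332695196065734601909230789256282743868824444944493765559556162973061328994614132339535)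
(.pk 4340164012817063234243400009554631260963304327395227910708061668871579806763709930050276758777916716626748218588951243025029464995435041789097339537427927107286584084027347153361856103041417079573932378568723014136836459881939873491385358622495008180433113958545618105167))
(.br 2 5
(.br 2 6
(.br 3 5
(.pk 48135364554185025036705628014562650721944885780586692821482042915308455778660480367889585419219871227125645961150412912602462166512090103559607548314287699595507376454954531850309043720163655408243293309773349515564559295502297761166609875768152247371358404389550019004538867054446528061900082627463306394838140159115114454888640986195953936904327055129115777496104708627629861564226606919753517168191)
(.pk 23604743521297687550006706266705625064670172436159854168605450993764012680704148411453662232755159848086776754819563454077286127486126587672700483337101155726214118068117769744584638291534639239199532240338260474622184937760993105044987391654118904352851903633794511959820073515537814131747941703017369586660887221494199597842973927829149336705652451352437157792146669736191609135784561193494106735369746121552377665815081669352151750144497951424952712282758731313317096993588714349958494381609509245903461004034120359038244454040863091599099454471564587355927543154082074484609526459150808284470068342834099099984199475720283347967704528958256959))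
(.br 3 5
(.pk 8727048453758608388990001518157155363177500038193554629292523562508967813758818097446627804926581840069672800500301227127046145172334343324594465219153601818224717994491288396017038911)
(.pk 943238143110903913550231224081029972214564562436095956404526780591687433346365639378381457677898469784174339549908826764309555043699085236798194590293846900023979788760134022863100031668780221782255529436475469543962945015382261421117945751348090220751375171976671804473802300564119562515493089543365025638225204170459486457952080676945556767739652578934767003982236855972045003549260905549040343186814385002260191076165558286148360750305353964411298524632553214680097711861717123856652786127380193133472135577532684786891148430969758916173633954487811743926530675007609658662463411179338928381819614783)))
(.pk 786881370649745641666256235573610737790052188645815631))))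
(.br 3 2
(.pk 3809797738422524802763696638350660840501900804700479336371213670337555779866127429597594870110238937642958200125490414034057081156046044291610817707653585393899895965693118115896272114199802155430578051107821326261824641847688468300870006559627257552314670868228127061039)
(.br 2 4
(.br 2 5
(.pk 5965668399009643421091957647252310868748136304989682754887104379450031564832058194401606649495111183794576392842035086583637647148335395772870709036700218304091191281743796009243600420731479588661278434002722288446459363076248134119316650039323446927752389053703403264478811243952199389289134572384367663880209401372630430882686643212379988775191045971170765373173052136351673913438930852793399313318013165021641959345530927301446015788881226360663441171784939915501450618995149176935640863665931075979008910225021519000744145487078289827139725480162069940630953544508784543989739501992621125931612082066123248988732377694709944037748081637145574939743499842623)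
(.pk 3813676513250515620248936413899913659728045024395570866582915894728071289582067178695649620780266754534888725834287943165271370016719663007758848892967215174831928789284670399467130074525043507584499300636577214989218498942366485022564487803001670156224590927805625234674928239659598211043378792242980483565520501651790434032689795603201572002197166287382858046304706011869069943581711028548512324348560814481866078103298827875391))
(.pk 199364400726511052465682098405725600982091790350630376189709494056031))))
(.br 1 4
(.br 1 5
(.br 2 4
(.br 2 5
(.pk 6789443952645353643608910520853385186083801459728445927587440719854756018359285681991585942448537638202747293523456284875872364923417954093465490416770837258786682123035430952379264791563262513368404112833153727472457994617345930786929752507533583678858121717849009336811341437716771650657942774841623440522881305257345233335890225919137691291604176608902282942183743559881851758810132657978058279375370124519787210371466059460691449086645940529144591028282173923054625236347871056041632619659965822047)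
(.br 2 6
(.br 4 3
(.pk 943238143110799491671824536869196382846158972205177376940033300450313013472213568410088871057003190072026975921226676617826700605830367923352700285228574141964168901314938156429480833819887322287330896829039540147336639474788712741563747970877895782073797403270275624108079371366001861867271103777870783216166476753538386329551930929128301178395597583656058270931770041189507091190198881255442714748800755422630906705010191268052290377465227166145991951156499497434524095907350028044646160284646371465044903087848909606691789152574538490023482015776647616206635307784255641326889699015093343060183348559)
(.br 4 5
(.pk 1081620824204645725265583070098794978193068000187059887738757661713719982977056945603891116947698929653599941368982772375082157041286075481391870296413206644880421092761614437938004737692996679915496238304908918305448143388563106187026520521853013345051681505968643254520366812650864082823854074100071228402730107592881825731152518217547365218949099470269463130220234811603585444490981034313166605660128124670129469329981010548495895502328886863)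
(.br 4 6
(.pk 1230866667491329725628403077339551619301342755413475733686308626409363628086888395259107173053687395883668556251417817425916446236003340705215916789343977425728206133170336909508674479902162632246493629304945437111344619666199005773215968421043303901805715366849688739331130612067530575)
(.br 4 7
(.pk 1065649130800048824285631769080198100609775135546700903562772958592715093633231041422547628357267519318692374570454966829899836939281879927878943779178987671261375758662932046684685153873004780543293710977828841784011943468425023385138850066705179366798332511421923622083098600079474042239852024466957862440266853877835681082599968411875013415297442997811054373938633861154871230746531596524435113834648454366233731968155400927719739464831801343341670792792834423768236366104004244016858530233524621478050378078314024941098035266356797434411639965978531217957899390748672146441098124705947664547858217039)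
(.pk 4340164012817063234243400009554634464792116844327308836988864661279750369537738948089658261267639456619005154069731680279802856992683102260791563664325920531909854048328824840414251750884124537613274207722204100333909821624082039478241431122464410094768893928759602967391)))))
(.br 4 3
(.pk 15419360056572853189903302313846931838615783857739097115554587942710083024337489759456268042213433407658971472066394406475523850931264408191602259496722308217167377122713634155120105226781138523353513136584680658970940705764407971558917489815721459280377167)
(.br 4 5
(.pk 8793439630437049607719848442379314331380945574111549613826769680765938235387654473571684557312022935373872538783101142867700628229641030586397907409000592366888530070488270786685957711)
(.pk 943238143110799491671800224256035772182954005828221760035023825809084039698748099665444373474409711192500772951130523535257051124993236201941825920049147339974344092159514197692407531477384331104479785669758713569393019938926496499707786233609261189617805023872881694007596588470986222732211101165560527010930214219734356075301959577091677372358951259205815743625704457152358527058849588271966329660676901927096335397819289229209093659313031785282350467938569026114023430807458677123172166670339754397767839231620592671908989005890235703815791482407795860853087650478579094274240069932072206132097381967)))))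
(.br 2 6
(.br 2 7
(.br 4 3
(.br 3 5
(.pk 2389254918443333490272925575771222400832342687703620746273601303721149962974821302280610483525570194683287962784154985983967375562122292765634829755825903573339671869935883531482839141391761461407154248487444071471938755015473479241514628952476452698276996765384227299865282365910951761460280288541946134016771324741156174034772414443405830723994879217038911)
(.br 3 6
(.pk 2099427534032667746396789864594933878041748402462291159535844126193238582066113538442690817290169502272821453742965867304584546428977409129064144731742259048512981427133818013140535234264598345723285462241750971166474442693353914866428149793856845146742148045890460031071879105206533253615506781773565904126769726563610485787788310770835990746151123866121452865551906434973990814878379229835024020532709741778377034163755289249610916903512895618216122463084309048526256164937485210599500921722985393638338500875450175)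
(.br 4 6
(.pk 2438649209195312059946686660862219414071104611841645746704250638652795687925189236357515223023089345888291370111438080913868712073444557564712152945191608101864601873179488473889958983850505508536555911846537537368528426840890820960593047335101148506468774260579999327321196996620460084074561226011491822182280049241059626277426553727555429323060458149115727)
(.pk 169715259800176271576424409419195791433867980926686707226675169237362606432053584308276320967425489114927884501721123271118948049273609141924485604117843719140491473940852579320795175148878824612588359457179781430479107810791910917635844896461220069350021777367920559236647106110978337411096398047986907400632865858609136351921713132160313701584777821239338558002902631661383641406436687))))
(.br 6 3
(.br 3 7
(.pk 9660156592573597393832357608121585688008685146449338045874155167840491771838307470224905904970936635831593579027812429651431643677516469527550377070775817623374520077702243099360098367)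
(.br 6 4
(.pk 2471418660294617068192760110869794548233906216090765158240026471328232315259733311212181034271511416910320613727352462798009896175617930046096159935525194797616660818436796146617146114750331848019665051387740707242851006850323935625380088314087249196831198115577225603461315303770654279706316823491631780484443626360066750842993871013918925496162414785590639)
(.pk 168413969261773454327771985806500060659112291088442412271484392506920302307641904673645095097331993143587356662814874444892825381812930545532155625414393409366003127391842202256709600706140497342218444048009988568728981120296266454409734220752195057852287318773284392676543786261808313555614759771931001273766657633507280091807403960738925517396987207461688367037360814376702365900666735)))
(.pk 1857432963019527811442568270014401210076892155619811860691131857710018370885086022574656506402234464919944709548783819776169134183415689926946835245403698451642016728134715540721563221399095032510694688108536399966070885634761643322190276059693946936989108981223719900276362966022048013284314243676763956802246720538787255022632092936303756279619091925614482559508222561431565311921518621117364112993065234627449618037437389637387885794215939130057258561766156239371341155806621466153926231877896976181231970318071865370297096285010859357178411090989705452191786603674444748109017127571798863881024125346850961183659120172475226424416908399875039271688063783336823148713931887)))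
(.br 4 3
(.br 3 5
(.pk 173603045529534959390782130278710092637003318638489760804779866242373122973694360664109609543189238127886122344301786661759007264651456084163836723723530228333711360426140677630898684317271021331806970715210366756092957993707106208184651731964563784342078500757727178232329511138738117957813086316607516291886553325393874814705991465682413267564764534559963863702453834429643603864647231)
(.br 3 6
(.pk 3813676513250515620249034714040194944998473455371598000826562733075765394665999308289796710229274331147829668214100168749997650708025643985737928375126590006952211413498299906730649031646945736564714022426937645441222512129824021399348670928410730474698711896343597547659502235318463857718280980678050005065752675704777016979475538111805818699958537038165327249644049544210165014089604319107624254396603111934814437009858656401215)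
(.br 4 6
(.pk 1230941420106231550484156395366629038877073795944238991404738872878531524582129753961480740075807062776430512028978385175508937892145270741640804012652790231165996703199319722043122956756259114367348541631699318152635526229149849098672056845468442475597412645355982496616353797045155151)
(.pk 6738183153450936656137216122128555245416496446697210970965018590984104545909122366534336724040874929651269393929286213326129901236940135303008117266143428859595254304284236059315445298548740191492443436917828923480162800173855867938030409395281022050582458859208636872049050239368883950024998421654487811562042480741925328348667245475830280415835083709489063781350968803772617420339125042192969351482098574562664864099839462535690040789525544785292547362443299766373000761175850062749978898630853326159))))
(.br 6 3
(.pk 533837071765476747930511982161275299034116074174485743613371195576915023604980785006907893293531916132651294521639777164408066539863072806230231584836009532705378307868015161096123830059514898806273921851461891757125282039789945462090850364751625405562299882473896989729707926328160402542194444582507097977887116651443409274801193883677379832015991271665140412137441983127301780831421603123172311578363510596383142541279678218696733192187762380808697794108762121671631749656517741558553473180015748114969048579434681419355907355759)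
(.br 6 4
(.pk 151409380532570284560390131310045695492193257086999320212859835184575656567785270830469507267492424576535325945695698290856795365231038889269099813496266643210378832361420348834160410789284189259382113809723303228531425135687648333431661428266880444921010858730728796830475987600606670815617155564162677801060652121334566126118587298706937665208837617696101030171371896645136757401006025902024001404491710574416108403240797812469348062109790581805403545465699615791084830426489336225612470094784163015692122214178938578911354533064194457100285295)
(.pk 4870529785366444152631301863615721370982528887267971164676771397202738003268606003744584642714979213833417214269613928238987326725822934212754346291196302258340902462401152510008977278422287303444274385822755860949849913391095967900983600923960443747832474692873704764511)))))
(.br 4 3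
(.pk 533853869932548065126329403150782655163877532352483739764882445622142765498712553083995667476972181161654040546788811302728129105158658892334462470657867383016646409974229554624429803406149491323079020573643606877575829202284530564233322068375862080377640340009990530523125074662247582734505562719399527809597977871846361012573846321986677934051052918176165224974840883628575155158569585409190014719892762469588971775030872591642879254605712477747948049325763032872481338215118362151400615757352899822337681781151725267823928538431)
(.pk 1911058578449155138549285569179957325516795057305861498514262799114845952373296690287976000661854618521327214472953066739973305718558772214955660844542822979837418427515210293574804122905218567528586500389765478643428107710241223752061278442058352268814272331343065125097859949839616799117481249474762947474694604510099655730822028406714475613082924595003871583051227750982881665648522998283155758501978682153945295514938811531322045214978159075270772827325617902379599025023978806978762465339823675429074526317900895))))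
(.br 2 4
(.br 2 5
(.br 4 3
(.pk 15419360056572853189903302313846931838615783857739097115554587942710083024337489759456268042213433407658971472066394406475523850931264408191602269116352727398772324944139419087321121679746781616682693951654196442299223733155024811606967119630184940937016655)
(.br 4 5
(.pk 8793439630437049607719862501484922278869629662714111283224564390473103036302743300053741906539328452318126996214936702618018851177535124724146845042382290584729029981304774394685814351)
(.pk 943238143110799491671800224256035772182954005828221760035023825809084039698748099665444373474409711192500772951130523535257051124993236201941825920049147339974344094153277907930344389159936158640215307150763662642796310483448207451483135790519120899854937837167676164814659341010561500016776796254467646900841750923635696256828946793108442566397910926016623160671425283576265389931731384885477892065162946582425411624010598132788855265404053390396714165794243236077618632473307627721798995004855182851245717266089002712294973987224360570481585119766130108598337763292327912647366619808536627392604862031)))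
(.pk 3813676513250515620248936413899913570324588232956062135098194126376707853949911074892351121834604813784094053546431220936326094250870687454142206106496311805386447833260742585419902784450384844499944065330356972407340711855512889564200619783501316118254328271285237755440224165868091070734418159197834019960092758286336611506725321123025231307221114114297902288401807319944886418196889323197361174363680800449821539375727615734607))
(.br 2 5
(.br 2 6
(.br 4 3
(.br 3 5
(.pk 42296261165880171530255874198833306540008708619828041436877944154838905801648085792148505576430403838081100591883727805096373049852849228434113418117563010100795463639367656083271392167835942902476032560127143720476791994324291390648697923946618974710709375362239257945387313825398586627031140653605418434917134107521936238555690261892641645068611873094321160042311603950254505769535391005723809990072392798977645623726355207025190370722013699322904519451613853453647347600498467246690435776768628418241111104040392605480274038655891728775251638529872315676223)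
(.pk 533853869932488964437600701637170003524950145597307534972312087585521770053514418534632730575027354563385026617721007210125912977367396827658889282942511900668400496385358027375752767868287297525355078069866728037621208586660937690138441290745682803925335625960617675333115557202268030955426539283351671694047753106557038269236764259016724876762289066349300037079681003442763189377831896255589672893682555221663347618044030162518279430178756850644205863060676847975371613135730582264148863436087242042343886740200050600944945395023))
(.br 5 3
(.br 3 6
(.pk 15653910672987565278130356943288365841298581354230860792265186201635174500137562787910355706358920044555083081149150751479059126531738081376782847637554151693445021020009435081751644417761900899085887733068114017273121294087487625086374204921551184725473087)
(.br 5 4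
(.pk 1221647555564798702330936507635797562031596250777100485235253746321346839671929376616019258280037081748496122868549721376652891719884609901051786959553287092848829852139159881276429624983483702091097398540158868274481270470416634972941522334222848227040719920170977340490593833182492255)
(.pk 6738183104565484650971959081936538626886622519276104677134876168526726686556866239531737772942237880506127820090561943769654190358126214611012561339476068896203025809259247762234198951044054792365435447810675420535728015518715062988955245491468337104846798860259721197017884385299835952493698214957208120995548311457994590438082659410047138453405322045444908734405802878290191502157741964713567765423964547045905156529908749590842224821728263210012677651541275653586217446258318356662667124224902428255)))
(.br 5 4
(.pk 151409659627665281109147576041070716793182037459939323270275844900768954519624284994594006943384791370733170802881262532146828923985962603214114908527233658622213235931224150297700589156850239574130738828545415010876371107754963656467492893485074529652756326355189197089521929885434483802660979400193840555425920618095595643700689866387232515784340293134857896077446845384692282621389956365560369264526991410694866185042861639036211589370422668990986721971603933524744285203335372293010737794978137398177512916980055721820258253395199052576257615)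
(.pk 4870400746199861492915693924785197750602826311192547018420824291659480094228791474221512432771955420972380233187493326407500385057761534307351394107953461626507448610629838693960002919311332177441892009344217900526900060527824886609503174506595994701826261164260257559919))))
(.br 4 3
(.pk 11905339126615263064854791086178735541877416009053780599134440790188886995089468349562298272580702802260917428294083499236961073768250358180243376477359567883725727157243002202450908603289604166056796711632741686921698406666287621085369841744342214580781961686043250444248961206896457899148108957687989967769712200952435082130280890617019025759128486843266306713457393009503603210344320733006521571749170561315218094408196127365339987011084392644640049462892101166182526124156946117592208255840294057898162551326925256713783135221306220693336404183067007099928630175901939007)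
(.br 5 3
(.pk 7668405991066694449251018509098660758750524593573841124763070443393315670949140201012577601944121912768442595164454432342661238884250489899116946911142189428275755679011303690999459295652227734193720361768409219050390443603579655217821144706286120310487679077797741778649017998122608704157666743577565945104059508523015071717926533616416191583)
(.pk 37165475159531458556552792918811361664909213303348543889131113596498608617113287532692339873394290029078115010584803502296290872790861850857200871490483381952997000177451019970307360776628241519138805129138207154427376831188277366463041572207897477416836042624177990970710452552440330450142225734906455014765109228085462554028620506808899190268500558458566433988191066369170387125512945537654612937571902388958391988512820869728512396557570032475871293828655061104854592009023936344653207896867313518968227230815041636613179559584146960799765439606165608802915679681812558025063686782864540604566363314184242379014748962575474964726225407707974642229412209930871259992301672841100351949624122910819920445859213493990495))))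
(.pk 1666557544542329698215709449073559963090705846981208384815125530025383934915769260645508612982349868598661518098788173572305131682802994651583515529015020425213791316410634877202469980704378227185711090084803976158697093545214904374684777569957542349626847376823676675394216041933316779409562501248188242875138471583772097736502299576758490730684659331746583068905404891949446608962611147870523296146545845377266169583196314767031293200632757396155237216599092004558748922634256775201290025491298436677438921017400381568065389542809813067889308790483404259806200208752274452172895526522527722316587596617634053316088985182630766420317225589396772471273906846179575901172527951))))
(.pk 1942932830630149148810539948273047403049349025049271871194576425327087212138012412216844842542177389688881284671164593902746088800682589182331004966448692011117833634730238259744775218303159172204531466808138835025563983925849885456598294177512993443304585059505500074922534178554403449475430136499481447498499201354391396177784266806984368399868352749892671)))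
(.br 1 4
(.br 1 5
(.br 1 6
(.br 4 2
(.br 2 5
(.br 2 6
(.pk 1089783292834248519198617206840280912557592245222063894112863573107612011566865339934200704925938097268431343658751874367174520448097534358987265036923712190600563849335320753186968949128190792436939630149314363793509787925115003383031705110813364952693531054082610135391061967458799822526197673316062032050845808900343741916913772051957134181102195921786712160758741603265375507081549726729219067284975158755081053647402141156114230674203145311)
(.br 2 7
(.br 5 4
(.pk 196088734640430962314396331664164182172017363554967886581001956899513867583339207173103575692310286286112668245447335273927521646930409743552941148335687937526975575699821809542750787652369914481542749701953980345254885945897807)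
(.br 4 3
(.br 4 6
(.pk 61888134226518385806593582615639365451328394423488722613977520532163606845588267455107039099768818822383331703635637355577648197609520496514143245567567342317396821153140038130073420823392007888732710449561010776501664700666298453726245155679)
(.br 4 7
(.pk 61888229613229976762127777841022701693382547273464201914701513958553829755588368303420296645771531855081400552988935190465245308730417951231280936218728760735399533902848170561994031379590440516554922898301216377743367186722838948313316979551)
(.pk 2142710810307280664083580595329023909017396685003755005620266008129349343208527443871543769289985868294151233746160515339892279537221787142043273608243248846435145926235759662205474217247985665640036977988849114380041484175112712242679916022665651632543108240256072905944414665753547719262504768785538945225636097817485798779416288049546372972631341173759613717567759097416223576868800767203117893684668828706539830508147513980023618119762441215913095064589437673529619266849159342455007437120034061573592154570618959)))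
(.br 4 6
(.pk 595013668232352247908393196852050803413421144324017890317243134253900895895734780149833043810981994379791996705286489578299285795449044532866972155379520492021207749580083461754303224290984506687754958103464249181373064177881744914758182150188855356853528882668933047072947597860959190302039407158162382743485942604467834068174534713900967951903136093205187727974842394293434055753069971339643232868987082976042336280961195951587345706279942365484484486276988611838065305151134527585772805535522260408413655574951364070823454766927)
(.pk 6789045035183742627770959288276739208140889343348121382192616441088321073143815096173316286108137658796388535878863941024430609817429154762543053382859679126103546346629132675213982881268999024953759938368380900969788670475476278015683953524074230957789570486362292093713099440326833327531408387650839300379496799054347577607074059428555717066945358259999394399478880590144916346278851292841598989156694542735482300670508199751330438832477151955292446268223425391519366476993961316280304971691923404623))))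
(.br 5 4
(.pk 110982290742114484490050689846430421250452108441718929808593821607637281617064485149406157436381648271412003127081321251638246423467666159134981903208543055)
(.br 4 3
(.pk 23938126839765623438565290196751719315895313872915873388877177073105461223601122644583278858121850603776196276316246207972858523499401238731085070212861401846991552745765709683640668505780939953183686848132231184647466292391364651776017214600098681995286302427430683304170646849945497934715015534833846543719937809445138580378629185016527856342227479092908809479874012708029371348736083794489383298309393330228758066286761417730750372773267352195396365582540464377050038902956419402036815)
(.pk 304431308225086621388050274549182171758800690573372967822971795607349600116349159286444299779035849400976241492509573504219130166223132389644086745883817261934592179244170783989012432752741958115102295764570095589792196867990642532936705436144201120404067688325263088511595162143449544065328875651788737439575335083346427215432764259128069221834817517926023671051811928153229193389860369764790971963541544097330992522332917372225264914327653340108640885208655)))))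
(.br 4 3
(.br 4 5
(.pk 11904986713560065373699856237627435602506538623182888457806953282637530758446546383922137282097769804265704874249380883219146727741794075679538885156175575150261522367152233315886266056742019947679918516030134466133581417172315876883584308926003372657678443542457708276650628212613880110432409150051632223990099387537487487747773445782879068145336673956584298608057631706806134231523210786185065148589234909386882002511511113398608416023159315578334828015268247793165893211404245152834885210849882893272400002158295626782615329456532375700818056884149885941744592691524793183)
(.br 4 7
(.br 3 5
(.pk 2438521423633145080638277690987820520632914504011651750842357091250745680939273258016114813597368623473504984715335550357897176837458005304324715887515041606248040409654515018814133091035047994439306821883270465261583304046796685945684724624745963814403150152295121592272521425260568685435811863082526797236091067178288549395407832401799258408790185026713151)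
(.pk 304440291585909388162446705541223898120740567968509039524720975207961692601170454523893136979213695106026789969965569532240113539576240923023358436627769401847887243582716120809088657338772626438579871513800984108376445763541896618342454151840285068140892596046570986861335337904161021219269792884641721638796573622164003878008777255304697496956067335835844747317903276863345072263027935968433635448794932560461078870363063450628574703304088813185001383458607))
(.pk 6737983694719758170435681422920779945173284551034527409244018166118593949738889412565895420153137195200628987776065482154420509018386208932218822273727810798729300744103552444221035950688997034990848004867654421199653019081475582283563972927401163770355728504028413486465016734745106661474565479278513697304953803497591595560838471516110258977024096884570284887739038762258326751022667192784925010049766333185032380319648585718024640834490977114044384738580231003612712355066153148808905836402409993535)))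
(.br 4 5
(.br 4 6
(.pk 48864728453468251933130154581771259823613755202061292676946763868423227030711949208436337837116529061967789795840437711862821081218781402067171119082192187328081985025279167163682524916975391516438395400173468313138842706826213834681254992881111581308981414874011602949539103893595487411501543608994792799797038650626136626995224822251623022811909728964253057095075740693674174443211793513842640024943)
(.br 4 7
(.br 5 3
(.pk 1212733085596055693325229842935836419615917010435015740792520022757458335453240373844934267292508814604465389643477595432862178654044104312475138591052122228175327606720277129599609045626342963332220441885345880929300911933228067919983490799783628724948847741247808549616074565810693802099808519899304886729459813694182491213762694989701088331822802667517305765978801328870676007980237417248829681122934964902506466414418176603060243574979753567)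
(.br 2 7
(.pk 61056387463301212299343958797559971067856489256580852315022218427249564692149618810850105593365361427416143225652212701376968600105575162762373029900627665562129748773424262279256108546454135453882535743812454077614938715482117682296415320111)
(.br 5 6
(.pk 346479162806710490095545621227024141552850879647915229177664477449135458208685380961872251222104471552788580091076425201663913523671503486044058794437553508664298961675665784589052507502662288828559883359187781998463604099678796400074508846616572508820994508246841005098587532293658595466284699744095)
(.pk 1081557272988298088941783223377198733113927283406528616758904483381307828815256892730631038989426193298438377170853294220659219743644835569505332765996407016779012160000140318200915157099838561281665499663675340653688519605877302582175510799771799875654398805773917777232109560041849620604006010153628067828608910968117983885066086138738598915229229981476338732370385908144918858265689592425576456816357091682003262724819875748593770662216464223))))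
(.pk 75295117684293104558902412002430913696890600412785301697679800299284335307511195673874200531992418623876528208895736243522599046487786773562390639511262098052316107361865576733842233570044758698716496630816801332916703797572997481127183816329471746994272988163034695928896773307992321304497421416647046694330840011147710745830503499826006436854913357630077887480219474647012098861846510738431139749207229092723075663187938956668356750969657062597534374638746622252211065134919904689281261974408211086030632555845788067545874097019454289419266153102933718441980357416684430984813959830670805864068701404536628336970369084901946684255)))
(.br 2 7
(.br 2 8
(.br 4 7
(.br 4 8
(.pk 1527917758256550064956892028258181222836489395215180678539323279010891459857913923282669677844219091500342616826202239580764047)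
(.pk 72994222057992607092521262336158105323011942374001572040719363848886948176237233590282804327676473210264710069528166368264266197363514484256118733368805754381011947458869646966360953464980719832787625878480800109883979160060161499092466675108952771606367014068087189112975707841362722490556269082687149465631072094446981282744202623230274012929697118689699970732784370556390406811068784953297887858760884720083267990722182913431250830840836272232224740881481872896034725206801081618543140007662427502421034257315144933936962154019263016216640511364013368939434120565345446548427600607429742548892963017223167009511607528583660566863))
(.br 4 9
(.br 4 10
(.br 5 3
(.br 3 6
(.pk 4769775046840378482752296334356243567951383016822533363130808921932909137133113529893375377986844725397197888108230356510959056439879568831129910083016530303109653131787762559219339705528160038664243762878999112478205787002984488011073936129664693657535812485742985738047)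
(.pk 1036552101045149735320733817155701312805497440142891567157132530689834456342842897023497955009787173820871150991275683278054908950845785929245179647705175872733924783351011640014170395071910116269529985402206641238883588826763206653553943680175454690019191848164961981451783880291758882927397745314168215282555360198574927730990881671886362881661617421913315634988614359961252960339736824233701245191998265231837520508569808218582572394813210286832625750795298029715763352650894766245880250223376463359678965174741589420683028024983972655352145738178352329884786487490091297464834370741003254524182525759))
(.pk 1179710377271071679227405581792567681808060767110151065781658485433644921694486021762216341074384212889051402759844393478287097560867080624997003696271552493667162362752810437837377760767466601390921465417521231884172409207698457815443537478873120057336422712711647916025063895963569424382196338086333862792779490137648562011313077661099419309204108019712706203987243526603765571361109338226544625190235043876033320767145509665021416779253281663))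
(.pk 23117053914536684868920001209530287640536263517974018810287025368724251888787614020806515797929295418308218073470142555200505966491348905974753124821516242799639033555823716381152947515590021035636143617914283120702592625331192587536649543083464827412499541291515608357655842225541736636529998000574879277254604928404316941443738483341234951599046370374837755427683009857358237712716302127490810591241258430453190669848686227861434112062733497216401789151752879536771172924102171215543704206041099559947998166686002314702333860686274075410114930106225295280397600757944357893082339767405697649822835842088751745933273473535853328383993052678845279))
(.pk 16945645053712833018922060001529100731124967176125009884177198649598987804563493088228572724775425200293069452417353338313563327201338480833122532387512580767675937904796834272481472527445585773682193395408003042200964472126716948868478817286107151930225503)))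
(.br 4 7
(.pk 2108300146075467843726710985796038414682463490691890939726637142202484578396156129984924519512191000910419693058228025785869852265017254479646657596127328873019595252244055209510297809616826542193309004857778704894841533069537946294147557835772319297536572239864259059961893023769065988262237901892477032807710807638729725557925990407634362812234743164696655)
(.br 4 8
(.br 4 9
(.pk 52932355531937570934689946610812086235140191422826548319055350590294576913783344747175935759189001484136799712549110760962877806456911490837695251277959196713608872696139687851605631709875186064117307998200323580067225990640684168768765406687085757420034997218393468613417644176352608536139279988932469899276849192591227167377797169116228632228085062526607720828256798794997750847435314325598609882925153103831624153647440331944000064671685790992370945087072472608019748659443932323304760696955108752676534045525725607343831854056643188352142917534032389731167)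
(.pk 388477508204702654150111798046458210712216090011106754467495103706069401548205747346688744014203804025933686688229895713809233253902970250819243981179764448293091649631862708796106087732261597504414370864193586088326291140022107276403889256046845825886239278350793750204699549201628845495949306622815))
(.pk 219870477727796305711905917013960341109059605620739181223272482071933490903685168608897126469693096891287581306720079788536158655650483981916282393405311001872539242567779450231500127030426659238750122078978740060410646764974943))))
(.pk 23765394524017490110996401324139825915822335257044578562926042801112678977612760600785321982905734194805114974720563792718324631047879456148968304936293452036986032413716790660518574435161156571378966642496807138219692011622042986914490821981301457782892783695289881645327858153476001027172978412376866552052153952250487246116946686013442289807277941530495534987205065724288210892200644374600816149831306385569628617100729468795168797188998531403385460620587540254729337283573764655574365610144907783853927409265393137404638142508649837960936901780772080651940813573176494492330830681593165806334512252530810537315864679481548196267539052561233743)))))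
(.br 5 4
(.pk 6734759917077484396550453385065161642179843969152654544192583695321760621681716296964874755902974693927568568589080096183306492548081662216775998475637219154096046267232892596815162924318693751843163274683710730407801575187658567852917748711447918866098690424265353340530062189555410114235488303799802654987792124066210807045794628706195289200764157583193449555818457695228366803447580106893912453038762871785004332822708032429061706925641338016185476591622550103516668352322304809032496337186756553384310919486259638591467237107047681521473124363455552039489796915418312695977042616172540810570954030709321946271025454875299253802784644126579324468081479448143)
(.br 2 7
(.pk 147161013107251809356791011708678862669978552138093766665779909758146485030156617869127065388457282602780805500437127005641695222017466035641391726098493748220283742849091907595954328281625878928273183128488993835980690490193699536509877859176863677354645926159049891559125964282894981732353986765151154703954875838042636675004078426785129930076182480911520675298837655952437456299721581592933496922918079663111992301679984844481173831757851049491720845186248352165815210519986407570316730355058732896207239948312648420425054347579643547392081111134169821575921382593612146307294048123995547452380861656071070860815660684694960916252788244940221499867184957012361134874250466568575692818986246936292685871)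
(.pk 798874344973157021892379133144972089933035770481014607))))
(.br 4 2
(.br 2 5
(.br 2 6
(.br 5 4
(.pk 110988811949966247481246202163134676677063457757050045524954597194376416900249103751304273882364730225822938024467817350631476664713719675270186498281304911)
(.br 4 3
(.pk 23938835459528237436676136419068523819276015460003517916209576379046017378125890725124441215573591911491185732895785242851926913035507897955688150821581000224641243211383544301040687060512587525557163472175712955824666072497668912195953515333090261272922121144503974168760241653460545474599544304095717491612684790475266527350876151252926719389866243015029652596676775212477471159538838794453520266252539792674770733293905978575804084554169427697601303488820590430919791700765634494592591)
(.pk 304449196302763203053601512676913448643320250317679818751166593831302102953186207733333198070467823819913819174290004541433650183841348406957480473807098734841788239033841657446922150635063131882805270364004268603916007706487688998020989777584546643164053014174565557396969488856564566338267105941008359866064482721186018851055635365179385267053379104409675338427334734382598379474933549267919388319156186411980055234133102249058870629997519406569281654421071)))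
(.pk 6789443952645353643608910520853385186083801459728445927587440719854756018359285681991585942448537638202747293523456284875872364923417954093465490416770837258786682123035430952379264791563262513368404112833153727472457994617345930786929752507533583678858121717849009336811341437716771650657942774841623440522881305257345233335890225919137691291604176608902282942183743559881851758810132657978058279375370124519787210371466059460691449086645940529144591028282173923054625236347871056041632619659965822047))
(.br 4 3
(.br 4 5
(.pk 4340164012817063234243393017634734019553426599333483547783973996911023706664379949668092755302052014545569449434341757947692190661820956885591967080537022158592844468615635242394965246598196424968881521527514382454419745391246905216697081036632412900867216165141118972767)
(.br 4 6
(.br 3 5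
(.pk 97528103186731666079914728036673074228636375586021766171043295261133400819170200624424025578100375928056332922178992766724373518962829799346896072919065560296709340742727990147179018909432617799362192530252721683260193282421433748579144492191552582820191129311989902363879234899806993286318947816961871952908580415)
(.pk 304449235624747809658520808336099475799814617070716969842712264851287127885361560412472520750339214205864135555901758188222085880781822100473985635676400152551878572717442785595221607390656365113609093305065008219063404001004420173506337911422538897731156604886108592602379412933512610489938917684245988462184727826562309368829309028701928919575667375286617062595104090539768903337100564346358384590557788565585586479586317836426591710722665394719490873423407))
(.pk 96788891769665524836776955520951310209593805679535058837508812128972259260770085121070094501758004288049591861761143949454073344916346557907241409840630389048198044710163570228793680811057826386191992375038532263515673690399307122812614319415984654566306404282426231612172740818773847377698190845724454077031773503)))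
(.br 4 5
(.br 4 6
(.br 5 3
(.pk 98261549389593282376126994217380726731771938993585955112695000960735368025974691346169763053492148001092593987206969613163682741930656737665596686558454630423815020151129210919109681759413843144762527733757754934013453350128943110154517392011328518262978155028864406393345876207206622372392861201977921189953599071)
(.pk 21194936816622312945610538141901430435493615345873349407694268344769919966509926793593089442525004475948829956466312871816646979516221056938948807195507811337586358111653532963885442441797605859200019210229950587758808763131670102211394186101921137507569231314566550374933249575154556676080372965834932966018413730588373595184760190134312076561352834315041047256862699231920108618926764808536525719600868235802981158152471471867121684065151016618208792807989656752537570108188878752505450955811770840963852307039331149341098988682573667415666534678256186671280818312433979000000399458651926795305306223941096699223147620983671502633354057342973487))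
(.pk 7726743526339076040732296661359154370951601298161543041291064454580315919661329735986233082686593032926085297892442091884717590832735869516586657005909592627360581809161284995505652582486315608020636661145636338208873823603944720251637391949931429916921288656030224477788276194563579046753073400936135599653989017027071756179707429278840124255))
(.br 2 6
(.br 2 7
(.br 4 6
(.pk 75294978883941292081704195192212340694243541730901154178148647453150608995488200751819524518893452021962666629461374445699045153357777927124515805055080860327928533082512349276679611727869459396879907118113648767940266234278658760517062437981536532926675918321942756839185356102335236681962232487521227992578478188394704003639538929988983465617159413332402138878465930957658446721226931116211087757402991542957152830543340364040582616129807022411865602840103855485447778943033062456135096195643644408475409632780378139343683667447650287690373745336376649371674866899207311969480148268223969264081768712855470654716560133391596910415)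
(.br 4 8
(.br 4 9
(.pk 52932434090236888848572771150496546871154457836100799637226944607647247438065786083786870708437272228595316229935755753290772980425506668489765687502828660555878020536326547046321809450888274987311664350994311513743286007786919102259757346324471223664511202730914018840744082018664288947082282539924476036430872495855362603985993309939769971357261257152735591242210790245847858389592268261353270673348687788122348798839326999801173776387003847918250438430009908601204473011804626890458701904805623404502419874373088314598153959599254040633329014378041065075551)
(.pk 388478146873677088742639049105198125494009861402356774409378930158379520912699478476306106867643284355450293363353858512482213507140739931807091763389544616364880348128555669574793796322732083215407514718611981842473656769374675389613463052713641582975249874916368773808052268514597254947649049850719))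
(.pk 219870839201583025623879882527126094390555645832907957288545680789777369844005379064275934832085171766457871013687846414801466730862394501907117156655096140909808809813222426560316427053273291376199911664954151424832124318118751)))
(.br 4 6
(.pk 1230866667491329725628403077339551619301342755413475733686308626409363628086888395259107173053687395883668556251417817425916446236003340705215916789343977425728206133170336909508674479902162632246493629304945437111344619666199005773215968421043303901805715366849688739331130612067530575)
(.br 4 7
(.pk 1065621407790434330082788013764357582949858267274837337612375795198147411899054812010203065685962065173731246964387158391667822416614022571264541457232101245811111279485835442478820468678072664440909563152138054703381551595119333215973618878885948568510399444378939887429940116559110965887580343636272059417498476030833370274258766294829170260376715298910975324721129351184585323534544994991197306661995049395345023748453255823882085239381477928092197300769339591927475702705574015782456608990482667394322411139983582231325770121135825784926883145267688956861599802354427825970028232455185720549416761423)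
(.pk 4903677045764689669433241671707599422219945101795116633374373030390618451320466396550658642570339337649438727528169801165868974193580851450552354627044693390962430042443142736260182809346599760102278353871039239314831266084842813775624572655949973231930275133262324298591))))
(.pk 943238143110799491671800224256035772182954005828221760035023825809084039698748099665444373474409711192500772951130523535257051124993236201941825920049147339974344092159514197692407531477384331104479785669758713569393019938926496499707786233609261189617805023872881694007596588470986222732211101165560527010930214219734356075301959577091677372358951259205815743625704457152358527058849588271966329660676901927096335397819289229209093659313031785282350467938569026114023430807458677123172166670339754397767839231620592671908989005890235703815791482407795860853087650478579094274240069932072206132097381967)))))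
(.br 5 4
(.br 4 6
(.br 4 7
(.br 5 6
(.pk 62311492570961944607994166969610575636706145294702407294217449814902650584949045841804162879527675788951513096695909435015379015668587091549563195727842921621948692438965324155304322428286168617476365406200648896788155566673192708940117833567)
(.pk 27227634087449296622455370680121480103935015385001976441101165717824706542110060850385560282459768953747323253212029193584043011672755570950583908225367382387620321319623450679350611130020926884231580495579781935184315318820710083333071145365481751411803923603013379246892263913295823170403819377091029423964216679551646315129044454377011614922490333440697106742968931598122100024580051352748925583704757116257711783244807560859713005443420416075195674628763984834613931383222904823347295))
(.pk 15411526473962900817379877984599238141393247702016528941576000450549225369832855858666318473989516383435735864643813334809476744789799167144360246144031264539621967013642532843537947846600486433863461509826000504987959149122110911713610358076229791363706094627282818606432722636927500714816430609165418455907980283476867588916068156071737084229326791328932246655546577504683607895356503678918122221963102389758457439))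
(.pk 792890957268524702785188833868364011611989278622676527))
(.br 2 6
(.br 2 7
(.br 2 8
(.br 6 3
(.pk 595045029958693518669640751019681403522363241145150932460802247832470959699880492877964216895374698025736389916012295650086138614840622509970956135510748299119298718309073959220233543177224659189898399610291253093419673015253209214066292025347486580301999673915704177412715380384342007061125814360505014264998856234656909733274351743866671881209056089266444525121290724221664507810882040293625721833380085258984569641188696300084291855690761036553998918220175809912858218902885836215484078411567411041934410271949145470025920149311)
(.pk 106367021203498024099032696229594857207628898994873821521781433840703189950771878772958469468341208858809376511751465788714458136693038641371385137523718779895127196767851357311813374153137183613221787926451602882453598917923929335490849424720251662793269501175611006607755446177597675309531957234268765302356767855))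
(.br 6 3
(.pk 1196400204438145925586454899724118970640802223147412387468965676546137680877991792275657051273253603434706571185743900923260809022165690178959196759893930467390796108659015477124077776016173045836887885775361667021590523422892325257961859734907628910196001484438930329951084137502191351763623833621909060467014096832867839803934290071782876194299695545119727599415289274982844235218837918041272252538450562134594752656245943643491804595051820863)
(.pk 190597548816743309359155884258516750014113708752112671475502258120178482670150738601817261778003807989588224132570709924821730176887705188566764946273826197441688475296911372077324814049235593961016468672161152459875336305119099305480778491839067729989580872431077157690560182628461165279909818331987611536417017009334821157226837091027788520753412170622072834079757751378296074205983855)))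
(.pk 297941643094102268026098832880548000681305977851986187112081189250300589060749315331666674599366683596748084132632335024843742572580507655458105984649315100337023623169349342834005329114998592432098923220925842008892597512915905020791000863010217132843822169344410498662769771851394861868999356405341218933560047671412586587358631162232452854380308517756884020069449333032999991403439577830340262822095408684516526679659549426812864876353522649192310379744075074956287994130784592815548010496053418996387067359726988488131244206154637287029357398975496936573662906185516398489111822717849876793461047897583456698692463))
(.pk 792890957268524704275380557687224826815028449860974159)))))
(.br 4 2
(.br 4 3
(.pk 11905339126613945075454087774660723480934796039515098118202281873788351592079007796787818834132950881343932306093110894571182855774829614951923274411012762670428208723559964145691149297596057864530516789432050931788209959207147527007784648494649562046241704320351520082155789570346839572810626860222773174757285260414358251027459906645497173765496123508162708571862012657755388126731681351766901750713889210428509581120263398403212567080242819143891550662689171709662466128534887759625721821752871768635071096117526434078388296046809363425232829451686256953530949260302021967)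
(.br 2 5
(.br 2 6
(.br 4 5
(.pk 48501555198076144363590651518520102930593624696525059372993508236856110267433536095717347500254513351449358145243647655630430847888389446418190326347681220158714376618771713140407571033471733744345831536305591555956121437782465161384695741239134764361182155372489546645947427597915969826882659167886572623868412477606529507055546355304998092927262569577102905111188813473243447919001373890023983085135)
(.pk 23764769431746950744905500924114749679967221719572985085641985404878651069264765622468456197094554847296509412912289527912026163500718635608856535551356577996815542192963494113154732982892554239756277564676645421264551628389900643993297836759881069626046297084554983715203019474974645152524810374112407096931616501269050455652323882805470631319660222523774071558812140607493066402259987798915645913087896472497479946312953075474286219789018515780814169790726822473737969951654802582310928650858729343397366182113306136842244244242551836695596673688148526749827170190232170610859318907414929800521351271314863365976908819617581918989474465203943247))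
(.br 4 5
(.pk 8793439630437049607719862501484922278869629662714111283224564390473103036302743300053741906539328452318126996214936702618018851177535124724146845042382290584729029981304774394685814351)
(.pk 943238143110799491671800224256035772182954005828221760035023825809084039698748099665444373474409711192500772951130523535257051124993236201941825920049147339974344094153277907930344389159936158640215307150763662642796310483448207451483135790519120899854937837167676164814659341010561500016776796254467646900841750923635696256828946793108442566397910926016623160671425283576265389931731384885477892065162946582425411624010598132788855265404053390396714165794243236077618632473307627721798995004855182851245717266089002712294973987224360570481585119766130108598337763292327912647366619808536627392604862031)))
(.pk 96788891769665524836776955520951273905470071470448397684610839471899959968320006249066722056227969327106425021347167936216519965592258981260191953920325510870617365319745483781725465032439570642914054032811983485980066625090404458571463475302551870602234950919413933012121707289740890835487832929767158249005839695)))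
(.br 2 5
(.br 2 6
(.br 2 7
(.br 5 3
(.br 3 6
(.pk 1188233733191960353278530387368012599348991741994659469378118441072629780742142553724719497175660111305959863714058434992395458614800395240247987006274872756964348669593785266393353308952395731210846794984420273415336339959117173874547622077460445357510704724226315091683579117710608148743998742210709590472511033694718185279621711277806919769601203357390537256662165966676995667690251847473980383466253103994757911540096293444879975472891885375)
(.br 5 4
(.pk 62304897027078055000484059026540367931952221983441835845821397792075968639543655758146312597670648783044687224203637920935163110428963545242082827465791946435048345414446828758387115476129198391077920927954345279445648540931983222293261645407)
(.pk 529808362375425142775531566376884255588063918905467822584649401468218819335941222904498653295354414492778934913272478793489655305698241467941387614429887990808644666903588356525261488150391262575426552461396488650253623696539724416756685708006861811533022915049399451380999994755698710535778161298094922641583206541991472864625576959387873607979240522561544721677491444763507513673249194226639108998097403851001827493063337798239161302798831610227584280328073094917927698256067025632977121384311569404828785135619627555299393926751)))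
(.pk 14997569358927577062849315942515808102711415092509542981333479242888476076761527321317240955164990415419799104137071945086496733345157429538386656603209972139291786878110172730171113831290387305401889261157713552710436252677616269601843091158849538512489996040290482465873244652883876247052951655034498937250027089249268113908907362058268188433165195274174014444470295881308539167845613039033871217304911821364589663))
(.br 5 3
(.br 3 6
(.pk 15654368783579542445966810439070429897797095047675821881414045821699748578571071304377602493783925962845091916467610630152411354433536005036193630942848612471032332923269324834237130016682187866463106096969521475818205484181111705933858002313975262663341887)
(.br 5 4
(.pk 1221647555564798702330936507635797562031596250777100485235253746321346839671929376616019258280037081748496122868549721376652891719884609901051786959553287092848829852139159881276429624983483702091097398540158868274481270470416634972941522334222848227040719920170977340490593833182492255)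
(.pk 6738183104565484650971959081936538626886622519276104677134876168526726686556866239531737772942237880506127820090561943769654190358126214611012561339476068896203025809259247762234198951044054792365435447810675420535728015518715062988955245491468337104846798860259721197017884385299835952493698214957208120995548311457994590438082659410047138453405322045444908734405802878290191502157741964713567765423964547045905156529908749590842224821728263210012677651541275653586217446258318356662667124224902428255)))
(.br 5 4
(.pk 151409659627665281109147576041070716793182037459939323270275844900768954519624284994594006943384791370733170802881262532146828923985962603214114908527233724102927636768366284940140332831671606798025962166616894566407640005236324117265767213689451040049013626151037868080329654173194265983721628572756460112053476730308466026890172526480731151168270559674725646150467501522598624069723780790821540961351279700994966067766846847139600332480109982978465537643249132758495324405227464719299612951826494256649772278371455055572492962121907609676346959)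
(.pk 4870400746199861492915693924785197750602826311192547018420824291659480094228791474221512432771955420972380233187493326407500385057761534307351394107953461626507448610629838693960002919311332177441892009344217900526900060527824886609503174506595994701826261164260257559919))))
(.br 5 3
(.pk 7668405991066694449251018509098660758750524593573841124763070443393315670949140201012577601944121912768442595164454432342661238884250489899116946911142189428275755679011303690999459295652227734193720361768409219050390443603579655217821144706286120310487679077797741778649017998122608704157666743577565945104059508523015071717926533616416191583)
(.pk 37165475159531458556552792918811361664909213303348543889131113596498608617113287532692339873394290029078115010584803502296290872790861850857200871490483381952997000177451019970307360776628241519138805129138207154427376831188277366463041572207897477416836042624177990970710452552440330450142225734906455014765109228085462554028620506808899190268500558458566433988191066369170387125512945537654612937571902388958391988512820869728512396557570032475871293828655061104854592009023936344653207896867313518968227230815041636613179559584146960799765439606165608802915679681812558025063686782864540604566363314184242379014748962575474964726225407707974642229412209930871259992301672841100351949624122910819920445859213493990495)))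
(.pk 786881370649745641666256235573610737790052188645815631))))
(.pk 199377563055598141625939250797333281857562138690185904942638315140191))))
(.br 2 1
(.br 1 3
(.br 1 4
(.br 2 3
(.br 2 4
(.pk 194619685314508364323454958599921775804998115519454707357002298464344676882796246216827454426938300772162539128500521574664680569848869333690868769048715996824019693503944109029459748523563794531540396289396985021466638445441871)
(.br 2 5
(.br 3 4
(.pk 15419360056574560201598144396830573453579208034268453293520108265520149650631990355527659139674042276074944639271129818608658760833460090340686926046996240090200876484167840343146823030237297173749325858772823123522360691968676964004498567680399933031445823)
(.br 3 5
(.pk 8727048453758608388990001518157155363177500038193554629292523562508967813758818097446627804926581840069672800500301227127046145172334343324594465219153601818224717994491288396017038911)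
(.pk 943238143110903913550231224081029972214564562436095956404526780591687433346365639378381457677898466202370823661264110734760627995559134078260218656553301543040051442893263406358229853968471095294612819202472579376822957895776553457621698437690643000381150372907000741133423573848085866551537988382870340833335348468498622570532289138140221101224410512798571935026756270260831475447031633551837478412667312124909367882360129445715738464348060841558531003122624334041590988842288802832426368041483546897697473024712963667530266331518747902215545110980932768849325415375821988252037582902894321587339916863)))
(.pk 3813676513250515620248942557658682667611280114111391159478765110269383629875362875355503352770640469678056214592832778735640115765250561512253998470800051283465912820445512546714885979610866474240981947112902436842728689703844769285868116667978279226385677834342873543667603393707695319424272887993174548726315066423540048189567629937265815682938349353370286261522259291847273325629111801858212661254302802130332041209367686804543)))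
(.br 2 5
(.br 2 6
(.br 5 3
(.br 3 6
(.pk 173607452497557617080230030122903328138807121138055943510378814849595868809765538751157348185966227761961568276247348514517503095986834492870908295460032648406056105383175057613123817175431722955177671335209724299905523196094904118317609862513285123539673762486092461143809207021901659383528083058911956855239295189374037118851300160163941086995898919618618392828398392109419838369559615)
(.br 5 4
(.pk 612175762062161148268362744294167678036663082918468354944131399493859676642025444591518723439169554231899324366447688955913405781565121399453951298106723273459331819260008344835268297139406445363262840131436473163730378661935945653695213246170774402952718816655834204303069660779840413459236087339204130856773086748268799533718584117049071883919428564913725942304835303007)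
(.br 3 4
(.pk 1221647564428110162941695806399634419857871837682997828583926362417848217927164431007773058767937435956357980524919675315466295812673285341805831433169867732210709557829769229051404850534195527858844470527631939237680504343121208340089693232575937520502901377467607545423609632878032703)
(.pk 6738183104565484650971959081936538626886622519276104677134876168526726686556866239531737772942237880506127820090561943769654190358126214681263957522552223779833589323108374848709667873070329516489497588446968836621547908214289682720286139153715272649404685069135427548379056910817247000003790198502301331603143174351165161473135695540313209790533040610251182759979947973468224347482718717242103411794567581653623961982206210089098249019944270617727471072864812030280417711891812527546346599446580950623))))
(.pk 109349900461552249071105021255373971783886076483730237954774203673616250456063684156155109277512647071547932046373748650222749945817715766421311656768182450247757122596368934630774332488158535240401841669415964361866014295308143941673463870073956192046797472357304573903340339381736320892216322981647514550475682639))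
(.br 5 3
(.pk 533853866059266227011601322362909052084232190551557880545990151073647373072063924775994695751431400131254191996142881531845174506592495821665644396120875710864599185798002627279949722967310809268921872763300655496892864816577729000638651527917884348730468180560874005265690375591852991315409735853819327929565064043941170765236834928729584384725479832666565970916191662893386155013592238564796983173443569156518762254523841404552796479026972797480845579602851570531692435557663054665233768379809466112773859643042524090428989764703)
(.pk 21034913491088827164789709000195283555800434584720860951258454228644682446617341199274169006836268227384081925245797136290228281985821506323716179193289092125956889163019358730740448887234191940397640128454431697930414367258999038691838434486656741158267602255598846436115417891877240493337496221687893724608542728271385357261823056283337986472727293000385633692523827965925214398720527514101367404029918253195887593670544495137817941412157006912143982361219871103223199872692478041737295241182433742446313017753373366715737901056784266993424232048815313647399353441224749773861785865819893222551101629993377826898835753226574376690970760600351567)))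
(.pk 943238143110799491671801743794358664809216498649206269002893708341653338129780976488956146329078628165145177046871738539826275868599261342367508091510879842706435546217561139564650721790025976772578775098774359595784624565487482358461280982643173050134185592230570497934715151209838870055829204415965378227784880163572491846283525591191823614581231907311389546539127613599660964546418530694277230025441060969495110295728233077034387146514574315828609023652870757451682287550019169744460071822718553839272316505230909810750499902867651980636971760029591408280744880838039814156270282450308344533023454031)))
(.br 2 3
(.pk 5329585967706671869202861566867225937160818507229659277076660533850695468644693352118318778175374326343983306414089359414238745910624216228760436290708608448040981395506070390022614115580693140493099981046902850145614152268289654697017101079211348638689336790604109463239998718950156949653932079624325606867489307895010704922888785351826695906064914578815417238043882442865352146482396008115688055985826090800868959743307516308966662137190983606222014137922092318692076499957569614641378616358134478057614524279464458390628918321448256379398414399606579282641250223613483149158847498696705965881644530090578071360314285864650313069159156274420289848646343849007)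
(.br 2 4
(.br 2 5
(.br 4 3
(.pk 533853869932488964437587801213985418791262886778303083192101020314030947314031209143070001010876488013000664039796750651953662044253865564195228549993441258731200543998081344852102819356327001529992850937348440284358970098774626318121937530778890917601171787486574750762825076903008303412036560628980391320782139930815574462463712281164493379091896035426036714754984531462461998872607847693761403724713282786154289966651392960695103085372727697941959031427203322488781461011723958868741433490613921959133906565969025458965663970623)
(.pk 1911058797756139359725043535517859345078798953546556606801268701000958528834864490747701762155085704360071626596515669740810733402031255377704277154776352243945990539555899827717319349553351023421508863649609230934399343345821780930493100590255034252997388634579218060751090944711894664574332961927028284814384582176675237956548273747802593131716473737103928367409629291828524398245798797309875450212194906842395594875665472164363961590626235789487096378562071853301472981753808321290357054551744058289274734673982559))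
(.pk 1666557544542329698215706764281734341985187980711874599463104321522733788706393140541626389850774300950186029277082886733620284093319258557536643885214684310246523414551388386307677693028802777394087772461196459545037494905444071752795635927077581883764660503040148995468739522077634993900922342443812720414139805045786739871898832225547051004243414147319419246556239537980196753426047433363652266067359469833455481342983891159992224431289818959542944358949070778525176603669468509439098069424573877692381117397076051415800144002817463622649179187203668419669466273062110086265440539324673809984200822345494665252896742808474950247781867916728034036805075591054229177034339151))
(.pk 1942933080213245323258495452076260258952926937248670574617426318427076782632994011343538716379655604321575905625380201132331868869501731275180381875427057821231712382915210992502029382463204361039236223519472248382256655769733543555736197595723132974230638072996723996419762829469149269762571838224801443486141752750607075626923395420550878391858947614307391))))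
(.pk 24523263175050895121867162973981356094672680552401050636354135708810248825628621377333719984045236630125924687675986736756663415747599251826989877438566352320580567411983488798643920452170752313259598982214290163363405226311412838675181562814697108571460461180729970289583307244964149541443605810701062163443412594218937366082383))
(.br 1 3
(.br 1 4
(.br 1 5
(.br 3 2
(.br 2 4
(.br 2 5
(.pk 55197321498508233533008725119550695022795961810700549150695637350088038871943448525415517673864171049723902949848428403259859230655372009602422680453960055028418690942136094771609489947212250562964550579398932153640030836887888944204315095887)
(.br 2 6
(.br 4 3
(.pk 110150838289401984091887016685401776421446235845128035430895189538909614077833130774185430281960244274137786362755423048335738033786256878035358892017644863)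
(.br 3 5
(.pk 23938835459530887603216147649652635584047118988399561458661048584074795205024976418446706933896831703184110714505676670819147982320286241455082189956639398947497515958886675217471194377165929939398305037056930165324993451428781780091250730544532175027251138715961392041949003593260422341861022571892623024159419909504820706716490261472460089995130517042930653854901287699542372031321878537135822081539274282170389900688239774596874748749094423701369259324175774395837617877845000038250047)
(.pk 302150582568644824027445967861958153216498459915157483702919801610003021971853311064776805755200614101929098455587898517456947081380463189189896316483544599330752943173544733903848326919574760110457110339545849793403115964721648740767022894810044291497419317912414197636909870920023590235799145423583691591504365563632194454241080134151767377136441620509518980710455454620057914391864189755562972617211697752646366910481448237006726587668737364934046835275327)))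
(.pk 6738183153450936656137031628134751076726247170146554695148740051468354388101487137045266074748292804150040509947922749474888626627855346830754936051641119959631879644435764806101783176609971164192389066582749587128119931297829117471180404150693422764911729915685250253277178896483735900678527280947000172877268598823293556987833664954110874175284593615659666683089928020915226247122137646617370730026507629502404339220941755350476780033923964383216507680293018586169494879597390044303425085170559218511)))
(.br 3 4
(.br 3 5
(.pk 196106038785618386686147482652503629637792762240739995667721817376051821927772170937008961993146948718525150051002023723977225301807787277918726929830650451224960807520649464526475786444067853012446017048887208260241255026717791)
(.br 3 6
(.br 2 6
(.pk 96788891769665524836779450321337614886466602279187408735307334114360849466990567325288666389238661570672567656062526318765424813430493384747597443441919679603994428655835188975752846989434682069109332303588932587393521641782074181795569622392813931735273564125261809750184253866827926457694331819294643491722164015)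
(.pk 74731024892035344935532676936772766645770323733998126180890361855524689411211865604341284898096092600089831042021701574595758000068480956593181060639764163699089076204512818017236412246355741965964039419957307641248936083458087661956376352678892402215330950001597383561627858709774140508154886997421863867891873694378332249581507587732251172183674940442417558361722981170074434659231518606577482546051343418825312475481194105309871261143367190614040776804864156123956505594069706753326264895533952690396991668378442156271621003832240674883979020085350293084967104230064869923714745042856517292374076121739769161140677935308722206031))
(.pk 7668406046703451136504115421242641300531370539875354002533926022947043329636105068538316959500932217819457271507921008666852822602104444944550568136696969443540455420815004865756137736240680659255774617149037365522649839273907272546098431394874386923586475838067091271830034382206931140875285191539768020430406577069507479922386308957089363279)))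
(.br 2 6
(.br 2 7
(.br 3 6
(.pk 1073420730590092279825933675040056119152185427760554291133485806580332419212966664667636926644046167384849749000468622787438853299410983768318203715619678807903003926583726586504403750864209599508090573345150220564553221097591469193538214434931574454039520685952176109141529208927899149640479710989747883580812667803038365560331799277796533496197204180031381889885343301544339905894176612808329186550069082360556454711610211366674725880946227007)
(.pk 23604088803108184327845471466817703899784553315847740220999273755882738153072324723310253163731026747969479909332133910336396856115584868030976476746089240979236149292810910700507063679111948372279618070963133198914092981173964715785094979862696845711288744909472492156365042907277746875217614152188896126615726455908292250437674813629822773105785539058923065733580760357782328558959294454983892245642164596309448536455328187906737868364997690439439604867396842622170615027050353098365071733947774442980237436906742481034760846898543787670415393189486188913985915398811346278794215788300836207377999058205072517905170745841208881733210217729226815))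
(.br 3 6
(.pk 691406261808818159550036908980509405445795537585137278200814305562558878816706169093024692563062159853563668040357749028521681229010922780751138119796446378112747710462524324740616747947305517367732922399746094911)
(.pk 168628994004656811603018615117800983827953143388942944198883721286701850309257951312485216968488599409342571499195794762250022751019162834860554279311986084621841994976568141150401504596299596209719734193477564508060499535005635495799623827108890171268751065028689761078238229693842974734622201271319900803779148439377849681455286338012277905604812816311920876178721769219998320360613620056038594791778080390821244391629309414632566975255984667514543222574519381389986538487058911332950490346883066583799562096206765094176570909316684295063205695)))
(.pk 48502985304147204718178740498272534485607435926387133674207063422069174117873294920482294711195061638918441196132694553060938568316002975372486386823948691186915778231946432105975090828738815332742849521027336621564568761424000360640629734738555853561473357573902130254024001660179391823337076407426640496087587082377590741293747682861999518928073876410703581838223636549244385585033374490441861559871))))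
(.br 4 3
(.br 3 5
(.br 3 6
(.pk 42619287043233180488610184020233077696975589332727372091560625853604822766319635087584221884097971530732953087959358550261279868308456404690029249525306222785889494782033544587051608812655190455853912618979793196465396039340106550551505617403519768268097263625995793604252270392829075466022628359416045065856604097940153412466616025890318029584122033122095748227909680228260504985008475509331313751059196704669853805481666732555351484993698408442738386136584115098655804188479938921406080935263064192017947667625500367342606827618278713725046089865597748048991)
(.pk 196106038785618470459205723597615825288898572767214064435535504556222214491046795741601886585196999983567049492311715152898934496285369218087170810546814957100039042760861624043477216917775654817405671668637899393903069191533663))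
(.br 3 6
(.br 3 7
(.br 4 6
(.pk 3351247537880036108978472813161325085348291254962381501735895103066939891782296978092943061356846677649857673876822683512792657392472394132525666810683817256742077625842478764732028704735934300132017748959139391262227768695936754359809291402788212630679129088660307888479773692666186389669553837785269373177111470363822283389237606232968981653427369903607206638806808221899080306070468682395508592506478745997118018148855313681146293404893284683105357567699433699269154454972759553973570804539659291070811748909601755344811766434952687819985509374412842872134206568921318080473106443925327)
(.pk 299953221161521460108472811420991450178306133159432128846721922702342891771917057079709667426259996418504258051608625756056686083173153254010637725351403751114777064962842376886842794663685636892426065184284511860997439623873231471368075557677066452565227352120572452098214334294126746047318982202061964647397472311474580211263421767714699815630406060307027714129861032669473519880018737652471040222225827048584367986849150151804739491585569505548845448638324603661483511691255298218076829567403838755801263597987583717678123650903896817970001434910116872660668503795511412028544267720411190138976161609740098857138255))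
(.br 4 6
(.pk 1230975287373549997283554824867008763204628101834937583218308274353541617518334655805585112221337425553547294311590252966723754233613353996840235551705138427936077283188782515396210207176289751008439190964491651203463823200112918938799706530775532271840454404742045707158581023366117199)
(.pk 533853869932430094610911599519239195564480261104135405424376319545692575063001304842253511352219111250554475076602637580608445021580894834284998019321119325431844642157417731125691892318234169330609274985044350211548180022103982007468816104164001720019049908460585961144601390588700446406847744405117550750589085386297905083736804956457763183346288156127568257396403788363012914480612114642560435576896303166516299109891628590387257525888771987764227060635238750150960154895078477634402224781370551244586161588728125279775473596239)))
(.pk 786881370649745641666253705224170438544827892632843823)))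
(.br 2 6
(.br 2 7
(.br 2 8
(.pk 13083479272899993281804356652545983316033190308814073633503114739292539019949075162263753363998484892895443554738055613786751722082427007838995283767775818710363143380574985545647665877569529380327289716242274589539867325816214557114793846360989939142513779617215976022388830820847406596888078383265957421227193944124299165687360187503031048554539849307329620192339040779401482805791068208009682810148279114904513539335966303713255103172262755874282291985831245041180666563761684401668730494697662827777630289241948342233231298380815973316674807588531947232387379268561400687)
(.pk 4250467371627116805090661513010191078475605418139431908185936602110565781619878549189206377430017787938387992040664303999797650319233805749238449458439119921149318345033761985302225929913124447181343770707831497830452983418685780223849832209314207090394577673877107617782771616594762697974019528281741900981572008550530423780167024356577628369650215490212149709674172995238360237653733135624541527108267507985534999222452086895471))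
(.pk 196106038785942920984023423437772166968565056924820686525059709112034304585091521746116249833216710863927973600123646093232873131054047020223655445240831409550136669436782128901249876596519976535933600511165311453859670544282479))
(.pk 346489379014259241939829752154875471237696995957415184964349240031978458666630611781343480120623916647551471776790374947123826510645523318301530512022476957185338291864760978656547015373476408375390972847109377065392544784948044591494590680663558459448723577661222043474575789998575096823108112479807))))
(.br 3 2
(.br 2 4
(.br 2 5
(.pk 6738183153450936656137031628134751076726247170146554695150830664244094084261882415670133545259705965566204851414868618609828306039978414695583959302021165512887813022397418785535560589921838235936601123667411284595390324011999712908399176507041321966003253460322529235370818767256388660684717893455112285348273428915007582397852439228232745054522160424551008160559523687543562371468370178444289658748500622244279462663645737876181863489216916386186764765147955034174692039536766259796080608098053780303)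
(.pk 194619685314508364323454958599921775804998115519454707357002298464344676882796246216827454426938300772162539128500521574664680569848869333690868769048715996824019693503944109029459748523563794531540396289396985021466638445441871))
(.br 3 4
(.br 3 5
(.pk 11905339126615263064854791086178735541877416009053780599134440790188886995089468349562298272580702802260917428255669144923369000962189270059032084377678050261844225442728944323439232235892125008828324178237535225554577686183999543601593305670607714725008139608682505815322453392531243210838811235832392223442108770781971899174403487972508471636695429844414191520093528679920407683408678154790547923986673928944411835827043282060592673801090460546717962499215178162785474789600144706734471527417018061080222456227986390671510118892374829045540529723811957261014863004764927279)
(.pk 2456445778096504414884677783438815447189568073490209241527125023001584915141233813212379408949281081629013427564265500063846869776559467576906740911051133883213800284384052438342248513446276982043951))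
(.br 2 5
(.br 2 6
(.br 3 5
(.pk 48135364554185025036705628014562650721944885780586692821482042915308455778660480367889585419219871227125645961150412912602462166512090103496630893546196146134272488935004581579364590035669827163199335217296413132109025415926216252979992328028867047673127635811642229655073840810845817318472047183233815981377936446400740612869825538272070396383853843338185597352514314679579493364207247253656363791935)
(.pk 23604743521297705740504160596418753557526388844916396573849733783653652933674834459176445715973346441824949545876006187269906910518029798539523435088474785122299827230150139914989430610466640371119776826549377554084161727532759955974203806257563214000707569520079772333213180892223773837085239193966277412696496452519921997707047086828116580903122097191910467632890074648087524431210503120859156910615473651056049567125691475424927410766647326267598955126137642986055238918427755973125264790595078730161191145933396073733907022525650344528388323568157670995019611026898575990741329782088034267013397224127768182532561493630522465641108282796144447))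
(.br 3 5
(.pk 8727048453758608388990001518157155363177500038193554629292523562508967813758818097446627804926581840069672800500301227127046145172334343324594465219153601818224717994491288396017038911)
(.pk 943238143110903913550231224081029972214564562436095956404526780591687433346365639378381457677898466202370823661264110734760627995559134078260218656553301543040051442893263406358229853968471095294612819202472579376822957895776553457621698437690643000381150372907000741133423573848085866551537988382870340833335348468498622570532289138140221101224410512798571935026756270260831475447031633551837478412667312124909367882360129445715738464348060841558531003122624334041590988842288802832426368041483546897697473024712963667530266331518747902215545110980932768849325415375821988252037582902894321587339916863)))
(.pk 96788891769665524836777111445975458574463091040929047273549523709414864740865000834740045880962885293917964379472303868715420387956163612028547065998984965996436991817415284869068053591538038373879827304793528656487329568123600742538564908284580688058780214895506657589240773380034527928959724519731825445559334207))))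
(.br 4 3
(.br 3 5
(.br 3 6
(.br 4 5
(.pk 48502985304152554299087776755527661221798740557428271051029185832516503864559232427124988008094403403947589157887333063449334263301378775789435194600211261194424431691881490399261201399483298739756039559706948284428064452397524549020774560953781920104930129846293693728874901973620686162264588417672237690256979062830117937948011259188497685242984097643016587611747579318226230017061254707996383442511)
(.pk 23764769431746986455494071122063462956921736409460990260151239294961320717276619583715923764332832121429542179028140676664245525869160473342396834641287264305412381715777265369680759651138232727088437763969566603436450398381653988565716609484151429928894634990658750371389920511810768497591711391094294705816903533396293905200170336196869005030110423154077050167918474338161877152271935025710019572891847230930464603563088780700042418075962646560774025746299155883559576595879595255761934510845779105956752362671255573076158091913375322096456386205877277630890407451670351629096267655065804100107853846976320414768787737435448409172574410677483343))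
(.br 4 5
(.pk 8793698911843525665706056138811636690881805163882908482039391101680067618485015442848553923412387140511860920356507109075913954249354365519278428212908962858305270278767370686750389839)
(.pk 943238143110799491671798710653409453442388609193651064376574824648907073293844196839995120014808507234749719434363921561340568208821903821366550634284331717061222432565947568961832995916282461912646098734577309311294009004516156184557018904278019550101749344047333781994600313702314558110408279252057518341144929551714994019245969249636578703322657682075070268399133465258372648622221653360746319802101344538539432368352709448674093537890869383089736953261655368136994831623406023743338561190629192482022265337744611269017813245186703027031229822362793933490889530221381034689561529091637437176590169679)))
(.pk 786881370649745641666254967923010472739220138024432943))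
(.br 2 5
(.br 2 6
(.br 2 7
(.br 5 3
(.br 3 6
(.pk 1188233733191960353278530387368012599348991741994659469378118441072629780742142553724719497175660111305959863714058434992395458614800395240247987006274872756964348669593785266393353308952395731210846794984420273415336339959117173874547622077460445357510704724226315091683579117710608148743998742210709590472511033694845266679061948668469435968417423262087149772915219388724589400677070005154573036783583608632348495023588825201499633949743707967)
(.pk 36883837769432655394107178576250067092722762049323818624702892869249672043864237287913974263840254815476700810358989218352132674794627244134486180809290229697595559051637263357081007531398733185053192698006085076409628248124978117599327595493813490453014456641873968746802837271533540395758765076103585807758409822306110758444740446384661584593480566211043284434318811941984574548433135736173118504150072497537954819867764827526009194723052470252199797192092478039623018598356983351278174322463372044460982030261861390311552811267938817824004372620439451433960010672709927722574781676338453758707667958456323456429269064586603044542063273132764325647493665636757316501174841796107320092580170757566917970916061282169951))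
(.pk 871015898756698097927411272518199922969699893804135791))
(.br 5 3
(.br 3 6
(.pk 15654368783579549113981243415957084746443194215744837056303498668827620653859383864971460739266809006210096081573883761904005116072946307686832815078610254016595182180593745227426591538464729913955254035152861673187233103817931157881534012023545526312433471)
(.br 5 4
(.pk 196106038785596841148952037576872763939514658806005884994151431529227929832078857022653818258316211966011695505815550936328677087919405944264012034251369806950341212981832756168032000313919688924312265323560035254299705613940319)
(.pk 6738183104565484650971959081936538626886622519276104677134876168526726686556866239531737772942237880506127820090561943769654190358126214681263957522552223779833589323108374848709667873070329516489497588446968836621547908214289682720286139153715272649404685069135427548379056910817247000003790198502301331603143174351165161473135695540313209790533040610251182759979947973468224347482718717242103411794567581653623961982206210089098249019944270617727471072864812030280417711891812527546346599446580950623)))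
(.pk 19826422536646576816313180692593929062984782818342649496163644388130748078787551415570823258699119)))
(.br 5 3
(.pk 96788891067441644020966413529273300830735921344620524739014148235709707268168900430255317443506139480016018476644059379584967638568789299450960922537864113951034659633966295734266206645482045416796675468762429343338963638444830212902157068317515312347394141032964826275323146604073739742470294518243012501322462303)
(.pk 85047828191781058226074928836882698273955568623193243247971674945381107765738536234125978139874241542061415232952380440613495024715465555253255585109408541961050657025936867824057242872368080722569183109935182963573208578489163644245251728456623880860009316446904204502656516174536364244831872353681430979927893066414100165683448674804419345769058915991601314009792200824887966717645207669260847167831469339626415202172624797082425179041703440414001437064019179573985146431)))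
(.pk 3813676513250515620248942557658682667611280155072653167318700843351366010690111473253906289182201287459457348787457684974546497362938311977274811443194008921021151483295546868562583966080210377338216518420219550920566687385214209572725608490594893058068548320291906993842031748651688423785547458729660108901381950898909649401729841785678855991444467736177561528136302319506203925490310987708201739968260851229168492899068727784767)))))
(.br 3 2
(.br 2 4
(.br 2 5
(.pk 5966020254402350195075601611179850108057275785288658293067576397823052997745980858952780890715819285378684364298287025011673418475737848599004334110785481159942157033159090231171082278988038339551679799015706655907059087449928975129869774724833294651701475199629193266434634787706081012127839498555856552241115348779414985175883192563444502021566140790480703298564939237609718342417564878526889923623954745562215501866852671981459626620619688824392964282986451252359777051202742043977316149914540175596958449611619586372818947991699445070818609883570561831364008710390460893574332405093341133344620850946549095670741025620569069434349157540032838851468450853951)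
(.pk 3813676513250515620248936413899913659728045024395570866582915894728071289582075181014843041511577339221431117472142884899717641331315967060813680445495257622355609155224353978007517282491757133024532544956781622617746582737174685206914210333511987881864836822425515523575964758271626347154232466604183039738579020545468501632448399580628331852585696185531909168113284910436099268358187717734712646757655372203257857703886395274303))
(.pk 175191888428366492059977470980553567495396702787113839737233544845863731640573591059579378662578941023104742430520475039037954131156380223570724876984655759572495246835613775507462290081908492621013638716267232566894407359657023))
(.br 2 4
(.br 2 5
(.br 2 6
(.br 4 3
(.br 3 5
(.pk 7726971355381311743602618304108371924377913092863420987267825180130263139754235663308848518199924805180300960674431111519870224229249932625135687164253503939355675611026369227100208342316611173171401657543040450947459393135951722306247347571874594997425053221195098731474296198116798753490542910762049605049085945331854388518810532608263714367)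
(.pk 533853869932548065126343163602179745784140423730923904700717037879118564781957518361515930313449948335722033680564906021062768818279629097494457721460243410572591723222253308235440061534946574931334736222144070495705368199769910368434253445927217184821366409462407727396853865064332883333742365230279638391522369088609563105609138943594364973758651058203002196735725417888657068106850537083553386361877890404362983517932841505715415395121200837260400094196052496870903905388691957482277781804213584531025213654168467449553789187407))
(.pk 957640452550646123559282453296398237160060730956364833288501209071009738627865324846333839561621901969126695554173857889870935394603883308481232008618258713258016948340650330786981246563787279880893063259096757275267445353933833112006348635307946377726382120662167528011718936169241079169436567030740916814475735450408251178488925871386711151133582423592725472734757012188836622410505423149811363416534526192593883883644038023259453565485394778917966155451667928627747343918920924049201855012326992159422423129335625119530887438011381108115965765057977846976828547095852450307946873082400166173921834079))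
(.br 4 3
(.pk 533853869932488964437587801213985418791262886778303083192101020314030947314031209143070001010876488013000664039796750651953662044253865564195228549993441258731200543998081344852102819356327001529992850937348440284358970098774626318121937530778890917601171787486574750762825076903008303412036560628980391320782139930815574462463712281164493379091897093309371101544068270963630841855547382369717585907029296652782643070145340058265388265389688413252328224433014206632011045666949985778495092465907929948152254561127810393228383089983)
(.pk 1911114927497428556412402194509419784591033133705435558586159224746143092056476384153040926463085356556402530946075573968754704563338372948596610055123613149519599470907230390050507270704317682236067833387653593559230006992002814020214966167660195360863422191603221703915442637199583254526077448400064840641943958796307062362124582897473650237854942734189584903910535172951107643375137056384407023951323555249371851441405861367148086182765755230562740253474049013905169832420187305719899889990815007594593223595848799)))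
(.pk 1666557544542329698215706764281734341985187980711874599463104321522733788706393140541626389850774300950186029277082886733620284093319258557536643885214684310246523414565091936427110478028475382755523200252744349896344083013482095479495641203418745296646571635767735990318434238851128144284506645939313426550101803888781264678766837921485120630200726395038856394742210740217165706224789176779933936444697703515366581448832773973381668853089742711640100546567838609715564191407901036739978337078174871602807420734233543031165500669292347065824259592052075287729461177517287570703078659536881520952118825157858209111264641240398925759708300138159779530661383957985211920806048591))
(.pk 1943057093649325951821339653375825283213403271270998726238164909455094383277711822773132369671776186831478139780935241356531400371666907315073148412613431444796153479547447948978195310348985215591307832917261726577119255434083610435456736506731864945148778713189020865220789367843307569578128475887267553289872691525129817271524485189033550543549098781570111))))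
(.pk 24524828444674021512974240349481013708067406025012549580638018633503380356368428522621398165729552784593516640247825101287055217253306482367896816124700516441856349736468454089591658484184562749051801346207438543258036755674047365361087615503955017163882160732097113590182689578366144234799652347851992919937598047084939096355663))))
(.br 3 2
(.br 2 4
(.br 2 5
(.br 2 6
(.br 4 3
(.pk 3351055053396121833741803672769763797954645646086489523817895025768576957158589964172308901988069165967186536636898508186795987841726120766234789046540003932174097626743571785860665246494693381583536481554832228646517562561416112808958194837120862362889924852275247457297596211649193727035726347959251707672988291799188929918373851993966082319596168255970979154739230332145713888158460086784425432333777620116416635632733610948164808578037170330627328937995123968296550865896891378464666803549994313942355746229923455722807243656250028219453703858309595691890092100406701994417476761548095)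
(.pk 1240301050420602544164952406127233630334780267903338236716349445328723792202265143729379155948647763477731188417267480387143522882248966006925286569655951714623045750895533532055721286311243889962679303416753329851225762262739822799335698691359576561415066727036153767822276817552930623))
(.pk 5966020939034791753511581916171041820229793877566222682307074672357616974019638147439266637728737792800318372245497946982913568715933955895951549655840298853514925794773949987072588626961983621737652940994343924668158844297050557341823614222482310351395346889280513706533794929186454326724437287577363986450856823036833679206236076441414538613672624483472995567901867276747589776225667945653458110519080392693960240305310284224345815674208958225461554616610921425835080852288308800879815824968058570679612968709097393736251629254912303776110440462781000344431655770451489528120114244425212810648462668914915072681908069310485458423446281502442507407638312252239))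
(.pk 943238143110799491671800224256035772182954011131387134843373857262123183167912100128634090342538375445776762960711729578531686545943253634083648834799241286964879152568146404492442956358139526150674949228485268865943749470212952268166136660367501417288233038381128755403500696006411356313014392033218943072836358229036303914639987347641951767221439103562935552197971583914113311754784965074708427120086363542574088541030882435768914689679573105254289992754027386002804200984060339281395387347966762287796546532730587365032659164478555557815836218976689275975533235563329779791050523676928121255799026511))
(.pk 199383759308263176898937765901168962751174433989944414292649483498591))
(.pk 31763665416)))
(.pk 31763669256)) 0 0 (by decide +kernel) A hA cons_zero

/-- `σ` enumerates `F` by the numbers below `k`. -/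
structure Lab {V : Type} (F : Set V) (k : ℕ) (σ : ℕ → V) : Prop where
  inj : ∀ i < k, ∀ j < k, σ i = σ j → i = j
  mem : ∀ i < k, σ i ∈ F
  surj : ∀ f ∈ F, ∃ i < k, σ i = f

/-- The subgraph induced by `F` is the complement of the graph with table `h`. -/
def Shape {V : Type} (G : SimpleGraph V) (F : Set V) (k : ℕ) (h : List ℕ) : Prop :=
  ∃ σ, Lab F k σ ∧
    ∀ i < k, ∀ j < k, G.Adj (σ i) (σ j) ↔ ¬ (i = j ∨ (h.getD i 0).testBit j = true)

/-- There are six branch sets inside `F` avoiding one vertex of `F`. -/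
def Six {V : Type} (G : SimpleGraph V) (F : Set V) : Prop :=
  ∃ x ∈ F, ∃ l : List (Set V), l.length = 6 ∧ Bags G l ∧ ∀ A ∈ l, A ⊆ F \ {x}

section
variable {V : Type} {G : SimpleGraph V} {F : Set V} {k : ℕ} {σ : ℕ → V}

lemma exists_lab [Finite V] (hk : F.ncard = k) (h0 : 0 < k) : ∃ σ, Lab F k σ := by
  have hF : F.Nonempty := by
    rw [← Set.ncard_pos]
    omega
  obtain ⟨v, hv⟩ := hF
  let e : F ≃ Fin k := Finite.equivFinOfCardEq hk
  refine ⟨fun i => if h : i < k then (e.symm ⟨i, h⟩ : V) else v, ?_, ?_, ?_⟩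
  · intro i hi j hj hij
    simpa [hi, hj, Subtype.val_inj] using hij
  · intro i hi
    simp [hi]
  · intro f hf
    exact ⟨e ⟨f, hf⟩, (e ⟨f, hf⟩).2, by simp⟩

lemma good_of_lab [Finite V] (hσ : Lab F k σ) (hk : F.ncard = k)
    (hd : ∀ f ∈ F, 6 ≤ (F ∩ G.neighborSet f).ncard) :
    Good k (k - 6) fun i j => i < k ∧ j < k ∧ G.Adj (σ i) (σ j) where
  symm x y h := ⟨h.2.1, h.1, h.2.2.symm⟩
  irrefl x h := G.loopless.irrefl _ h.2.2
  bound i hi s hs := by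
    have h1 := Set.ncard_sdiff_add_ncard_of_subset
      (Set.inter_subset_left : F ∩ G.neighborSet (σ i) ⊆ F)
    have h2 := hd _ (hσ.mem i hi)
    have h3 : (s : Set ℕ).ncard ≤ (F \ (F ∩ G.neighborSet (σ i))).ncard := by
      refine Set.ncard_le_ncard_of_injOn σ ?_ ?_ (Set.toFinite _)
      · intro j hj
        obtain ⟨h3, h4⟩ := hs j hj
        exact ⟨hσ.mem j h3, fun h => h4 ⟨hi, h3, h.2⟩⟩
      · intro a ha b hb hab
        exact hσ.inj _ (hs a ha).1 _ (hs b hb).1 hab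
    rw [Set.ncard_coe_finset] at h3
    omega

lemma six_of_hasModel (hσ : Lab F k σ)
    (h : HasModel k fun i j => i < k ∧ j < k ∧ G.Adj (σ i) (σ j)) : Six G F := by
  obtain ⟨x, hx, l, hl, h1, h2⟩ := h
  refine ⟨σ x, hσ.mem x hx, l.map fun p => {σ p.1, σ p.2}, by simpa using hl, ⟨?_, ?_⟩, ?_⟩
  · intro A hA
    obtain ⟨p, hp, rfl⟩ := List.mem_map.1 hA
    obtain ⟨-, -, -, -, h | h⟩ := h1 p hp
    · simpa [h] using conn_singleton (σ p.2)
    · exact conn_pair h.2.2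
  · rw [List.pairwise_map]
    refine h2.imp_of_mem ?_
    intro p q hp hq hpq
    obtain ⟨hp1, hp2, -⟩ := h1 p hp
    obtain ⟨hq1, hq2, -⟩ := h1 q hq
    obtain ⟨⟨a, b, c, d⟩, h⟩ := hpq
    constructor
    · rw [Set.disjoint_left]
      rintro v (rfl | rfl) (hv | hv)
      · exact a (hσ.inj _ hp1 _ hq1 hv)
      · exact b (hσ.inj _ hp1 _ hq2 hv)
      · exact c (hσ.inj _ hp2 _ hq1 hv)
      · exact d (hσ.inj _ hp2 _ hq2 hv)
    · rcases h with h | h | h | h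
      · exact ⟨_, Or.inl rfl, _, Or.inl rfl, h.2.2⟩
      · exact ⟨_, Or.inl rfl, _, Or.inr rfl, h.2.2⟩
      · exact ⟨_, Or.inr rfl, _, Or.inl rfl, h.2.2⟩
      · exact ⟨_, Or.inr rfl, _, Or.inr rfl, h.2.2⟩
  · intro A hA
    obtain ⟨p, hp, rfl⟩ := List.mem_map.1 hA
    obtain ⟨hp1, hp2, hpx, hpx', -⟩ := h1 p hp
    rintro v (rfl | rfl)
    · exact ⟨hσ.mem _ hp1, fun hv => hpx (hσ.inj _ hp1 _ hx hv)⟩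
    · exact ⟨hσ.mem _ hp2, fun hv => hpx' (hσ.inj _ hp2 _ hx hv)⟩

lemma shape_of_isExc {h : List ℕ} (hσ : Lab F k σ)
    (he : IsExc k h fun i j => i < k ∧ j < k ∧ G.Adj (σ i) (σ j)) : h ≠ [] ∧ Shape G F k h := by
  obtain ⟨h0, π, hπ, he⟩ := he
  refine ⟨h0, fun i => σ (π i), ⟨?_, ?_, ?_⟩, ?_⟩
  · intro i hi j hj hij
    exact π.injective (hσ.inj _ ((hπ i).2 hi) _ ((hπ j).2 hj) hij)
  · intro i hi
    exact hσ.mem _ ((hπ i).2 hi)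
  · intro f hf
    obtain ⟨i, hi, rfl⟩ := hσ.surj f hf
    refine ⟨π.symm i, ?_, by simp⟩
    rwa [← hπ, Equiv.apply_symm_apply]
  · intro i hi j hj
    rw [← he i hi j hj]
    simp [hπ, hi, hj]

theorem six_or_shape [Finite V] (h7 : 7 ≤ F.ncard) (h11 : F.ncard ≤ 11)
    (hd : ∀ f ∈ F, 6 ≤ (F ∩ G.neighborSet f).ncard) :
    Six G F ∨ Shape G F 8 [2, 1, 8, 4, 32, 16, 128, 64] ∨
      Shape G F 9 [6, 5, 3, 48, 40, 24, 384, 320, 192] ∨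
      Shape G F 10 [14, 49, 193, 769, 322, 642, 532, 292, 152, 104] := by
  obtain ⟨k, hk⟩ : ∃ k, F.ncard = k := ⟨_, rfl⟩
  rw [hk] at h7 h11
  obtain ⟨σ, hσ⟩ := exists_lab hk (by omega)
  have hg := good_of_lab hσ hk hd
  have key : ∀ h, Concl k h (fun i j => i < k ∧ j < k ∧ G.Adj (σ i) (σ j)) →
      Six G F ∨ (h ≠ [] ∧ Shape G F k h) := fun h hc =>
    hc.imp (six_of_hasModel hσ) (shape_of_isExc hσ)
  interval_cases k
  · have := key _ (concl_7 hg)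
    tauto
  · have := key _ (concl_8 hg)
    tauto
  · have := key _ (concl_9 hg)
    tauto
  · have := key _ (concl_10 hg)
    tauto
  · have := key _ (concl_11 hg)
    tauto

end

/-- The subgraph induced by `F` is one of the three exceptional graphs. -/
def Exc {V : Type} (G : SimpleGraph V) (F : Set V) : Prop :=
  Shape G F 8 [2, 1, 8, 4, 32, 16, 128, 64] ∨
    Shape G F 9 [6, 5, 3, 48, 40, 24, 384, 320, 192] ∨
      Shape G F 10 [14, 49, 193, 769, 322, 642, 532, 292, 152, 104]

section
variable {V : Type} {G : SimpleGraph V} [Finite V] {s u : V}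

lemma Inst.seven_le (hI : Inst G s) (hu : u ∉ cn G s) : 7 ≤ (G.neighborSet u).ncard := by
  obtain ⟨v, hv⟩ := hI.nbr u hu
  have h1 := hI.tri u v hu hv
  have h2 : insert v (G.commonNeighbors u v) ⊆ G.neighborSet u :=
    Set.insert_subset hv Set.inter_subset_left
  have h3 := Set.ncard_le_ncard h2
  rw [Set.ncard_insert_of_notMem (G.notMem_commonNeighbors_right u v)] at h3
  omega

lemma exc_of_attached (hI : Inst G s) (hu : u ∉ cn G s) (hlow : (G.neighborSet u).ncard ≤ 11)
    {C : Set V} (hC : Conn G C) (hCu : Disjoint C (cn G u))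
    (hN : ∀ f, G.Adj u f → (∃ g, G.Adj u g ∧ g ≠ f ∧ ¬ G.Adj f g) → ∃ c ∈ C, G.Adj f c) :
    Exc G (G.neighborSet u) := by
  refine (six_or_shape (hI.seven_le hu) hlow fun f hf => hI.tri u f hu hf).resolve_left ?_
  rintro ⟨x, hx, l, hl, hb, hlF⟩
  have hCF : ∀ c ∈ C, ¬ G.Adj u c ∧ c ≠ u := fun c hc =>
    ⟨fun h => Set.disjoint_left.1 hCu hc (Or.inr h),
      fun h => Set.disjoint_left.1 hCu hc (Or.inl h)⟩
  obtain ⟨X, hX, hXC, hxX, hXA⟩ : ∃ X, Conn G X ∧ X ⊆ insert x C ∧ x ∈ X ∧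
      ∀ f, G.Adj u f → f ≠ x → ∃ y ∈ X, G.Adj y f := by
    by_cases h : ∃ c ∈ C, G.Adj x c
    · refine ⟨insert x C, hC.insert h, le_rfl, Or.inl rfl, fun f hf hfx => ?_⟩
      by_cases hxf : G.Adj x f
      · exact ⟨x, Or.inl rfl, hxf⟩
      · obtain ⟨c, hc, hfc⟩ := hN f hf ⟨x, hx, hfx.symm, fun h => hxf h.symm⟩
        exact ⟨c, Or.inr hc, hfc.symm⟩
    · refine ⟨{x}, conn_singleton x, by simp, rfl, fun f hf hfx => ⟨x, rfl, ?_⟩⟩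
      by_contra hxf
      exact h (hN x hx ⟨f, hf, hfx, hxf⟩)
  have huX : u ∉ X := by
    intro h
    rcases hXC h with h | h
    · exact G.loopless.irrefl u (h ▸ hx : G.Adj u u)
    · exact (hCF u h).2 rfl
  refine hI.free (((hb.cons hX ?_).cons (conn_singleton u) ?_).minorOf (n := 8) (by simp [hl]))
  · intro A hA
    constructor
    · rw [Set.disjoint_left]
      intro v hv hvA
      obtain ⟨h1, h2⟩ := hlF A hA hvA
      rcases hXC hv with h | h
      · exact h2 h
      · exact (hCF v h).1 h1
    · obtain ⟨f, hf⟩ := (hb.1 A hA).1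
      obtain ⟨h1, h2⟩ := hlF A hA hf
      obtain ⟨y, hy, hyf⟩ := hXA f h1 h2
      exact ⟨y, hy, f, hf, hyf⟩
  · intro B hB
    rcases List.mem_cons.1 hB with rfl | hB
    · exact ⟨Set.disjoint_singleton_left.2 huX, u, rfl, x, hxX, hx⟩
    · obtain ⟨f, hf⟩ := (hb.1 B hB).1
      exact ⟨Set.disjoint_singleton_left.2 fun h => G.loopless.irrefl u (hlF B hB h).1,
        u, rfl, f, hf, (hlF B hB hf).1⟩

end

/-- The vertices of `S` are pairwise adjacent. -/
def Clq {V : Type} (G : SimpleGraph V) (S : Set V) : Prop :=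
  ∀ x ∈ S, ∀ y ∈ S, x ≠ y → G.Adj x y

/-- The vertices of `F` with a neighbour in `A`. -/
def att {V : Type} (G : SimpleGraph V) (F A : Set V) : Set V := {f | f ∈ F ∧ ∃ a ∈ A, G.Adj a f}

/-- The properties of the exceptional neighbourhoods that are used below. -/
structure Hub {V : Type} (G : SimpleGraph V) (F : Set V) (c : ℕ) : Prop where
  bound : 2 * c + 4 < 2 * F.ncard
  eight : 8 ≤ F.ncard
  four : 4 ≤ c
  six : c ≤ 6
  deg : ∀ f ∈ F, 6 ≤ (F ∩ G.neighborSet f).ncard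
  clique : ∀ K ⊆ F, Clq G K → K.ncard ≤ 4
  codeg : ∀ f ∈ F, ∀ g ∈ F, G.Adj f g → (F ∩ G.commonNeighbors f g).ncard ≤ 4
  cover : ∀ K : Fin 4 → Set V, (∀ i, K i ⊆ F) → (∀ i, Clq G (K i)) →
    ∃ f ∈ F, ∃ g ∈ F, G.Adj f g ∧ ∀ i, ¬ (f ∈ K i ∧ g ∈ K i)
  rich : ∀ A B, Conn G A → Conn G B → Disjoint A B → Disjoint A F → Disjoint B F →
    ¬ Clq G (att G F A) → c < (att G F B).ncard →
    ∃ l, l.length = 7 ∧ Bags G l ∧ ∀ S ∈ l, (S ∩ F).Nonempty ∧ S ⊆ F ∪ (A ∪ B)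
  one : ∀ u v, u ≠ v → ¬ G.Adj u v → (∀ f ∈ F, G.Adj u f) → (∀ f ∈ F, G.Adj v f) →
    Nonempty (K22222 ↪g G) ∨
      ∀ f ∈ F, ∀ g ∈ F, G.Adj f g → (F ∩ G.commonNeighbors f g).ncard ≤ 3

section
variable {V : Type} {G : SimpleGraph V}

lemma att_mono {F A B : Set V} (h : A ⊆ B) : att G F A ⊆ att G F B :=
  fun _ hf => ⟨hf.1, hf.2.imp fun _ ha => ⟨h ha.1, ha.2⟩⟩

/-- Deleting one component of `A - a` from `A` leaves a connected set. -/
lemma Conn.sdiff {A D : Set V} (hA : Conn G A) {a : V} (ha : a ∈ A)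
    (hD : IsComp G (A \ {a})ᶜ D) : Conn G (A \ D) := by
  have hDA : ∀ d ∈ D, d ∈ A ∧ d ≠ a := fun d hd => by
    simpa using Set.disjoint_compl_right_iff_subset.1 hD.2.1 hd
  have haD : a ∉ D := fun h => (hDA a h).2 rfl
  have key : ∀ T : Set V, a ∉ T → (∃ b ∈ A \ D, b ∈ T) →
      ∃ p ∈ A \ D, ∃ q ∈ A \ D, p ∈ T ∧ q ∉ T ∧ G.Adj p q := by
    rintro T haT ⟨b, hb, hbT⟩
    obtain ⟨p, hp, q, hq, hpT, hqT, hpq⟩ := hA.2 (T \ D) ⟨b, hb.1, hbT, hb.2⟩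
      ⟨a, ha, fun h => haT h.1⟩
    by_cases hqD : q ∈ D
    · have := hD.2.2 ⟨hpT.2, q, hqD, hpq.symm⟩
      simp only [Set.mem_compl_iff, Set.mem_sdiff, Set.mem_singleton_iff, not_and, not_not] at this
      exact absurd (this hp ▸ hpT.1) haT
    · exact ⟨p, ⟨hp, hpT.2⟩, q, ⟨hq, hqD⟩, hpT.1, fun h => hqT ⟨h, hqD⟩, hpq⟩
  refine ⟨⟨a, ha, haD⟩, fun T h1 h2 => ?_⟩
  by_cases haT : a ∈ T
  · obtain ⟨p, hp, q, hq, hpT, hqT, hpq⟩ := key Tᶜ (fun h => h haT) h2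
    exact ⟨q, hq, p, hp, not_not.1 hqT, hpT, hpq.symm⟩
  · exact key T haT h1

lemma IsComp.touch_root {A D : Set V} (hA : Conn G A) {a : V} (ha : a ∈ A)
    (hD : IsComp G (A \ {a})ᶜ D) : ∃ d ∈ D, G.Adj a d := by
  have hDA : ∀ d ∈ D, d ∈ A ∧ d ≠ a := fun d hd => by
    simpa using Set.disjoint_compl_right_iff_subset.1 hD.2.1 hd
  obtain ⟨d, hd⟩ := hD.1.1
  obtain ⟨p, hp, q, hq, hpT, hqT, hpq⟩ := hA.2 D ⟨d, (hDA d hd).1, hd⟩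
    ⟨a, ha, fun h => (hDA a h).2 rfl⟩
  have := hD.2.2 ⟨hqT, p, hpT, hpq⟩
  simp only [Set.mem_compl_iff, Set.mem_sdiff, Set.mem_singleton_iff, not_and, not_not] at this
  exact ⟨p, hpT, this hq ▸ hpq.symm⟩

variable [Finite V] {s u : V} {c : ℕ}

omit [Finite V] in
lemma Hub.poor {F A : Set V} (h : Hub G F c) (hA : Clq G (att G F A)) :
    (att G F A).ncard ≤ 4 := h.clique _ (fun _ hf => hf.1) hA

/-- The sets `A i` cannot contain all edges of `F` if they are small. -/
lemma two_mul_le {F : Set V} (h : ∀ f ∈ F, 6 ≤ (F ∩ G.neighborSet f).ncard) {n : ℕ}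
    (K : Fin n → Set V)
    (hKF : ∀ i, K i ⊆ F) (hK : ∀ i, (K i).ncard ≤ 6)
    (hcov : ∀ f ∈ F, ∀ g ∈ F, G.Adj f g → ∃ i, f ∈ K i ∧ g ∈ K i) :
    2 * F.ncard ≤ ∑ i, (K i).ncard := by
  classical
  have := Fintype.ofFinite V
  have h1 : ∀ i, (K i).ncard = ∑ f ∈ F.toFinset, if f ∈ K i then 1 else 0 := by
    intro i
    rw [Finset.sum_boole, Set.ncard_eq_toFinset_card']
    simp only [Nat.cast_id]
    congr 1
    ext f
    simp only [Set.mem_toFinset, Finset.mem_filter]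
    exact ⟨fun hf => ⟨hKF i hf, hf⟩, fun hf => hf.2⟩
  simp only [h1]
  rw [Finset.sum_comm, Set.ncard_eq_toFinset_card', mul_comm, ← smul_eq_mul]
  refine Finset.card_nsmul_le_sum _ _ _ ?_
  intro f hf
  rw [Set.mem_toFinset] at hf
  rw [Finset.sum_boole]
  simp only [Nat.cast_id]
  by_contra! hlt
  have hdeg := h f hf
  obtain ⟨g, hg⟩ : (F ∩ G.neighborSet f).Nonempty := by
    rw [← Set.ncard_pos]
    omega
  obtain ⟨i, hi, -⟩ := hcov f hf g hg.1 hg.2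
  have huniq : ∀ j, f ∈ K j → j = i := by
    intro j hj
    exact Finset.card_le_one.1 (Nat.lt_succ_iff.1 hlt) j (by simpa using hj) i (by simpa using hi)
  have hsub : insert f (F ∩ G.neighborSet f) ⊆ K i := by
    rintro g (rfl | hg)
    · exact hi
    · obtain ⟨j, hj, hgj⟩ := hcov f hf g hg.1 hg.2
      exact huniq j hj ▸ hgj
  have h2 := Set.ncard_le_ncard hsub
  rw [Set.ncard_insert_of_notMem (fun h => G.loopless.irrefl f h.2)] at h2
  have := hK i
  omega

section
variable (hI : Inst G s) (hu : u ∉ cn G s) (hH : Hub G (G.neighborSet u) c)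
include hI hu hH

omit [Finite V] hI hH in
lemma not_mem_cn_comm : s ∉ cn G u := by
  rintro (rfl | h)
  · exact hu (Or.inl rfl)
  · exact hu (Or.inr h.symm)

/-- An edge of the neighbourhood of `u` has a common neighbour not in `cn G u`. -/
lemma exists_common {f g : V} (hf : G.Adj u f) (hg : G.Adj u g) (hfg : G.Adj f g) :
    ∃ o, o ∉ cn G u ∧ G.Adj o f ∧ G.Adj o g := by
  by_contra! hcon
  have h6 : 6 ≤ (G.commonNeighbors f g).ncard := by
    by_cases h1 : G.Adj s f
    · by_cases h2 : G.Adj s g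
      · exact absurd h2 (hcon s (not_mem_cn_comm hu) h1)
      · rw [G.commonNeighbors_symm]
        exact hI.tri g f (by rintro (rfl | h); exacts [hu (Or.inr hg.symm), h2 h]) hfg.symm
    · exact hI.tri f g (by rintro (rfl | h); exacts [hu (Or.inr hf.symm), h1 h]) hfg
  have hsub : G.commonNeighbors f g ⊆ insert u (G.neighborSet u ∩ G.commonNeighbors f g) := by
    intro o ho
    by_cases h : o ∈ cn G u
    · rcases h with rfl | h
      · exact Or.inl rfl
      · exact Or.inr ⟨h, ho⟩
    · exact absurd ho.2.symm (hcon o h ho.1.symm)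
  have h1 := Set.ncard_le_ncard hsub
  have h2 := Set.ncard_insert_le u (G.neighborSet u ∩ G.commonNeighbors f g)
  have h3 := hH.codeg f hf g hg hfg
  omega

lemma exists_mem_att {f : V} (hf : G.Adj u f) : f ∈ att G (G.neighborSet u) (cn G u)ᶜ := by
  obtain ⟨g, hg⟩ : (G.neighborSet u ∩ G.neighborSet f).Nonempty := by
    rw [← Set.ncard_pos]
    have := hH.deg f hf
    omega
  obtain ⟨o, ho, h1, -⟩ := exists_common hI hu hH hf hg.1 hg.2
  exact ⟨hf, o, ho, h1⟩

lemma not_cover_two {A B D : Set V} (hO : (cn G u)ᶜ ⊆ A ∪ (B ∪ D))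
    (hA : (att G (G.neighborSet u) A).ncard ≤ c) (hB : (att G (G.neighborSet u) B).ncard ≤ c)
    (hD : Clq G (att G (G.neighborSet u) D)) : False := by
  have hD := hH.poor hD
  have h4 := hH.four
  have h6 := hH.six
  have := two_mul_le hH.deg ![att G (G.neighborSet u) A, att G (G.neighborSet u) B,
    att G (G.neighborSet u) D] ?_ ?_ ?_
  · simp only [Fin.sum_univ_three, Matrix.cons_val_zero, Matrix.cons_val_one,
      Matrix.cons_val] at this
    have := hH.bound
    omega
  · intro i
    fin_cases i <;> exact fun _ hf => hf.1
  · intro i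
    fin_cases i <;> simp <;> omega
  · intro f hf g hg hfg
    obtain ⟨o, ho, h1, h2⟩ := exists_common hI hu hH hf hg hfg
    rcases hO ho with h | h | h
    · exact ⟨0, ⟨hf, o, h, h1⟩, hg, o, h, h2⟩
    · exact ⟨1, ⟨hf, o, h, h1⟩, hg, o, h, h2⟩
    · exact ⟨2, ⟨hf, o, h, h1⟩, hg, o, h, h2⟩

lemma not_cover_four {A B C D : Set V} (hO : (cn G u)ᶜ ⊆ A ∪ (B ∪ (C ∪ D)))
    (hA : Clq G (att G (G.neighborSet u) A)) (hB : Clq G (att G (G.neighborSet u) B))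
    (hC : Clq G (att G (G.neighborSet u) C)) (hD : Clq G (att G (G.neighborSet u) D)) :
    False := by
  have hK : ∀ i, Clq G ((![att G (G.neighborSet u) A, att G (G.neighborSet u) B,
      att G (G.neighborSet u) C, att G (G.neighborSet u) D] : Fin 4 → Set V) i) := by
    intro i
    fin_cases i <;> assumption
  obtain ⟨f, hf, g, hg, hfg, h⟩ := hH.cover _ (fun i => by
    fin_cases i <;> exact fun _ hf => hf.1) hK
  obtain ⟨o, ho, h1, h2⟩ := exists_common hI hu hH hf hg hfg
  rcases hO ho with h' | h' | h' | h'
  · exact h 0 ⟨⟨hf, o, h', h1⟩, hg, o, h', h2⟩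
  · exact h 1 ⟨⟨hf, o, h', h1⟩, hg, o, h', h2⟩
  · exact h 2 ⟨⟨hf, o, h', h1⟩, hg, o, h', h2⟩
  · exact h 3 ⟨⟨hf, o, h', h1⟩, hg, o, h', h2⟩

omit hu [Finite V] in
lemma ncard_att_le {A B : Set V} (hA : Conn G A) (hB : Conn G B) (hAB : Disjoint A B)
    (hAu : A ⊆ (cn G u)ᶜ) (hBu : B ⊆ (cn G u)ᶜ) (hr : ¬ Clq G (att G (G.neighborSet u) A)) :
    (att G (G.neighborSet u) B).ncard ≤ c := by
  by_contra! hlt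
  have hdis : ∀ {S}, S ⊆ (cn G u)ᶜ → Disjoint S (G.neighborSet u) := fun hS =>
    Set.disjoint_left.2 fun v hv h => hS hv (Or.inr h)
  obtain ⟨l, hl, hb, h⟩ := hH.rich A B hA hB hAB (hdis hAu) (hdis hBu) hr hlt
  refine hI.free ((hb.cons (conn_singleton u) ?_).minorOf (n := 8) (by simp [hl]))
  intro S hS
  obtain ⟨⟨f, hf, hfF⟩, hsub⟩ := h S hS
  refine ⟨Set.disjoint_singleton_left.2 fun huS => ?_, u, rfl, f, hf, hfF⟩
  rcases hsub huS with h | h | h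
  · exact G.loopless.irrefl u h
  · exact hAu h (Or.inl rfl)
  · exact hBu h (Or.inl rfl)

end
end

section
variable {V : Type} {G : SimpleGraph V} [Finite V] {s u : V} {c : ℕ}

section
variable (hI : Inst G s) (hs : NoInst (Nat.card V)) (hu : u ∉ cn G s)
  (hH : Hub G (G.neighborSet u) c)
include hI hs hu hH

omit hu in
/-- A set with a small neighbourhood attached at a root `a` cannot exist. -/
lemma false_of_root {D E : Set V} {a p : V} (hD : D.Nonempty) (hDs : Disjoint D (cn G s))
    (hE : Conn G E) (huE : u ∈ E) (hpE : p ∈ E) (hpu : u ≠ p) (hED : Disjoint E D)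
    (hEN : Disjoint E (nbs G D)) (hN : nbs G D ⊆ insert a (att G (G.neighborSet u) D))
    (ha : ∃ e ∈ E, G.Adj a e) (hp : Clq G (att G (G.neighborSet u) D)) : False := by
  have hE' : ∀ x ∈ E, x ∉ D ∪ nbs G D := by
    rintro x hx (h | h)
    · exact Set.disjoint_left.1 hED hx h
    · exact Set.disjoint_left.1 hEN hx h
  have h8 := eight_le_ncard_nbs hI hs hD hDs hE hED hEN (fun b hb => by
    rcases hN hb with rfl | hb
    · exact ha
    · exact ⟨u, huE, G.symm.symm _ _ hb.1⟩) hpu (hE' _ huE) (hE' _ hpE)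
  have h1 := Set.ncard_le_ncard hN
  have h2 := Set.ncard_insert_le a (att G (G.neighborSet u) D)
  have h3 := hH.poor hp
  omega

omit hs in
lemma false_of_pair {d : V} (hd : d ∉ cn G u) (hO : (cn G u)ᶜ ⊆ {d, s})
    (hp : Clq G (att G (G.neighborSet u) {s})) : False := by
  have h4 := hH.poor hp
  have hsF : ∀ K : Set V, K ⊆ G.neighborSet u → 5 ≤ K.ncard → ∃ f ∈ K, ¬ G.Adj s f := by
    intro K hK h5
    by_contra! h
    have : K ⊆ att G (G.neighborSet u) {s} := fun f hf => ⟨hK hf, s, rfl, h f hf⟩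
    have := Set.ncard_le_ncard this
    omega
  have hdF : ∀ f, G.Adj u f → G.Adj d f := by
    intro f hf
    have h6 := hH.deg f hf
    obtain ⟨g, hg, hsg⟩ := hsF _ Set.inter_subset_left (by omega : 5 ≤
      (G.neighborSet u ∩ G.neighborSet f).ncard)
    obtain ⟨o, ho, h1, h2⟩ := exists_common hI hu hH hf hg.1 hg.2
    rcases hO ho with rfl | rfl
    · exact h1
    · exact absurd h2 hsg
  obtain ⟨f, hf, hsf⟩ := hsF _ le_rfl (by have := hH.eight; omega)
  obtain ⟨g, hg⟩ : (G.neighborSet u ∩ G.neighborSet f).Nonempty := by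
    rw [← Set.ncard_pos]
    have := hH.deg f hf
    omega
  rcases hH.one u d (fun h => hd (Or.inl h.symm)) (fun h => hd (Or.inr h)) (fun f hf => hf)
    hdF with ⟨h⟩ | h
  · exact hI.noK.elim h.some
  · have h3 := h f hf g hg.1 hg.2
    have hfs : f ∉ cn G s := by
      rintro (rfl | h)
      · exact not_mem_cn_comm hu (Or.inr hf)
      · exact hsf h
    have h6 := hI.tri f g hfs hg.2
    have hsub : G.commonNeighbors f g ⊆
        insert u (insert d (G.neighborSet u ∩ G.commonNeighbors f g)) := by
      intro o ho
      by_cases hou : o ∈ cn G u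
      · rcases hou with rfl | hou
        · exact Or.inl rfl
        · exact Or.inr (Or.inr ⟨hou, ho⟩)
      · rcases hO hou with rfl | rfl
        · exact Or.inr (Or.inl rfl)
        · exact absurd ho.1.symm hsf
    have h1 := Set.ncard_le_ncard hsub
    have h2 := Set.ncard_insert_le u (insert d (G.neighborSet u ∩ G.commonNeighbors f g))
    have h3 := Set.ncard_insert_le d (G.neighborSet u ∩ G.commonNeighbors f g)
    omega

omit [Finite V] hI hs hu hH in
/-- A set attached to a nonadjacent pair has an attachment outside any clique. -/
lemma exists_mem_att_of_not_clq {F A K : Set V} (hA : ¬ Clq G (att G F A)) (hK : Clq G K) :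
    ∃ f ∈ att G F A, f ∉ K := by
  by_contra! h
  exact hA fun x hx y hy => hK x (h x hx) y (h y hy)

/-- A minimal richly attached set is a single vertex. -/
lemma eq_singleton_of_minimal {A Z R : Set V} (hAu : A ⊆ (cn G u)ᶜ) (hZu : Z ⊆ (cn G u)ᶜ)
    (hA : Conn G A) (hZ : Conn G Z) (hsA : s ∉ A) (hsZ : s ∈ Z ∪ R)
    (ht : Touch G A Z) (hrA : ¬ Clq G (att G (G.neighborSet u) A))
    (hpZ : Clq G (att G (G.neighborSet u) Z)) (hpR : Clq G (att G (G.neighborSet u) R))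
    (hO : (cn G u)ᶜ ⊆ A ∪ (Z ∪ R)) (hAR : ∀ x ∈ A, ∀ r ∈ R, ¬ G.Adj x r)
    (hmin : ∀ D ⊆ A, D ≠ A → Conn G D → Conn G (A \ D ∪ Z) →
      Clq G (att G (G.neighborSet u) D)) : ∃ a, A = {a} := by
  obtain ⟨a, ha, z, hz, haz⟩ := ht
  refine ⟨a, Set.Subset.antisymm ?_ (Set.singleton_subset_iff.2 ha)⟩
  intro v hv
  by_contra hva
  obtain ⟨D, hD, hvD⟩ := exists_isComp (G := G) (X := (A \ {a})ᶜ) (v := v) (by simpa using ⟨hv, hva⟩)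
  have hDA : ∀ {D}, IsComp G (A \ {a})ᶜ D → ∀ d ∈ D, d ∈ A ∧ d ≠ a := fun hD d hd => by
    simpa using Set.disjoint_compl_right_iff_subset.1 hD.2.1 hd
  have haD : a ∉ D := fun h => (hDA hD a h).2 rfl
  have hDsub : D ⊆ A := fun d hd => (hDA hD d hd).1
  have hAD := hA.sdiff ha hD
  have hpD : Clq G (att G (G.neighborSet u) D) := by
    refine hmin D hDsub (fun h => haD (h ▸ ha)) hD.1 ?_
    exact hAD.union_of_touch hZ ⟨a, ⟨ha, haD⟩, z, hz, haz⟩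
  by_cases hDZ : Touch G D Z
  · have hpAD : Clq G (att G (G.neighborSet u) (A \ D)) := by
      refine hmin _ Set.sdiff_subset (fun h => (h.symm ▸ hv : v ∈ A \ D).2 hvD) hAD ?_
      rw [sdiff_sdiff_right_self]
      have : A ⊓ D = D := by simpa using hDsub
      rw [this]
      exact hD.1.union_of_touch hZ hDZ
    refine not_cover_four hI hu hH (A := D) (B := A \ D) ?_ hpD hpAD hpZ hpR
    intro o ho
    by_cases h : o ∈ D
    · exact Or.inl h
    · rcases hO ho with h' | h'
      · exact Or.inr (Or.inl ⟨h', h⟩)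
      · exact Or.inr (Or.inr h')
  · have hnbs : ∀ b ∈ nbs G D, b = a ∨ b ∈ att G (G.neighborSet u) D := by
      rintro b ⟨hbD, d, hd, hdb⟩
      by_cases hbu : b ∈ cn G u
      · rcases hbu with rfl | hbu
        · exact absurd (Or.inr hdb.symm) (hAu (hDsub hd))
        · exact Or.inr ⟨hbu, d, hd, hdb⟩
      · rcases hO hbu with h | h | h
        · have := hD.2.2 ⟨hbD, d, hd, hdb⟩
          simp only [Set.mem_compl_iff, Set.mem_sdiff, Set.mem_singleton_iff, not_and,
            not_not] at this
          exact Or.inl (this h)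
        · exact absurd ⟨d, hd, b, h, hdb⟩ hDZ
        · exact absurd hdb (hAR d (hDsub hd) b h)
    have hDs : Disjoint D (cn G s) := by
      rw [Set.disjoint_left]
      rintro d hd (rfl | h)
      · exact hsA (hDsub hd)
      · rcases hsZ with h' | h'
        · exact hDZ ⟨d, hd, s, h', h.symm⟩
        · exact hAR d (hDsub hd) s h' h.symm
    obtain ⟨f, ⟨hfu, x, hx, hxf⟩, hfD⟩ := exists_mem_att_of_not_clq hrA hpD
    have hxD : x ∉ D := fun h => hfD ⟨hfu, x, h, hxf⟩
    have huf : u ≠ f := G.ne_of_adj hfu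
    have hO' : ∀ y ∈ A, y ≠ u ∧ ¬ G.Adj u y := fun y hy =>
      ⟨fun h => hAu hy (Or.inl h), fun h => hAu hy (Or.inr h)⟩
    obtain ⟨E, hE, huE, hfE, haE, hEsub⟩ : ∃ E, Conn G E ∧ u ∈ E ∧ f ∈ E ∧
        (∃ e ∈ E, G.Adj a e) ∧ ∀ e ∈ E, e = u ∨ e = f ∨
          (e ∉ D ∧ e ≠ a ∧ e ∈ A ∧ e ∉ nbs G D) := by
      by_cases hxa : x = a
      · exact ⟨{u, f}, conn_pair hfu, by simp, by simp, ⟨f, by simp, hxa ▸ hxf⟩, by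
          rintro e (h | h)
          · exact Or.inl h
          · exact Or.inr (Or.inl h)⟩
      · obtain ⟨D', hD', hxD'⟩ := exists_isComp (G := G) (X := (A \ {a})ᶜ) (v := x)
          (by simpa using ⟨hx, hxa⟩)
        obtain ⟨e, he, hae⟩ := hD'.touch_root hA ha
        refine ⟨insert u (insert f D'), (hD'.1.insert ⟨x, hxD', hxf.symm⟩).insert
          ⟨f, by simp, hfu⟩, by simp, by simp, ⟨e, by simp [he], hae⟩, ?_⟩
        rintro e (h | h | h)
        · exact Or.inl h
        · exact Or.inr (Or.inl h)
        · have h1 : e ∉ D := by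
            intro h'
            have := hD.eq_of_inter hD' ⟨e, h', h⟩
            exact hxD (this ▸ hxD')
          refine Or.inr (Or.inr ⟨h1, (hDA hD' e h).2, (hDA hD' e h).1, fun h' => ?_⟩)
          rcases hnbs e h' with h'' | h''
          · exact (hDA hD' e h).2 h''
          · exact (hO' e (hDA hD' e h).1).2 h''.1
    refine false_of_root hI hs hH ⟨v, hvD⟩ hDs hE huE hfE huf ?_ ?_ (fun b hb => hnbs b hb) haE hpD
    · rw [Set.disjoint_left]
      intro e he heD
      rcases hEsub e he with rfl | rfl | h
      · exact (hO' _ (hDsub heD)).1 rfl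
      · exact (hO' _ (hDsub heD)).2 hfu
      · exact h.1 heD
    · rw [Set.disjoint_left]
      intro e he heD
      rcases hEsub e he with rfl | rfl | h
      · rcases hnbs _ heD with h | h
        · exact (hO' a ha).1 h.symm
        · exact G.loopless.irrefl _ h.1
      · rcases hnbs _ heD with h | h
        · exact (hO' a ha).2 (h ▸ hfu)
        · exact hfD h
      · exact h.2.2.2 heD

end
end

section
variable {V : Type} {G : SimpleGraph V} {s u : V} {c : ℕ}

lemma mem_att_of_mem_nbs {Z : Set V} (hZ : Z ⊆ (cn G u)ᶜ) {b : V} (hb : b ∈ nbs G Z)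
    (hbu : b ∈ cn G u) : b ∈ att G (G.neighborSet u) Z := by
  obtain ⟨-, z, hz, hzb⟩ := hb
  rcases hbu with rfl | h
  · exact absurd (Or.inr hzb.symm) (hZ hz)
  · exact ⟨h, z, hz, hzb⟩

variable [Finite V]

lemma exists_minimal_set (P : Set V → Prop) (hP : ∃ A, P A) :
    ∃ A, P A ∧ ∀ D ⊆ A, D ≠ A → ¬ P D := by
  obtain ⟨A, hA, h⟩ := exists_minimal_of_wellFoundedLT P hP
  exact ⟨A, hA, fun D hD hne hPD => hne (Set.Subset.antisymm hD (h hPD hD))⟩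

section
variable (hI : Inst G s) (hs : NoInst (Nat.card V)) (hu : u ∉ cn G s)
  (hH : Hub G (G.neighborSet u) c)
include hI hs hu hH

/-- If `u` is separated from `s` by a component avoiding `s`, the neighbourhood of `u` is not
a hub. -/
lemma false_of_comp {C : Set V} (hC : IsComp G (cn G u) C) (hsC : s ∉ C) : False := by
  have hCO : C ⊆ (cn G u)ᶜ := fun v hv h => Set.disjoint_left.1 hC.2.1 hv h
  have hattC : ∀ {C}, IsComp G (cn G u) C → s ∉ C →
      8 ≤ (att G (G.neighborSet u) C).ncard := by
    intro C hC hsC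
    have h1 := hC.eight_le hI hs hu hsC
    have h2 : nbs G C ⊆ att G (G.neighborSet u) C := fun b hb =>
      ⟨hC.nbs_subset hb, hb.2⟩
    exact h1.trans (Set.ncard_le_ncard h2)
  have hpoor : ∀ B, Conn G B → B ⊆ (cn G u)ᶜ → Disjoint B C →
      Clq G (att G (G.neighborSet u) B) := by
    intro B hB hBO hBC
    by_contra h
    have h1 := ncard_att_le hI hH hB hC.1 hBC hBO hCO h
    have h2 := hattC hC hsC
    have := hH.six
    omega
  obtain ⟨S, hS, hsS⟩ := exists_isComp (G := G) (not_mem_cn_comm hu)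
  have hSO : S ⊆ (cn G u)ᶜ := fun v hv h => Set.disjoint_left.1 hS.2.1 hv h
  have hpS : Clq G (att G (G.neighborSet u) S) := by
    refine hpoor S hS.1 hSO ?_
    rw [Set.disjoint_left]
    intro x hx hx'
    exact hsC (hS.eq_of_inter hC ⟨x, hx, hx'⟩ ▸ hsS)
  have hSs : S = {s} := by
    refine Set.Subset.antisymm ?_ (Set.singleton_subset_iff.2 hsS)
    intro p hp
    by_contra hps
    have h1 := eight_le_ncard_nbs_of_mem hI hs hS.1 hsS hp hps (v := u) (by
      rintro (h | h)
      · exact hSO h (Or.inl rfl)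
      · exact G.loopless.irrefl u (hS.nbs_subset h))
    have h2 : nbs G S ⊆ att G (G.neighborSet u) S := fun b hb =>
      ⟨hS.nbs_subset hb, hb.2⟩
    have h3 := Set.ncard_le_ncard h2
    have h4 := hH.poor hpS
    omega
  subst hSs
  have hO : (cn G u)ᶜ ⊆ C ∪ {s} := by
    intro o ho
    obtain ⟨J, hJ, hoJ⟩ := exists_isComp (G := G) ho
    by_cases hsJ : s ∈ J
    · exact Or.inr (hJ.eq_of_inter hS ⟨s, hsJ, hsS⟩ ▸ hoJ)
    · by_cases hJC : (J ∩ C).Nonempty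
      · exact Or.inl (hJ.eq_of_inter hC hJC ▸ hoJ)
      · have h1 := hattC hJ hsJ
        have h2 := hH.poor (hpoor J hJ.1 (fun v hv h => Set.disjoint_left.1 hJ.2.1 hv h)
          (Set.disjoint_iff_inter_eq_empty.2 (Set.not_nonempty_iff_eq_empty.1 hJC)))
        omega
  have hCs : ∀ x ∈ C, ¬ G.Adj x s := fun x hx h =>
    hsC (hC.mem_of_adj hx h (not_mem_cn_comm hu))
  obtain ⟨A, ⟨hAC, hA, hrA, hCA⟩, hmin⟩ := exists_minimal_set
    (fun A => A ⊆ C ∧ Conn G A ∧ ¬ Clq G (att G (G.neighborSet u) A) ∧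
      (C \ A = ∅ ∨ Conn G (C \ A))) ⟨C, le_rfl, hC.1, fun h => by
        have h1 := hH.poor h
        have h2 := hattC hC hsC
        omega, Or.inl (by simp)⟩
  rcases hCA with hCA | hZ
  · have : A = C := Set.Subset.antisymm hAC (Set.sdiff_eq_empty.1 hCA)
    subst this
    obtain ⟨a, ha⟩ := hA.1
    by_cases h1 : A = {a}
    · refine false_of_pair hI hu hH (d := a) (hCO ha) ?_ hpS
      rw [h1] at hO
      exact hO
    · obtain ⟨b, hb, hba⟩ : ∃ b ∈ A, b ≠ a := by
        by_contra! h
        exact h1 (Set.Subset.antisymm h (Set.singleton_subset_iff.2 ha))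
      obtain ⟨D, hD, hbD⟩ := exists_isComp (G := G) (X := (A \ {a})ᶜ) (v := b)
        (by simpa using ⟨hb, hba⟩)
      have hDA : ∀ d ∈ D, d ∈ A ∧ d ≠ a := fun d hd => by
        simpa using Set.disjoint_compl_right_iff_subset.1 hD.2.1 hd
      have haD : a ∉ D := fun h => (hDA a h).2 rfl
      have hDsub : D ⊆ A := fun d hd => (hDA d hd).1
      have hAD := hA.sdiff ha hD
      have hp1 : Clq G (att G (G.neighborSet u) D) := by
        by_contra h
        exact hmin D hDsub (fun h => haD (h ▸ ha)) ⟨hDsub, hD.1, h, Or.inr hAD⟩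
      have hp2 : Clq G (att G (G.neighborSet u) (A \ D)) := by
        by_contra h
        refine hmin (A \ D) Set.sdiff_subset (fun h => (h.symm ▸ hb : b ∈ A \ D).2 hbD)
          ⟨Set.sdiff_subset, hAD, h, Or.inr ?_⟩
        rw [sdiff_sdiff_right_self]
        have : A ⊓ D = D := by simpa using hDsub
        rw [this]
        exact hD.1
      refine not_cover_four hI hu hH (A := D) (B := A \ D) ?_ hp1 hp2 hpS hpS
      intro o ho
      by_cases h : o ∈ D
      · exact Or.inl h
      · rcases hO ho with h' | h'
        · exact Or.inr (Or.inl ⟨h', h⟩)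
        · exact Or.inr (Or.inr (Or.inl h'))
  · have hZO : C \ A ⊆ (cn G u)ᶜ := fun z hz => hCO hz.1
    have hO' : (cn G u)ᶜ ⊆ A ∪ (C \ A ∪ {s}) := by
      intro o ho
      by_cases h : o ∈ A
      · exact Or.inl h
      · exact Or.inr ((hO ho).imp (fun h' => ⟨h', h⟩) id)
    have hAO : A ⊆ (cn G u)ᶜ := hAC.trans hCO
    have hdis : Disjoint A (C \ A) := Set.disjoint_sdiff_right
    have hpZ : Clq G (att G (G.neighborSet u) (C \ A)) := by
      by_contra h
      exact not_cover_two hI hu hH hO' (ncard_att_le hI hH hZ hA hdis.symm hZO hAO h)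
        (ncard_att_le hI hH hA hZ hdis hAO hZO hrA) hpS
    have ht : Touch G A (C \ A) := by
      obtain ⟨x, hx⟩ := hA.1
      obtain ⟨y, hy⟩ := hZ.1
      obtain ⟨p, hp, q, hq, hpA, hqA, hpq⟩ := hC.1.2 A ⟨x, hAC hx, hx⟩ ⟨y, hy.1, hy.2⟩
      exact ⟨p, hpA, q, ⟨hq, hqA⟩, hpq⟩
    obtain ⟨a, rfl⟩ := eq_singleton_of_minimal (R := {s}) hI hs hu hH hAO hZO hA hZ (fun h => hsC (hAC h))
      (Or.inr rfl) ht hrA hpZ hpS hO' (by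
        rintro x hx r rfl
        exact hCs x (hAC hx)) (by
        intro D hD hne hDc hDZ
        by_contra h
        refine hmin D hD hne ⟨hD.trans hAC, hDc, h, Or.inr ?_⟩
        convert hDZ using 1
        ext v
        have h1 := @hAC v
        have h2 := @hD v
        simp only [Set.mem_sdiff, Set.mem_union]
        tauto)
    obtain ⟨f, ⟨hfu, x, rfl, hxf⟩, hfZ⟩ := exists_mem_att_of_not_clq hrA hpZ
    have hnb : ∀ b ∈ nbs G (C \ {x}), b = x ∨ b ∈ att G (G.neighborSet u) (C \ {x}) := by
      intro b hb
      by_cases hbu : b ∈ cn G u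
      · exact Or.inr (mem_att_of_mem_nbs hZO hb hbu)
      · obtain ⟨z, hz, hzb⟩ := hb.2
        have := hC.mem_of_adj hz.1 hzb hbu
        by_contra! h
        exact hb.1 ⟨this, h.1⟩
    have hxO : x ∉ cn G u := hAO rfl
    refine false_of_root hI hs hH hZ.1 ?_ (conn_pair hfu) (by simp) (p := f) (by simp)
      (G.ne_of_adj hfu) ?_ ?_ (a := x) (fun b hb => hnb b hb) ⟨f, by simp, hxf⟩ hpZ
    · exact (hC.disjoint_cn hu hsC).mono_left Set.sdiff_subset
    · rw [Set.disjoint_left]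
      rintro e (rfl | rfl) he
      · exact hZO he (Or.inl rfl)
      · exact hZO he (Or.inr hfu)
    · rw [Set.disjoint_left]
      rintro e (rfl | rfl) he
      · rcases hnb _ he with rfl | h
        · exact hxO (Or.inl rfl)
        · exact G.loopless.irrefl _ h.1
      · rcases hnb _ he with rfl | h
        · exact hxO (Or.inr hfu)
        · exact hfZ h

/-- The neighbourhood of a far vertex is not a hub. -/
theorem false_of_hub : False := by
  by_cases hall : ∃ C, IsComp G (cn G u) C ∧ s ∉ C
  · obtain ⟨C, hC, hsC⟩ := hall
    exact false_of_comp hI hs hu hH hC hsC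
  push Not at hall
  have hsO := not_mem_cn_comm hu
  obtain ⟨S, hS, hsS⟩ := exists_isComp (G := G) hsO
  have hO : Conn G (cn G u)ᶜ := by
    convert hS.1 using 1
    refine Set.Subset.antisymm ?_ fun v hv h => Set.disjoint_left.1 hS.2.1 hv h
    intro o ho
    obtain ⟨J, hJ, hoJ⟩ := exists_isComp (G := G) ho
    exact hJ.eq_of_inter hS ⟨s, hall J hJ, hsS⟩ ▸ hoJ
  by_cases hfam : ∃ A, A ⊆ (cn G u)ᶜ ∧ s ∉ A ∧ Conn G A ∧
      ¬ Clq G (att G (G.neighborSet u) A) ∧ Conn G ((cn G u)ᶜ \ A)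
  · obtain ⟨A, ⟨hAO, hsA, hA, hrA, hZ⟩, hmin⟩ := exists_minimal_set _ hfam
    set Z := (cn G u)ᶜ \ A with hZdef
    have hZO : Z ⊆ (cn G u)ᶜ := Set.sdiff_subset
    have hO' : (cn G u)ᶜ ⊆ A ∪ (Z ∪ ∅) := by
      intro o ho
      by_cases h : o ∈ A
      · exact Or.inl h
      · exact Or.inr (Or.inl ⟨ho, h⟩)
    have hdis : Disjoint A Z := Set.disjoint_sdiff_right
    have hp0 : Clq G (att G (G.neighborSet u) ∅) := by
      rintro x ⟨-, a, ha, -⟩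
      exact absurd ha (Set.notMem_empty a)
    have hpZ : Clq G (att G (G.neighborSet u) Z) := by
      by_contra h
      exact not_cover_two hI hu hH hO' (ncard_att_le hI hH hZ hA hdis.symm hZO hAO h)
        (ncard_att_le hI hH hA hZ hdis hAO hZO hrA) hp0
    have hsZ : s ∈ Z := ⟨hsO, hsA⟩
    have ht : Touch G A Z := by
      obtain ⟨x, hx⟩ := hA.1
      obtain ⟨p, hp, q, hq, hpA, hqA, hpq⟩ := hO.2 A ⟨x, hAO hx, hx⟩ ⟨s, hsO, hsA⟩
      exact ⟨p, hpA, q, ⟨hq, hqA⟩, hpq⟩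
    obtain ⟨a, rfl⟩ := eq_singleton_of_minimal hI hs hu hH hAO hZO hA hZ hsA
      (Or.inl hsZ) ht hrA hpZ hp0 hO' (by
        rintro x hx r hr
        exact absurd hr (Set.notMem_empty r)) (by
        intro D hD hne hDc hDZ
        by_contra h
        refine hmin D hD hne ⟨hD.trans hAO, fun h => hsA (hD h), hDc, h, ?_⟩
        convert hDZ using 1
        ext v
        have h1 := @hAO v
        have h2 := @hD v
        simp only [hZdef, Set.mem_sdiff, Set.mem_union]
        tauto)
    have haO : a ∉ cn G u := hAO rfl
    by_cases hZs : Z = {s}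
    · refine false_of_pair hI hu hH haO ?_ (hZs ▸ hpZ)
      rw [Set.union_empty, hZs] at hO'
      exact hO'
    · obtain ⟨p, hp, hps⟩ : ∃ p ∈ Z, p ≠ s := by
        by_contra! h
        exact hZs (Set.Subset.antisymm h (Set.singleton_subset_iff.2 hsZ))
      have hnb : nbs G Z ⊆ insert a (att G (G.neighborSet u) Z) := by
        intro b hb
        by_cases hbu : b ∈ cn G u
        · exact Or.inr (mem_att_of_mem_nbs hZO hb hbu)
        · by_contra! h
          exact hb.1 ⟨hbu, fun h' => h (Or.inl h')⟩
      have h1 := eight_le_ncard_nbs_of_mem hI hs hZ hsZ hp hps (v := u) (by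
        rintro (h | h)
        · exact hZO h (Or.inl rfl)
        · rcases hnb h with h | h
          · exact haO (Or.inl h.symm)
          · exact G.loopless.irrefl u h.1)
      have h2 := Set.ncard_le_ncard hnb
      have h3 := Set.ncard_insert_le a (att G (G.neighborSet u) Z)
      have h4 := hH.poor hpZ
      omega
  · have hDsub : ∀ {D}, IsComp G ((cn G u)ᶜ \ {s})ᶜ D → ∀ d ∈ D, d ∉ cn G u ∧ d ≠ s :=
      fun hD d hd => by simpa using Set.disjoint_compl_right_iff_subset.1 hD.2.1 hd
    have hpoor : ∀ {D}, IsComp G ((cn G u)ᶜ \ {s})ᶜ D →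
        Clq G (att G (G.neighborSet u) D) := by
      intro D hD
      by_contra h
      exact hfam ⟨D, fun d hd => (hDsub hD d hd).1, fun h => (hDsub hD s h).2 rfl, hD.1, h,
        hO.sdiff hsO hD⟩
    have hdeg := hI.deg
    have h8 := hH.eight
    -- a vertex of the neighbourhood that `s` does not see
    obtain ⟨f₀, hf₀, hsf₀⟩ : ∃ f, G.Adj u f ∧ ¬ G.Adj s f := by
      by_contra! h
      have := Set.ncard_le_ncard (show G.neighborSet u ⊆ G.neighborSet s from h)
      omega
    obtain ⟨-, o, ho, hof₀⟩ := exists_mem_att hI hu hH hf₀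
    have hos : o ≠ s := by
      rintro rfl
      exact hsf₀ hof₀
    obtain ⟨D₁, hD₁, hoD₁⟩ := exists_isComp (G := G) (X := ((cn G u)ᶜ \ {s})ᶜ) (v := o)
      (by simpa using ⟨ho, hos⟩)
    -- a second component
    obtain ⟨o₂, ho₂, ho₂s, ho₂D⟩ : ∃ o, o ∉ cn G u ∧ o ≠ s ∧ o ∉ D₁ := by
      by_contra! h
      have hsub : insert f₀ (G.neighborSet u ∩ G.neighborSet f₀) ⊆
          att G (G.neighborSet u) D₁ := by
        rintro g (rfl | hg)
        · exact ⟨hf₀, o, hoD₁, hof₀⟩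
        · obtain ⟨w, hw, h1, h2⟩ := exists_common hI hu hH hf₀ hg.1 hg.2
          exact ⟨hg.1, w, h w hw (by rintro rfl; exact hsf₀ h1), h2⟩
      have h1 := Set.ncard_le_ncard hsub
      rw [Set.ncard_insert_of_notMem (fun h => G.loopless.irrefl f₀ h.2)] at h1
      have h2 := hH.deg f₀ hf₀
      have h3 := hH.poor (hpoor hD₁)
      omega
    obtain ⟨D₂, hD₂, hoD₂⟩ := exists_isComp (G := G) (X := ((cn G u)ᶜ \ {s})ᶜ) (v := o₂)
      (by simpa using ⟨ho₂, ho₂s⟩)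
    obtain ⟨D, hD, hD3⟩ : ∃ D, IsComp G ((cn G u)ᶜ \ {s})ᶜ D ∧
        (G.neighborSet s ∩ D).ncard ≤ 3 := by
      have hdis : Disjoint (G.neighborSet s ∩ D₁) (G.neighborSet s ∩ D₂) := by
        rw [Set.disjoint_left]
        rintro x ⟨-, h1⟩ ⟨-, h2⟩
        exact ho₂D (hD₁.eq_of_inter hD₂ ⟨x, h1, h2⟩ ▸ hoD₂)
      have h1 := Set.ncard_union_eq hdis
      have h2 := Set.ncard_le_ncard (show G.neighborSet s ∩ D₁ ∪ G.neighborSet s ∩ D₂ ⊆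
        G.neighborSet s from Set.union_subset Set.inter_subset_left Set.inter_subset_left)
      by_cases h : (G.neighborSet s ∩ D₁).ncard ≤ 3
      · exact ⟨D₁, hD₁, h⟩
      · exact ⟨D₂, hD₂, by omega⟩
    have hD4 := hH.poor (hpoor hD)
    have hDO : D ⊆ (cn G u)ᶜ := fun d hd => (hDsub hD d hd).1
    have hDnb : ∀ d ∈ D, ∀ v, G.Adj d v → v ∈ D ∨ v = s ∨ v ∈ att G (G.neighborSet u) D := by
      intro d hd v hdv
      by_cases hvu : v ∈ cn G u
      · by_cases hvD : v ∈ D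
        · exact Or.inl hvD
        · exact Or.inr (Or.inr (mem_att_of_mem_nbs hDO ⟨hvD, d, hd, hdv⟩ hvu))
      · by_cases hvs : v = s
        · exact Or.inr (Or.inl hvs)
        · exact Or.inl (hD.mem_of_adj hd hdv (by simpa using ⟨hvu, hvs⟩))
    by_cases hne : (D \ G.neighborSet s).Nonempty
    · have hnb : ∀ b ∈ nbs G (D \ G.neighborSet s),
          b ∈ att G (G.neighborSet u) D ∪ G.neighborSet s ∩ D := by
        rintro b ⟨hb, d, hd, hdb⟩
        rcases hDnb d hd.1 b hdb with h | rfl | h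
        · by_contra! h'
          exact hb ⟨h, fun h'' => h' (Or.inr ⟨h'', h⟩)⟩
        · exact absurd hdb.symm hd.2
        · exact Or.inl h
      obtain ⟨f, hf, hfD⟩ : ∃ f ∈ G.neighborSet u, f ∉ att G (G.neighborSet u) D := by
        by_contra! h
        have := Set.ncard_le_ncard (show G.neighborSet u ⊆ _ from h)
        omega
      obtain ⟨E, hE, huE, hsE, hEsub⟩ : ∃ E, Conn G E ∧ u ∈ E ∧ s ∈ E ∧
          ∀ e ∈ E, e = u ∨ e = f ∨ e ∉ cn G u ∧ e ∉ D := by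
        obtain ⟨-, x, hx, hxf⟩ := exists_mem_att hI hu hH hf
        have hxD : x ∉ D := fun h => hfD ⟨hf, x, h, hxf⟩
        have hsD : s ∉ D := fun h => (hDsub hD s h).2 rfl
        by_cases hxs : x = s
        · subst hxs
          refine ⟨insert u {f, x}, (conn_pair hxf.symm).insert ⟨f, by simp, hf⟩, by simp,
            by simp, ?_⟩
          rintro e (rfl | rfl | rfl)
          · exact Or.inl rfl
          · exact Or.inr (Or.inl rfl)
          · exact Or.inr (Or.inr ⟨hsO, hsD⟩)
        · obtain ⟨D', hD', hxD'⟩ := exists_isComp (G := G) (X := ((cn G u)ᶜ \ {s})ᶜ) (v := x)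
            (by simpa using ⟨hx, hxs⟩)
          obtain ⟨e, he, hse⟩ := hD'.touch_root hO hsO
          refine ⟨insert u (insert f (insert s D')), (((hD'.1.insert ⟨e, he, hse⟩).insert
            ⟨x, by simp [hxD'], hxf.symm⟩).insert ⟨f, by simp, hf⟩), by simp, by simp, ?_⟩
          rintro e (rfl | rfl | rfl | h)
          · exact Or.inl rfl
          · exact Or.inr (Or.inl rfl)
          · exact Or.inr (Or.inr ⟨hsO, hsD⟩)
          · refine Or.inr (Or.inr ⟨(hDsub hD' e h).1, fun h' => ?_⟩)
            exact hxD (hD.eq_of_inter hD' ⟨e, h', h⟩ ▸ hxD')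
      have hE1 : ∀ e ∈ E, e ∉ D := by
        intro e he heD
        rcases hEsub e he with rfl | rfl | h
        · exact hDO heD (Or.inl rfl)
        · exact hDO heD (Or.inr hf)
        · exact h.2 heD
      have hE2 : ∀ e ∈ E, e ∉ nbs G (D \ G.neighborSet s) := by
        intro e he hen
        rcases hnb e hen with h | h
        · rcases hEsub e he with rfl | rfl | h'
          · exact G.loopless.irrefl _ h.1
          · exact hfD h
          · exact h'.1 (Or.inr h.1)
        · exact hE1 e he h.2
      have hE3 : ∀ e ∈ E, e ∉ D \ G.neighborSet s ∪ nbs G (D \ G.neighborSet s) := by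
        rintro e he (h | h)
        · exact hE1 e he h.1
        · exact hE2 e he h
      have h1 := eight_le_ncard_nbs hI hs hne (E := E) (by
          rw [Set.disjoint_left]
          rintro d hd (rfl | h)
          · exact (hDsub hD _ hd.1).2 rfl
          · exact hd.2 h) hE
        (Set.disjoint_left.2 fun e he h => hE1 e he h.1)
        (Set.disjoint_left.2 fun e he h => hE2 e he h)
        (by
          intro b hb
          rcases hnb b hb with h | h
          · exact ⟨u, huE, G.symm.symm _ _ h.1⟩
          · exact ⟨s, hsE, G.symm.symm _ _ h.1⟩)
        (show u ≠ s from fun h => hu (Or.inl h)) (hE3 u huE) (hE3 s hsE)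
      have h2 := Set.ncard_le_ncard (show nbs G (D \ G.neighborSet s) ⊆ _ from hnb)
      have h3 := Set.ncard_union_le (att G (G.neighborSet u) D) (G.neighborSet s ∩ D)
      omega
    · have hDs : D ⊆ G.neighborSet s := by
        rw [Set.not_nonempty_iff_eq_empty, Set.sdiff_eq_empty] at hne
        exact hne
      obtain ⟨d, hd⟩ := hD.1.1
      obtain ⟨h, hh, hdh⟩ := exists_adj_far hI hs (hDs hd)
      have hhF : h ∈ att G (G.neighborSet u) D := by
        rcases hDnb d hd h hdh with h' | rfl | h'
        · exact absurd (Or.inr (hDs h')) hh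
        · exact absurd (Or.inl rfl) hh
        · exact h'
      have h6 := hI.tri h d hh hdh.symm
      have hsub : insert h (insert d (G.commonNeighbors h d)) ⊆
          att G (G.neighborSet u) D ∪ G.neighborSet s ∩ D := by
        rintro x (rfl | rfl | hx)
        · exact Or.inl hhF
        · exact Or.inr ⟨hDs hd, hd⟩
        · rcases hDnb d hd x hx.2 with h' | rfl | h'
          · exact Or.inr ⟨hDs h', h'⟩
          · exact absurd (Or.inr (G.symm.symm _ _ hx.1)) hh
          · exact Or.inl h'
      have h1 := Set.ncard_le_ncard hsub
      rw [Set.ncard_insert_of_notMem, Set.ncard_insert_of_notMem] at h1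
      · have h3 := Set.ncard_union_le (att G (G.neighborSet u) D) (G.neighborSet s ∩ D)
        omega
      · exact fun h' => G.loopless.irrefl d h'.2
      · rintro (h' | h')
        · exact G.ne_of_adj hdh h'.symm
        · exact G.loopless.irrefl h h'.1

end
end

/-- Adjacency in the complement of the graph with table `h`. -/
def coAdj (h : List ℕ) (i j : ℕ) : Bool := !(i == j || (h.getD i 0).testBit j)

/-- Adjacency after adding the edges `ab` and `xy`. -/
def coAdjPlus (h : List ℕ) (a b x y i j : ℕ) : Bool :=
  coAdj h i j || (i == a && j == b) || (i == b && j == a) || (i == x && j == y) ||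
    (i == y && j == x)

/-- The pairs of `m` together with all singletons avoiding them. -/
def fillBags (k : ℕ) (m : List (ℕ × ℕ)) : List (ℕ × ℕ) :=
  m ++ ((List.range k).filter fun i => m.all fun p => p.1 != i && p.2 != i).map fun i => (i, i)

/-- The pairs of `m` and the remaining singletons are seven branch sets after adding the edges
`ab` and `xy`. -/
def okEntry (h : List ℕ) (k : ℕ) (a b x y : ℕ) (m : List (ℕ × ℕ)) : Bool :=
  decide (a < k ∧ b < k ∧ x < k ∧ y < k ∧ a ≠ x) &&
    ((fillBags k m).length == 7 && (fillBags k m).all fun p =>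
      decide (p.1 < k ∧ p.2 < k) && (p.1 == p.2 || coAdjPlus h a b x y p.1 p.2)) &&
    decide ((fillBags k m).Pairwise fun p q =>
      (p.1 ≠ q.1 ∧ p.1 ≠ q.2 ∧ p.2 ≠ q.1 ∧ p.2 ≠ q.2) ∧
        (coAdjPlus h a b x y p.1 q.1 || coAdjPlus h a b x y p.1 q.2 ||
          coAdjPlus h a b x y p.2 q.1 || coAdjPlus h a b x y p.2 q.2) = true)

/-- The pairs that combine with the nonadjacent pair `ij` according to the table `T`. -/
def partners (T : List (ℕ × ℕ × ℕ × ℕ × List (ℕ × ℕ))) (i j : ℕ) : List (ℕ × ℕ) :=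
  (T.filter fun e => (e.1 == i && e.2.1 == j) || (e.1 == j && e.2.1 == i)).map
    (fun e => (e.2.2.1, e.2.2.2.1)) ++
  (T.filter fun e => (e.2.2.1 == i && e.2.2.2.1 == j) || (e.2.2.1 == j && e.2.2.2.1 == i)).map
    (fun e => (e.1, e.2.1))

/-- Some pair of `L` survives the deletion of any `d` numbers below `k`. -/
def survives (k : ℕ) : ℕ → List (ℕ × ℕ) → Bool
  | 0, L => !L.isEmpty
  | d + 1, L => (List.range k).all fun z =>
      survives k d (L.filter fun p => p.1 != z && p.2 != z)

/-- The table `T` settles the exceptional graph with table `h`. -/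
def okTable (h : List ℕ) (k d : ℕ) (T : List (ℕ × ℕ × ℕ × ℕ × List (ℕ × ℕ))) : Bool :=
  (T.all fun e => okEntry h k e.1 e.2.1 e.2.2.1 e.2.2.2.1 e.2.2.2.2) &&
    (List.range k).all fun i => (List.range k).all fun j =>
      i == j || coAdj h i j || survives k d (partners T i j)

/-- The clique `L` extends to a clique with `n` further vertices. -/
def extendsClique (h : List ℕ) (k : ℕ) : ℕ → List ℕ → Bool
  | 0, _ => true
  | n + 1, L => (List.range k).any fun a =>
      L.all (fun b => coAdj h b a) && extendsClique h k n (a :: L)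

lemma extendsClique_of_pairwise {h : List ℕ} {k : ℕ} : ∀ M L : List ℕ, (∀ a ∈ M, a < k) →
    M.Pairwise (fun a b => coAdj h a b = true) → (∀ b ∈ L, ∀ a ∈ M, coAdj h b a = true) →
    extendsClique h k M.length L = true := by
  intro M
  induction M with
  | nil => intro L _ _ _; rfl
  | cons a M ih =>
    intro L hk hM hL
    rw [List.pairwise_cons] at hM
    simp only [extendsClique, List.length_cons, List.any_eq_true, List.mem_range,
      Bool.and_eq_true, List.all_eq_true]
    refine ⟨a, hk a (by simp), fun b hb => hL b hb a (by simp), ih _ (fun c hc => hk c (by simp [hc]))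
      hM.2 ?_⟩
    intro b hb c hc
    rcases List.mem_cons.1 hb with rfl | hb
    · exact hM.1 c hc
    · exact hL b hb c (by simp [hc])

section
variable {V : Type} {G : SimpleGraph V} {F : Set V} {k : ℕ} {σ : ℕ → V} {h : List ℕ}

lemma survives_spec {d : ℕ} : ∀ {L : List (ℕ × ℕ)}, survives k d L = true →
    ∀ Z : List ℕ, Z.length = d → (∀ z ∈ Z, z < k) → ∃ p ∈ L, p.1 ∉ Z ∧ p.2 ∉ Z := by
  induction d with
  | zero =>
    intro L hL Z hZ _
    rw [List.length_eq_zero_iff] at hZ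
    subst hZ
    cases L with
    | nil => simp [survives] at hL
    | cons p L => exact ⟨p, by simp, by simp, by simp⟩
  | succ d ih =>
    intro L hL Z hZ hk
    cases Z with
    | nil => simp at hZ
    | cons z Z =>
      simp only [survives, List.all_eq_true, List.mem_range] at hL
      obtain ⟨p, hp, h1, h2⟩ := ih (hL z (hk z (by simp))) Z (by simpa using hZ)
        fun w hw => hk w (by simp [hw])
      simp only [List.mem_filter, Bool.and_eq_true, bne_iff_ne, ne_eq] at hp
      exact ⟨p, hp.1, by simp [h1, hp.2.1], by simp [h2, hp.2.2]⟩

lemma mem_partners {T : List (ℕ × ℕ × ℕ × ℕ × List (ℕ × ℕ))} {i j : ℕ} {p : ℕ × ℕ}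
    (hp : p ∈ partners T i j) : ∃ e ∈ T,
      (((e.1 = i ∧ e.2.1 = j) ∨ (e.1 = j ∧ e.2.1 = i)) ∧ p = (e.2.2.1, e.2.2.2.1)) ∨
      (((e.2.2.1 = i ∧ e.2.2.2.1 = j) ∨ (e.2.2.1 = j ∧ e.2.2.2.1 = i)) ∧ p = (e.1, e.2.1)) := by
  simp only [partners, List.mem_append, List.mem_map, List.mem_filter, Bool.or_eq_true,
    Bool.and_eq_true, beq_iff_eq] at hp
  rcases hp with ⟨e, ⟨he, h1⟩, rfl⟩ | ⟨e, ⟨he, h1⟩, rfl⟩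
  · exact ⟨e, he, Or.inl ⟨h1, rfl⟩⟩
  · exact ⟨e, he, Or.inr ⟨h1, rfl⟩⟩

variable (hσ : Lab F k σ) (hh : ∀ i < k, ∀ j < k, G.Adj (σ i) (σ j) ↔ coAdj h i j = true)
include hσ hh

lemma bags_of_okEntry {a b x y : ℕ} {m : List (ℕ × ℕ)} (hok : okEntry h k a b x y m = true)
    {P Q : Set V} (hP : Conn G P) (hQ : Conn G Q) (hPQ : Disjoint P Q) (hPF : Disjoint P F)
    (hQF : Disjoint Q F) (ha : σ a ∈ att G F P) (hb : σ b ∈ att G F P) (hx : σ x ∈ att G F Q)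
    (hy : σ y ∈ att G F Q) :
    ∃ l, l.length = 7 ∧ Bags G l ∧ ∀ S ∈ l, (S ∩ F).Nonempty ∧ S ⊆ F ∪ (P ∪ Q) := by
  simp only [okEntry, Bool.and_eq_true, decide_eq_true_eq, beq_iff_eq, List.all_eq_true,
    Bool.or_eq_true] at hok
  obtain ⟨⟨⟨hak, hbk, hxk, hyk, hax⟩, hlen, hm⟩, hpw⟩ := hok
  obtain ⟨-, a', ha', haa⟩ := ha
  obtain ⟨-, b', hb', hbb⟩ := hb
  obtain ⟨-, x', hx', hxx⟩ := hx
  obtain ⟨-, y', hy', hyy⟩ := hy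
  let β : ℕ → Set V := fun i => {v | v = σ i ∨ (i = a ∧ v ∈ P) ∨ (i = x ∧ v ∈ Q)}
  have hβ0 : ∀ i, σ i ∈ β i := fun i => Or.inl rfl
  have hβP : ∀ v ∈ P, v ∈ β a := fun v hv => Or.inr (Or.inl ⟨rfl, hv⟩)
  have hβQ : ∀ v ∈ Q, v ∈ β x := fun v hv => Or.inr (Or.inr ⟨rfl, hv⟩)
  have hβc : ∀ i, Conn G (β i) := by
    intro i
    by_cases hia : i = a
    · subst hia
      convert hP.insert ⟨a', ha', haa.symm⟩ using 1
      ext v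
      simp [β, hax]
    · by_cases hix : i = x
      · subst hix
        convert hQ.insert ⟨x', hx', hxx.symm⟩ using 1
        ext v
        simp [β, hia]
      · convert conn_singleton (G := G) (σ i) using 1
        ext v
        simp [β, hia, hix]
  have hβt : ∀ i < k, ∀ j < k, coAdjPlus h a b x y i j = true → Touch G (β i) (β j) := by
    intro i hi j hj hij
    simp only [coAdjPlus, Bool.or_eq_true, Bool.and_eq_true, beq_iff_eq] at hij
    rcases hij with (((hij | ⟨rfl, rfl⟩) | ⟨rfl, rfl⟩) | ⟨rfl, rfl⟩) | ⟨rfl, rfl⟩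
    · exact ⟨_, hβ0 i, _, hβ0 j, (hh i hi j hj).2 hij⟩
    · exact ⟨_, hβP _ hb', _, hβ0 _, hbb⟩
    · exact ⟨_, hβ0 _, _, hβP _ hb', hbb.symm⟩
    · exact ⟨_, hβQ _ hy', _, hβ0 _, hyy⟩
    · exact ⟨_, hβ0 _, _, hβQ _ hy', hyy.symm⟩
  have hβd : ∀ i < k, ∀ j < k, i ≠ j → ∀ v, v ∈ β i → v ∉ β j := by
    have hFP : ∀ i < k, σ i ∉ P := fun i hi h' => Set.disjoint_left.1 hPF h' (hσ.mem i hi)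
    have hFQ : ∀ i < k, σ i ∉ Q := fun i hi h' => Set.disjoint_left.1 hQF h' (hσ.mem i hi)
    rintro i hi j hj hij v (rfl | ⟨rfl, hv⟩ | ⟨rfl, hv⟩) (hw | ⟨rfl, hw⟩ | ⟨rfl, hw⟩)
    · exact hij (hσ.inj _ hi _ hj hw)
    · exact hFP _ hi hw
    · exact hFQ _ hi hw
    · exact hFP _ hj (hw ▸ hv)
    · exact hij rfl
    · exact Set.disjoint_left.1 hPQ hv hw
    · exact hFQ _ hj (hw ▸ hv)
    · exact Set.disjoint_left.1 hPQ hw hv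
    · exact hij rfl
  refine ⟨(fillBags k m).map fun p => β p.1 ∪ β p.2, by simpa using hlen, ⟨?_, ?_⟩, ?_⟩
  · intro S hS
    obtain ⟨p, hp, rfl⟩ := List.mem_map.1 hS
    obtain ⟨⟨h1, h2⟩, h3 | h3⟩ := hm p hp
    · rw [h3, Set.union_self]
      exact hβc _
    · exact (hβc _).union_of_touch (hβc _) (hβt _ h1 _ h2 h3)
  · rw [List.pairwise_map]
    refine hpw.imp_of_mem ?_
    intro p q hp hq hpq
    obtain ⟨⟨hp1, hp2⟩, -⟩ := hm p hp
    obtain ⟨⟨hq1, hq2⟩, -⟩ := hm q hq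
    obtain ⟨⟨h1, h2, h3, h4⟩, h5⟩ := hpq
    constructor
    · rw [Set.disjoint_left]
      rintro v (hv | hv) (hw | hw)
      · exact hβd _ hp1 _ hq1 h1 v hv hw
      · exact hβd _ hp1 _ hq2 h2 v hv hw
      · exact hβd _ hp2 _ hq1 h3 v hv hw
      · exact hβd _ hp2 _ hq2 h4 v hv hw
    · rcases h5 with ((h5 | h5) | h5) | h5
      · exact (hβt _ hp1 _ hq1 h5).mono Set.subset_union_left Set.subset_union_left
      · exact (hβt _ hp1 _ hq2 h5).mono Set.subset_union_left Set.subset_union_right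
      · exact (hβt _ hp2 _ hq1 h5).mono Set.subset_union_right Set.subset_union_left
      · exact (hβt _ hp2 _ hq2 h5).mono Set.subset_union_right Set.subset_union_right
  · intro S hS
    obtain ⟨p, hp, rfl⟩ := List.mem_map.1 hS
    obtain ⟨⟨h1, h2⟩, -⟩ := hm p hp
    refine ⟨⟨σ p.1, Or.inl (hβ0 _), hσ.mem _ h1⟩, ?_⟩
    rintro v ((rfl | h') | (rfl | h'))
    · exact Or.inl (hσ.mem _ h1)
    · exact Or.inr (h'.imp (fun h => h.2) fun h => h.2)
    · exact Or.inl (hσ.mem _ h2)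
    · exact Or.inr (h'.imp (fun h => h.2) fun h => h.2)

omit hh in
lemma ncard_of_lab {S : Set V} (hS : S ⊆ F) {p : ℕ → Bool} (hp : ∀ i < k, σ i ∈ S ↔ p i = true) :
    S.ncard = ((Finset.range k).filter fun i => p i = true).card := by
  have : S = σ '' (((Finset.range k).filter fun i => p i = true : Finset ℕ) : Set ℕ) := by
    ext v
    constructor
    · intro hv
      obtain ⟨i, hi, rfl⟩ := hσ.surj v (hS hv)
      exact ⟨i, by simpa using ⟨hi, (hp i hi).1 hv⟩, rfl⟩
    · rintro ⟨i, hi, rfl⟩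
      simp only [Finset.coe_filter, Finset.mem_range, Set.mem_ofPred_eq] at hi
      exact (hp i hi.1).2 hi.2
  rw [this, Set.InjOn.ncard_image, Set.ncard_coe_finset]
  intro i hi j hj hij
  simp only [Finset.coe_filter, Finset.mem_range, Set.mem_ofPred_eq] at hi hj
  exact hσ.inj i hi.1 j hj.1 hij

lemma rich_of_okTable {d c : ℕ} (hdc : k ≤ c + 1 + d) (h0 : 0 < k)
    {T : List (ℕ × ℕ × ℕ × ℕ × List (ℕ × ℕ))} (hT : okTable h k d T = true) {A B : Set V}
    (hA : Conn G A) (hB : Conn G B) (hAB : Disjoint A B) (hAF : Disjoint A F)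
    (hBF : Disjoint B F) (hr : ¬ Clq G (att G F A)) (hc : c < (att G F B).ncard) :
    ∃ l, l.length = 7 ∧ Bags G l ∧ ∀ S ∈ l, (S ∩ F).Nonempty ∧ S ⊆ F ∪ (A ∪ B) := by
  classical
  simp only [okTable, Bool.and_eq_true, List.all_eq_true, List.mem_range, Bool.or_eq_true,
    beq_iff_eq] at hT
  obtain ⟨hT1, hT2⟩ := hT
  obtain ⟨i, hi, j, hj, hiA, hjA, hij, hnij⟩ : ∃ i < k, ∃ j < k, σ i ∈ att G F A ∧
      σ j ∈ att G F A ∧ i ≠ j ∧ ¬ G.Adj (σ i) (σ j) := by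
    by_contra! hcon
    refine hr fun f hf g hg hne => ?_
    obtain ⟨i, hi, rfl⟩ := hσ.surj f hf.1
    obtain ⟨j, hj, rfl⟩ := hσ.surj g hg.1
    exact hcon i hi j hj hf hg fun h => hne (by rw [h])
  have hsv : survives k d (partners T i j) = true := by
    rcases hT2 i hi j hj with (h | h) | h
    · exact absurd h hij
    · exact absurd ((hh i hi j hj).2 h) hnij
    · exact h
  obtain ⟨Z, hZd, hZk, hZ⟩ : ∃ Z : List ℕ, Z.length = d ∧ (∀ z ∈ Z, z < k) ∧
      ∀ i < k, σ i ∉ att G F B → i ∈ Z := by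
    have h1 := ncard_of_lab hσ (S := att G F B) (fun f hf => hf.1)
      (p := fun i => decide (σ i ∈ att G F B)) (by simp)
    have h2 := Finset.card_filter_add_card_filter_not (s := Finset.range k)
      (fun i => decide (σ i ∈ att G F B) = true)
    rw [Finset.card_range] at h2
    set S := (Finset.range k).filter fun i => ¬ decide (σ i ∈ att G F B) = true with hS
    refine ⟨S.toList ++ List.replicate (d - S.card) 0, ?_, ?_, ?_⟩
    · simp only [List.length_append, Finset.length_toList, List.length_replicate]
      omega
    · intro z hz
      simp only [List.mem_append, Finset.mem_toList, List.mem_replicate] at hz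
      rcases hz with hz | hz
      · simp only [hS, Finset.mem_filter, Finset.mem_range] at hz
        exact hz.1
      · omega
    · intro i hi hiB
      simp [hS, hi, hiB]
  obtain ⟨p, hp, hp1, hp2⟩ := survives_spec hsv Z hZd hZk
  obtain ⟨⟨a, b, x, y, m⟩, he, h'⟩ := mem_partners hp
  have hok := hT1 _ he
  have hk := hok
  simp only [okEntry, Bool.and_eq_true, decide_eq_true_eq] at hk
  obtain ⟨⟨⟨hak, hbk, hxk, hyk, -⟩, -⟩, -⟩ := hk
  have hBmem : ∀ {i}, i < k → i ∉ Z → σ i ∈ att G F B := fun hi h =>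
    by_contra fun h' => h (hZ _ hi h')
  rcases h' with ⟨h1, rfl⟩ | ⟨h1, rfl⟩
  · have hx := hBmem hxk hp1
    have hy := hBmem hyk hp2
    rcases h1 with ⟨rfl, rfl⟩ | ⟨rfl, rfl⟩
    · exact bags_of_okEntry hσ hh hok hA hB hAB hAF hBF hiA hjA hx hy
    · exact bags_of_okEntry hσ hh hok hA hB hAB hAF hBF hjA hiA hx hy
  · have ha := hBmem hak hp1
    have hb := hBmem hbk hp2
    rw [Set.union_comm A B]
    rcases h1 with ⟨rfl, rfl⟩ | ⟨rfl, rfl⟩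
    · exact bags_of_okEntry hσ hh hok hB hA hAB.symm hBF hAF ha hb hiA hjA
    · exact bags_of_okEntry hσ hh hok hB hA hAB.symm hBF hAF ha hb hjA hiA

lemma deg_of_lab {n : ℕ}
    (hd : ∀ i < k, n ≤ ((Finset.range k).filter fun j => coAdj h i j = true).card) :
    ∀ f ∈ F, n ≤ (F ∩ G.neighborSet f).ncard := by
  intro f hf
  obtain ⟨i, hi, rfl⟩ := hσ.surj f hf
  rw [ncard_of_lab hσ Set.inter_subset_left (p := fun j => coAdj h i j)]
  · exact hd i hi
  · intro j hj
    rw [← hh i hi j hj]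
    exact ⟨fun h' => h'.2, fun h' => ⟨hσ.mem j hj, h'⟩⟩

lemma codeg_of_lab {n : ℕ}
    (hd : ∀ i < k, ∀ j < k, coAdj h i j = true →
      ((Finset.range k).filter fun l => (coAdj h i l && coAdj h j l) = true).card ≤ n) :
    ∀ f ∈ F, ∀ g ∈ F, G.Adj f g → (F ∩ G.commonNeighbors f g).ncard ≤ n := by
  intro f hf g hg hfg
  obtain ⟨i, hi, rfl⟩ := hσ.surj f hf
  obtain ⟨j, hj, rfl⟩ := hσ.surj g hg
  rw [ncard_of_lab hσ Set.inter_subset_left (p := fun l => coAdj h i l && coAdj h j l)]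
  · exact hd i hi j hj ((hh i hi j hj).1 hfg)
  · intro l hl
    rw [Bool.and_eq_true, ← hh i hi l hl, ← hh j hj l hl]
    exact ⟨fun h' => h'.2, fun h' => ⟨hσ.mem l hl, h'⟩⟩

lemma clique_of_lab (hd : extendsClique h k 5 [] = false) [Finite V] :
    ∀ K ⊆ F, Clq G K → K.ncard ≤ 4 := by
  intro K hK hcl
  by_contra! hlt
  have := Fintype.ofFinite K
  rw [← Nat.card_coe_set_eq, Nat.card_eq_fintype_card] at hlt
  obtain ⟨g⟩ := Function.Embedding.nonempty_of_card_le (α := Fin 5) (β := K)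
    (by rwa [Fintype.card_fin])
  choose t ht1 ht2 using fun i => hσ.surj (g i) (hK (g i).2)
  have hadj : ∀ i j, i ≠ j → coAdj h (t i) (t j) = true := by
    intro i j hij
    rw [← hh _ (ht1 i) _ (ht1 j), ht2, ht2]
    refine hcl _ (g i).2 _ (g j).2 fun h' => hij (g.injective (Subtype.ext h'))
  have hex := extendsClique_of_pairwise (h := h) (k := k) [t 0, t 1, t 2, t 3, t 4] []
    (by simp [ht1]) (by simp [hadj]) (by simp)
  rw [List.length_cons, List.length_cons, List.length_cons, List.length_cons, List.length_cons,
    List.length_nil, hd] at hex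
  exact absurd hex (by decide)

omit hσ hh in
/-- Four cliques cannot cover a graph in which all degrees are at least six. -/
lemma cover_of_lt [Finite V] (h9 : 9 ≤ F.ncard)
    (hd : ∀ f ∈ F, 6 ≤ (F ∩ G.neighborSet f).ncard)
    (hcl : ∀ K ⊆ F, Clq G K → K.ncard ≤ 4) (K : Fin 4 → Set V) (hKF : ∀ i, K i ⊆ F)
    (hK : ∀ i, Clq G (K i)) : ∃ f ∈ F, ∃ g ∈ F, G.Adj f g ∧ ∀ i, ¬ (f ∈ K i ∧ g ∈ K i) := by
  by_contra! hcon
  have hK4 : ∀ i, (K i).ncard ≤ 4 := fun i => hcl _ (hKF i) (hK i)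
  have h1 := two_mul_le hd K hKF (fun i => (hK4 i).trans (by norm_num)) hcon
  have h2 : ∑ i, (K i).ncard ≤ ∑ _i : Fin 4, 4 := Finset.sum_le_sum fun i _ => hK4 i
  simp at h2
  omega

end

/-- Branch sets for the exceptional graph on eight vertices. -/
def table8 : List (ℕ × ℕ × ℕ × ℕ × List (ℕ × ℕ)) :=
  [(0,1,2,3,[(4,6)]), (0,1,4,5,[(2,6)]), (0,1,6,7,[(2,4)]), (2,3,4,5,[(0,6)]), (2,3,6,7,[(0,4)]),
    (4,5,6,7,[(0,2)])]

/-- Branch sets for the exceptional graph on nine vertices. -/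
def table9 : List (ℕ × ℕ × ℕ × ℕ × List (ℕ × ℕ)) :=
  [(0,1,3,4,[(2,6),(5,7)]), (0,1,3,5,[(2,6),(4,7)]), (0,1,4,5,[(2,6),(3,7)]),
    (0,1,6,7,[(2,3),(4,8)]), (0,1,6,8,[(2,3),(4,7)]), (0,1,7,8,[(2,3),(4,6)]),
    (0,2,3,4,[(1,6),(5,7)]), (0,2,3,5,[(1,6),(4,7)]), (0,2,4,5,[(1,6),(3,7)]),
    (0,2,6,7,[(1,3),(4,8)]), (0,2,6,8,[(1,3),(4,7)]), (0,2,7,8,[(1,3),(4,6)]),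
    (1,2,3,4,[(0,6),(5,7)]), (1,2,3,5,[(0,6),(4,7)]), (1,2,4,5,[(0,6),(3,7)]),
    (1,2,6,7,[(0,3),(4,8)]), (1,2,6,8,[(0,3),(4,7)]), (1,2,7,8,[(0,3),(4,6)]),
    (3,4,6,7,[(0,5),(1,8)]), (3,4,6,8,[(0,5),(1,7)]), (3,4,7,8,[(0,5),(1,6)]),
    (3,5,6,7,[(0,4),(1,8)]), (3,5,6,8,[(0,4),(1,7)]), (3,5,7,8,[(0,4),(1,6)]),
    (4,5,6,7,[(0,3),(1,8)]), (4,5,6,8,[(0,3),(1,7)]), (4,5,7,8,[(0,3),(1,6)])]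

/-- Branch sets for the exceptional graph on ten vertices. -/
def table10 : List (ℕ × ℕ × ℕ × ℕ × List (ℕ × ℕ)) :=
  [(0,1,2,6,[(0,4),(3,5),(7,9)]), (0,1,2,7,[(0,5),(3,4),(6,8)]), (0,1,3,8,[(0,4),(2,5),(7,9)]),
    (0,1,3,9,[(0,5),(2,4),(6,8)]), (0,1,4,6,[(1,2),(3,5),(8,9)]), (0,1,4,8,[(1,3),(2,5),(6,7)]),
    (0,1,5,7,[(1,2),(3,4),(8,9)]), (0,1,5,9,[(1,3),(2,4),(6,7)]), (0,2,1,4,[(0,6),(3,7),(5,8)]),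
    (0,2,1,5,[(0,7),(3,6),(4,9)]), (0,2,3,8,[(0,7),(1,6),(4,9)]), (0,2,3,9,[(0,6),(1,7),(5,8)]),
    (0,2,4,6,[(1,2),(3,5),(8,9)]), (0,2,5,7,[(1,2),(3,4),(8,9)]), (0,2,6,9,[(1,7),(2,3),(4,5)]),
    (0,2,7,8,[(1,6),(2,3),(4,5)]), (0,3,1,4,[(0,8),(2,9),(5,6)]), (0,3,1,5,[(0,9),(2,8),(4,7)]),
    (0,3,2,6,[(0,9),(1,8),(4,7)]), (0,3,2,7,[(0,8),(1,9),(5,6)]), (0,3,4,8,[(1,3),(2,5),(6,7)]),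
    (0,3,5,9,[(1,3),(2,4),(6,7)]), (0,3,6,9,[(1,7),(2,3),(4,5)]), (0,3,7,8,[(1,6),(2,3),(4,5)]),
    (1,4,2,6,[(0,4),(3,5),(7,9)]), (1,4,3,8,[(0,4),(2,5),(7,9)]), (1,4,5,7,[(0,6),(1,8),(2,9)]),
    (1,4,5,9,[(0,8),(1,6),(3,7)]), (1,4,6,9,[(0,7),(2,3),(4,5)]), (1,4,7,8,[(0,6),(2,3),(4,5)]),
    (1,5,2,7,[(0,5),(3,4),(6,8)]), (1,5,3,9,[(0,5),(2,4),(6,8)]), (1,5,4,6,[(0,7),(1,9),(2,8)]),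
    (1,5,4,8,[(0,9),(1,7),(3,6)]), (1,5,6,9,[(0,7),(2,3),(4,5)]), (1,5,7,8,[(0,6),(2,3),(4,5)]),
    (2,6,3,9,[(0,6),(1,7),(5,8)]), (2,6,4,8,[(0,5),(1,3),(6,7)]), (2,6,5,7,[(0,4),(1,3),(7,9)]),
    (2,6,5,9,[(0,4),(1,3),(6,7)]), (2,6,7,8,[(0,9),(1,3),(4,7)]), (2,7,3,8,[(0,7),(1,6),(4,9)]),
    (2,7,4,6,[(0,5),(1,3),(6,8)]), (2,7,4,8,[(0,5),(1,3),(6,7)]), (2,7,5,9,[(0,4),(1,3),(6,7)]),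
    (2,7,6,9,[(0,8),(1,3),(5,6)]), (3,8,4,6,[(0,5),(1,2),(8,9)]), (3,8,5,7,[(0,4),(1,2),(7,9)]),
    (3,8,5,9,[(0,4),(1,2),(7,9)]), (3,8,6,9,[(0,7),(1,2),(4,9)]), (3,9,4,6,[(0,5),(1,2),(6,8)]),
    (3,9,4,8,[(0,5),(1,2),(6,8)]), (3,9,5,7,[(0,4),(1,2),(8,9)]), (3,9,7,8,[(0,6),(1,2),(5,8)]),
    (4,6,5,9,[(0,7),(1,9),(2,8)]), (4,6,7,8,[(0,5),(1,9),(2,8)]), (4,8,5,7,[(0,6),(1,8),(2,9)]),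
    (4,8,6,9,[(0,5),(1,7),(3,6)]), (5,7,6,9,[(0,4),(1,8),(2,9)]), (5,9,7,8,[(0,4),(1,6),(3,7)])]

lemma okTable_8 : okTable [2, 1, 8, 4, 32, 16, 128, 64] 8 2 table8 = true := by decide +kernel

lemma okTable_9 : okTable [6, 5, 3, 48, 40, 24, 384, 320, 192] 9 3 table9 = true := by decide +kernel

lemma okTable_10 : okTable [14, 49, 193, 769, 322, 642, 532, 292, 152, 104] 10 3 table10 = true := by decide +kernel

/-- Four truth values. -/
abbrev Quad := Bool × Bool × Bool × Bool

/-- Some position is true in both quadruples. -/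
def Quad.meet (a b : Quad) : Bool :=
  (a.1 && b.1) || (a.2.1 && b.2.1) || (a.2.2.1 && b.2.2.1) || (a.2.2.2 && b.2.2.2)

set_option synthInstance.maxHeartbeats 400000 in
set_option synthInstance.maxSize 4000 in
/-- Four disjoint pairs of subsets of a set of four elements are not pairwise intersecting. -/
lemma quad_false : ∀ a b : Quad, a.meet b = false →
    ∀ c : Quad, a.meet c = true → b.meet c = true →
    ∀ d : Quad, c.meet d = false → a.meet d = true → b.meet d = true →
    ∀ e : Quad, a.meet e = true → b.meet e = true → c.meet e = true → d.meet e = true →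
    ∀ f : Quad, e.meet f = false → a.meet f = true → b.meet f = true → c.meet f = true →
      d.meet f = true →
    ∀ g : Quad, a.meet g = true → b.meet g = true → c.meet g = true → d.meet g = true →
      e.meet g = true → f.meet g = true →
    ∀ h : Quad, g.meet h = false → a.meet h = true → b.meet h = true → c.meet h = true →
      d.meet h = true → e.meet h = true → f.meet h = true → False := by
  decide +kernel

section
variable {V : Type} {G : SimpleGraph V} {F : Set V}

lemma Shape.exists_lab {k : ℕ} {h : List ℕ} (hS : Shape G F k h) : ∃ σ, Lab F k σ ∧
    ∀ i < k, ∀ j < k, G.Adj (σ i) (σ j) ↔ coAdj h i j = true := by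
  obtain ⟨σ, hσ, hh⟩ := hS
  refine ⟨σ, hσ, fun i hi j hj => ?_⟩
  rw [hh i hi j hj]
  simp [coAdj]

lemma Lab.ncard {k : ℕ} {σ : ℕ → V} (hσ : Lab F k σ) : F.ncard = k := by
  rw [ncard_of_lab hσ le_rfl (p := fun _ => true) (fun i hi => by simpa using hσ.mem i hi)]
  simp

lemma cover_of_shape {σ : ℕ → V} (hσ : Lab F 8 σ)
    (hh : ∀ i < 8, ∀ j < 8, G.Adj (σ i) (σ j) ↔ coAdj [2, 1, 8, 4, 32, 16, 128, 64] i j = true)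
    (K : Fin 4 → Set V) (hK : ∀ i, Clq G (K i)) :
    ∃ f ∈ F, ∃ g ∈ F, G.Adj f g ∧ ∀ i, ¬ (f ∈ K i ∧ g ∈ K i) := by
  classical
  by_contra! hcon
  let q : ℕ → Quad := fun i => (decide (σ i ∈ K 0), decide (σ i ∈ K 1), decide (σ i ∈ K 2),
    decide (σ i ∈ K 3))
  have hq : ∀ i j, (q i).meet (q j) = true ↔ ∃ l, σ i ∈ K l ∧ σ j ∈ K l := by
    intro i j
    simp only [Quad.meet, q, Bool.or_eq_true, Bool.and_eq_true, decide_eq_true_eq]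
    constructor
    · rintro (((h | h) | h) | h)
      exacts [⟨0, h⟩, ⟨1, h⟩, ⟨2, h⟩, ⟨3, h⟩]
    · rintro ⟨l, h⟩
      fin_cases l
      · exact Or.inl (Or.inl (Or.inl h))
      · exact Or.inl (Or.inl (Or.inr h))
      · exact Or.inl (Or.inr h)
      · exact Or.inr h
  have h1 : ∀ i < 8, ∀ j < 8, coAdj [2, 1, 8, 4, 32, 16, 128, 64] i j = true →
      (q i).meet (q j) = true := fun i hi j hj h =>
    (hq i j).2 (hcon _ (hσ.mem i hi) _ (hσ.mem j hj) ((hh i hi j hj).2 h))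
  have h2 : ∀ i < 8, ∀ j < 8, i ≠ j → coAdj [2, 1, 8, 4, 32, 16, 128, 64] i j = false →
      (q i).meet (q j) = false := by
    intro i hi j hj hij h
    by_contra h'
    rw [Bool.not_eq_false, hq] at h'
    obtain ⟨l, hl, hl'⟩ := h'
    have := hK l _ hl _ hl' fun h => hij (hσ.inj i hi j hj h)
    rw [hh i hi j hj, h] at this
    exact absurd this (by decide)
  refine quad_false (q 0) (q 1) ?_ (q 2) ?_ ?_ (q 3) ?_ ?_ ?_ (q 4) ?_ ?_ ?_ ?_ (q 5) ?_ ?_ ?_ ?_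
    ?_ (q 6) ?_ ?_ ?_ ?_ ?_ ?_ (q 7) ?_ ?_ ?_ ?_ ?_ ?_ ?_
  all_goals first
    | exact h1 _ (by decide) _ (by decide) (by decide)
    | exact h2 _ (by decide) _ (by decide) (by decide) (by decide)

lemma embedding_of_shape {σ : ℕ → V} (hσ : Lab F 8 σ)
    (hh : ∀ i < 8, ∀ j < 8, G.Adj (σ i) (σ j) ↔ coAdj [2, 1, 8, 4, 32, 16, 128, 64] i j = true)
    {u v : V} (huv : u ≠ v) (hnuv : ¬ G.Adj u v) (hu : ∀ f ∈ F, G.Adj u f)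
    (hv : ∀ f ∈ F, G.Adj v f) : Nonempty (K22222 ↪g G) := by
  let τ : ℕ → V := fun n => if n = 0 then u else if n = 1 then v else σ (n - 2)
  have hco : ∀ i < 8, ∀ j < 8, coAdj [2, 1, 8, 4, 32, 16, 128, 64] i j = true ↔
      i / 2 ≠ j / 2 := by decide
  have hadj : ∀ m < 10, ∀ n < 10, G.Adj (τ m) (τ n) ↔ m / 2 ≠ n / 2 := by
    intro m hm n hn
    rcases m with _ | _ | m <;> rcases n with _ | _ | n
    · simp [τ]
    · simpa [τ] using hnuv
    · have := hu _ (hσ.mem n (by omega))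
      exact iff_of_true (by simpa [τ] using this) (by omega)
    · simpa [τ] using fun h : G.Adj v u => hnuv h.symm
    · simp [τ]
    · have := hv _ (hσ.mem n (by omega))
      exact iff_of_true (by simpa [τ] using this) (by omega)
    · have := (hu _ (hσ.mem m (by omega))).symm
      exact iff_of_true (by simpa [τ] using this) (by omega)
    · have := (hv _ (hσ.mem m (by omega))).symm
      exact iff_of_true (by simpa [τ] using this) (by omega)
    · have := hco m (by omega) n (by omega)
      rw [← hh m (by omega) n (by omega)] at this
      have h2 : (m + 1 + 1) / 2 ≠ (n + 1 + 1) / 2 ↔ m / 2 ≠ n / 2 := by omega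
      rw [h2, ← this]
      simp [τ]
  have hinj : ∀ m < 10, ∀ n < 10, τ m = τ n → m = n := by
    intro m hm n hn h
    by_contra hmn
    have h2 : m / 2 = n / 2 := by
      by_contra h'
      exact G.ne_of_adj ((hadj m hm n hn).2 h') h
    rcases m with _ | _ | m <;> rcases n with _ | _ | n
    · exact hmn rfl
    · exact huv (by simpa [τ] using h)
    · omega
    · exact huv (by simpa [τ] using h.symm)
    · exact hmn rfl
    · omega
    · omega
    · omega
    · have := hσ.inj m (by omega) n (by omega) (by simpa [τ] using h)
      omega
  refine ⟨⟨⟨fun w => τ (2 * w.1 + w.2), ?_⟩, ?_⟩⟩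
  · rintro ⟨⟨i, hi⟩, ⟨j, hj⟩⟩ ⟨⟨i', hi'⟩, ⟨j', hj'⟩⟩ h
    have := hinj (2 * i + j) (by omega) (2 * i' + j') (by omega) h
    change 2 * i + j = 2 * i' + j' at this
    obtain rfl : i = i' := by omega
    obtain rfl : j = j' := by omega
    rfl
  · rintro ⟨⟨i, hi⟩, ⟨j, hj⟩⟩ ⟨⟨i', hi'⟩, ⟨j', hj'⟩⟩
    change G.Adj (τ (2 * i + j)) (τ (2 * i' + j')) ↔ (⟨i, hi⟩ : Fin 5) ≠ ⟨i', hi'⟩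
    rw [hadj _ (by omega) _ (by omega), ne_eq, ne_eq, Fin.mk.injEq]
    omega

variable [Finite V]

set_option synthInstance.maxHeartbeats 400000 in
set_option synthInstance.maxSize 4000 in
/-- The exceptional neighbourhoods are hubs. -/
theorem Exc.exists_hub (hF : Exc G F) : ∃ c, Hub G F c := by
  rcases hF with hF | hF | hF <;> obtain ⟨σ, hσ, hh⟩ := hF.exists_lab <;> have hk := hσ.ncard
  · refine ⟨5, ?_, ?_, ?_, ?_, ?_, ?_, ?_, ?_, ?_, ?_⟩
    · omega
    · omega
    · omega
    · omega
    · exact deg_of_lab hσ hh (by decide +kernel)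
    · exact clique_of_lab hσ hh (by decide +kernel)
    · exact codeg_of_lab hσ hh (by decide +kernel)
    · exact fun K _ hK => cover_of_shape hσ hh K hK
    · exact fun A B => rich_of_okTable hσ hh (by norm_num) (by norm_num) okTable_8
    · exact fun u v huv hn hu hv => Or.inl (embedding_of_shape hσ hh huv hn hu hv)
  · have hdeg := deg_of_lab hσ hh (n := 6) (by decide +kernel)
    have hcl := clique_of_lab hσ hh (by decide +kernel)
    have hco := codeg_of_lab hσ hh (n := 3) (by decide +kernel)
    refine ⟨5, ?_, ?_, ?_, ?_, hdeg, hcl, ?_, ?_, ?_, ?_⟩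
    · omega
    · omega
    · omega
    · omega
    · exact fun f hf g hg h => (hco f hf g hg h).trans (by norm_num)
    · exact fun K hKF hK => cover_of_lt (by omega) hdeg hcl K hKF hK
    · exact fun A B => rich_of_okTable hσ hh (by norm_num) (by norm_num) okTable_9
    · exact fun _ _ _ _ _ _ => Or.inr hco
  · have hdeg := deg_of_lab hσ hh (n := 6) (by decide +kernel)
    have hcl := clique_of_lab hσ hh (by decide +kernel)
    have hco := codeg_of_lab hσ hh (n := 3) (by decide +kernel)
    refine ⟨6, ?_, ?_, ?_, ?_, hdeg, hcl, ?_, ?_, ?_, ?_⟩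
    · omega
    · omega
    · omega
    · omega
    · exact fun f hf g hg h => (hco f hf g hg h).trans (by norm_num)
    · exact fun K hKF hK => cover_of_lt (by omega) hdeg hcl K hKF hK
    · exact fun A B => rich_of_okTable hσ hh (by norm_num) (by norm_num) okTable_10
    · exact fun _ _ _ _ _ _ => Or.inr hco

lemma Inst.not_exc {s u : V} (hI : Inst G s) (hs : NoInst (Nat.card V)) (hu : u ∉ cn G s) :
    ¬ Exc G (G.neighborSet u) := by
  intro h
  obtain ⟨c, hc⟩ := h.exists_hub
  exact false_of_hub hI hs hu hc

end

/-- The number of ordered adjacent pairs in `X × Y`. -/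
noncomputable def ec {V : Type} (G : SimpleGraph V) (X Y : Set V) : ℕ :=
  {p : V × V | p.1 ∈ X ∧ p.2 ∈ Y ∧ G.Adj p.1 p.2}.ncard

section
variable {V : Type} [Finite V] {G : SimpleGraph V}

omit [Finite V] in
lemma ec_comm (X Y : Set V) : ec G X Y = ec G Y X := by
  unfold ec
  rw [← Set.ncard_image_of_injective _ Prod.swap_injective]
  congr 1
  ext ⟨a, b⟩
  simp only [Set.mem_image, Set.mem_ofPred_eq, Prod.exists, Prod.swap_prod_mk, Prod.mk.injEq]
  constructor
  · rintro ⟨c, d, ⟨h1, h2, h3⟩, rfl, rfl⟩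
    exact ⟨h2, h1, h3.symm⟩
  · rintro ⟨h1, h2, h3⟩
    exact ⟨b, a, ⟨h2, h1, h3.symm⟩, rfl, rfl⟩

lemma ec_mono {X X' Y Y' : Set V} (hX : X ⊆ X') (hY : Y ⊆ Y') : ec G X Y ≤ ec G X' Y' :=
  Set.ncard_le_ncard fun _ h => ⟨hX h.1, hY h.2.1, h.2.2⟩

lemma ec_union_left {X X' : Set V} (h : Disjoint X X') (Y : Set V) :
    ec G (X ∪ X') Y = ec G X Y + ec G X' Y := by
  unfold ec
  rw [← Set.ncard_union_eq]
  · congr 1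
    ext p
    simp only [Set.mem_union, Set.mem_ofPred_eq]
    tauto
  · rw [Set.disjoint_left] at h ⊢
    exact fun p hp hp' => h hp.1 hp'.1

lemma ec_union_right {Y Y' : Set V} (h : Disjoint Y Y') (X : Set V) :
    ec G X (Y ∪ Y') = ec G X Y + ec G X Y' := by
  rw [ec_comm, ec_union_left h, ec_comm Y, ec_comm Y']

omit [Finite V] in
lemma ec_singleton (x : V) (Y : Set V) : ec G {x} Y = (Y ∩ G.neighborSet x).ncard := by
  unfold ec
  rw [← Set.ncard_image_of_injective (Y ∩ G.neighborSet x) (Prod.mk_right_injective x)]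
  congr 1
  ext ⟨a, b⟩
  simp only [Set.mem_image, Set.mem_ofPred_eq, Set.mem_singleton_iff, Prod.mk.injEq,
    Set.mem_inter_iff, mem_neighborSet]
  constructor
  · rintro ⟨rfl, h2, h3⟩
    exact ⟨b, ⟨h2, h3⟩, rfl, rfl⟩
  · rintro ⟨c, ⟨h2, h3⟩, rfl, rfl⟩
    exact ⟨rfl, h2, h3⟩

omit [Finite V] in
lemma ec_empty (Y : Set V) : ec G ∅ Y = 0 := by simp [ec]

lemma mul_le_ec {n : ℕ} {X Y : Set V} (h : ∀ x ∈ X, n ≤ (Y ∩ G.neighborSet x).ncard) :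
    n * X.ncard ≤ ec G X Y := by
  induction X, X.toFinite using Set.Finite.induction_on with
  | empty => simp
  | @insert a X ha hX ih =>
    rw [Set.ncard_insert_of_notMem ha, Set.insert_eq, ec_union_left (by simpa using ha),
      ec_singleton]
    have h1 := ih fun x hx => h x (Set.mem_insert_of_mem _ hx)
    have h2 := h a (Set.mem_insert _ _)
    linarith

lemma ec_le_mul {n : ℕ} {X Y : Set V} (h : ∀ x ∈ X, (Y ∩ G.neighborSet x).ncard ≤ n) :
    ec G X Y ≤ n * X.ncard := by
  induction X, X.toFinite using Set.Finite.induction_on with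
  | empty => simp [ec_empty]
  | @insert a X ha hX ih =>
    rw [Set.ncard_insert_of_notMem ha, Set.insert_eq, ec_union_left (by simpa using ha),
      ec_singleton]
    have h1 := ih fun x hx => h x (Set.mem_insert_of_mem _ hx)
    have h2 := h a (Set.mem_insert _ _)
    linarith

/-- A vertex whose degree is at least that of a neighbor `u` is adjacent to a vertex outside the
closed neighborhood of `u` unless it is adjacent to all other neighbors of `u`. -/
lemma exists_adj_not_mem_cn {u f g : V} (huf : G.Adj u f) (hug : G.Adj u g) (hgf : g ≠ f)
    (hfg : ¬ G.Adj f g) (hd : (G.neighborSet u).ncard ≤ (G.neighborSet f).ncard) :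
    ∃ h ∉ cn G u, G.Adj f h := by
  by_contra! hcon
  have h1 : G.neighborSet f ⊆ insert u (G.neighborSet u \ {f, g}) := by
    intro v hv
    have hv' : v ∈ cn G u := by
      by_contra h
      exact hcon v h hv
    rcases hv' with rfl | hv'
    · exact Set.mem_insert _ _
    · refine Set.mem_insert_of_mem _ ⟨hv', ?_⟩
      rintro (rfl | rfl)
      · exact hv.ne rfl
      · exact hfg hv
  have h2 : ({f, g} : Set V) ⊆ G.neighborSet u := by
    rintro v (rfl | rfl)
    · exact huf
    · exact hug
  have h3 := Set.ncard_le_ncard h1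
  have h4 := Set.ncard_insert_le u (G.neighborSet u \ {f, g})
  have h5 := Set.ncard_sdiff_add_ncard_of_subset h2
  rw [Set.ncard_pair hgf.symm] at h5
  omega

lemma Inst.exists_low {s : V} (hI : Inst G s) (hs : NoInst (Nat.card V))
    (H : ∀ X : Set V, s ∉ X → 5 ≤ X.ncard → ec G X X + 38 ≤ 12 * X.ncard) :
    ∃ u ∉ cn G s, (G.neighborSet u).ncard ≤ 11 := by
  by_contra! hcon
  obtain ⟨w, hw⟩ := hI.far
  have hdis : Disjoint (cn G s)ᶜ (G.neighborSet s) := by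
    rw [Set.disjoint_left]
    exact fun v hv hv' => hv (Or.inr hv')
  have hX : ((cn G s)ᶜ ∪ G.neighborSet s) = {s}ᶜ := by
    ext v
    simp only [Set.mem_union, Set.mem_compl_iff, cn, Set.mem_ofPred_eq, mem_neighborSet,
      Set.mem_singleton_iff, not_or]
    constructor
    · rintro (h | h)
      · exact h.1
      · exact h.ne'
    · intro h
      by_cases h' : G.Adj s v
      · exact Or.inr h'
      · exact Or.inl ⟨h, h'⟩
  have hsub : ∀ u ∉ cn G s, G.neighborSet u ⊆ {s}ᶜ := by
    rintro u hu v hv rfl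
    exact hu (Or.inr hv.symm)
  have h1 : 12 * (cn G s)ᶜ.ncard ≤ ec G (cn G s)ᶜ {s}ᶜ := by
    refine mul_le_ec fun u hu => ?_
    rw [Set.inter_eq_right.2 (hsub u hu)]
    exact hcon u hu
  have h2 : 7 * (G.neighborSet s).ncard ≤ ec G (G.neighborSet s) {s}ᶜ := by
    refine mul_le_ec fun y hy => ?_
    obtain ⟨h, hh, hyh⟩ := exists_adj_far hI hs hy
    have h3 := hI.tri h y hh hyh.symm
    have h4 : h ∉ G.commonNeighbors h y := fun h' => h'.1.ne rfl
    have h5 : insert h (G.commonNeighbors h y) ⊆ {s}ᶜ ∩ G.neighborSet y := by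
      rintro v (rfl | hv)
      · exact ⟨fun h' => hh (Or.inl h'), hyh⟩
      · exact ⟨hsub h hh hv.1, hv.2⟩
    have h6 := Set.ncard_le_ncard h5
    rw [Set.ncard_insert_of_notMem h4] at h6
    omega
  have h3 := Set.ncard_union_eq hdis
  rw [hX] at h3
  have h4 := ec_union_left (G := G) hdis {s}ᶜ
  rw [hX] at h4
  have h5 := Set.ncard_le_ncard (hsub w hw)
  have h6 := hcon w hw
  have h7 := H {s}ᶜ (by simp) (by omega)
  have := hI.deg
  omega

end

section
variable {V : Type} [Finite V] {G : SimpleGraph V} {s u : V} {C : Set V}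

lemma ec_eq_add {a : V} {X : Set V} (ha : a ∈ X) (Y : Set V) :
    ec G X Y = (Y ∩ G.neighborSet a).ncard + ec G (X \ {a}) Y := by
  rw [← ec_singleton, ← ec_union_left Set.disjoint_sdiff_right, Set.union_sdiff_self,
    Set.union_eq_right.2 (by simpa using ha)]

omit [Finite V] in
lemma conn_cn (u : V) : Conn G (cn G u) := by
  refine ⟨⟨u, Or.inl rfl⟩, ?_⟩
  rintro T ⟨a, ha, haT⟩ ⟨b, hb, hbT⟩
  by_cases huT : u ∈ T
  · rcases hb with rfl | hb
    · exact absurd huT hbT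
    · exact ⟨u, Or.inl rfl, b, Or.inr hb, huT, hbT, hb⟩
  · rcases ha with rfl | ha
    · exact absurd haT huT
    · exact ⟨a, Or.inr ha, u, Or.inl rfl, haT, huT, ha.symm⟩

/-- A component of the graph without `cn G u` sends at least nineteen edges to it if its vertices
have large degree. -/
lemma nineteen_le_ec (hI : Inst G s) (hs : NoInst (Nat.card V)) (hu : u ∉ cn G s)
    (hlow : (G.neighborSet u).ncard ≤ 11) (hC : IsComp G (cn G u) C) (hsC : s ∉ C)
    (hdeg : ∀ d ∈ C, 12 ≤ (G.neighborSet d).ncard) : 19 ≤ ec G C (G.neighborSet u) := by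
  set F := G.neighborSet u with hF
  have hCs := hC.disjoint_cn hu hsC
  have huF : u ∉ F := fun h => G.loopless.irrefl u h
  have hCF : Disjoint C F := hC.2.1.mono_right fun v hv => Or.inr hv
  have huC : u ∉ C := fun h => Set.disjoint_left.1 hC.2.1 h (Or.inl rfl)
  have hCnbr : ∀ d ∈ C, ∀ v, G.Adj d v → v ∈ C ∨ v ∈ F := by
    intro d hd v hv
    by_cases h : v ∈ C
    · exact Or.inl h
    · exact Or.inr (hC.nbs_subset ⟨h, d, hd, hv⟩)
  have h8 := hC.eight_le hI hs hu hsC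
  have hSF : nbs G C ⊆ F := hC.nbs_subset
  have hedge : ∀ d ∈ C, ∀ f ∈ F, G.Adj d f →
      8 ≤ (C ∩ G.neighborSet f).ncard + (F ∩ G.neighborSet d).ncard := by
    intro d hd f hf hdf
    have h1 := hI.tri d f (fun h => Set.disjoint_left.1 hCs hd h) hdf
    have h2 : G.commonNeighbors d f ⊆
        ((C ∩ G.neighborSet f) \ {d}) ∪ ((F ∩ G.neighborSet d) \ {f}) := by
      intro v hv
      rcases hCnbr d hd v hv.1 with h | h
      · exact Or.inl ⟨⟨h, hv.2⟩, fun h' => hv.1.ne' h'⟩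
      · exact Or.inr ⟨⟨h, hv.1⟩, fun h' => hv.2.ne' h'⟩
    have h3 := (Set.ncard_le_ncard h2).trans (Set.ncard_union_le _ _)
    have h4 := Set.ncard_sdiff_singleton_add_one (s := C ∩ G.neighborSet f) ⟨hd, hdf.symm⟩
    have h5 := Set.ncard_sdiff_singleton_add_one (s := F ∩ G.neighborSet d) ⟨hf, hdf⟩
    omega
  have hpos : ∀ {A : Set V} {a b : V}, b ∈ A → G.Adj a b →
      1 ≤ (A ∩ G.neighborSet a).ncard := by
    intro A a b hb hab
    exact (Set.ncard_pos).2 ⟨b, hb, hab⟩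
  set B := {d | d ∈ C ∧ ∃ f ∈ F, G.Adj d f} with hB
  have hBC : B ⊆ C := fun d hd => hd.1
  have hBt : ∀ d ∈ B, 1 ≤ (F ∩ G.neighborSet d).ncard := by
    rintro d ⟨-, f, hf, hdf⟩
    exact hpos hf hdf
  have heB : ec G B F ≤ ec G C F := ec_mono hBC le_rfl
  have heS : ec G (nbs G C) C ≤ ec G C F := by
    rw [ec_comm]
    exact ec_mono le_rfl hSF
  have hne : ∃ f, f ∈ F := by
    have : 0 < (nbs G C).ncard := by omega
    obtain ⟨f, hf⟩ := Set.nonempty_of_ncard_ne_zero this.ne'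
    exact ⟨f, hSF hf⟩
  by_contra! hlt
  rcases Nat.lt_or_ge B.ncard 8 with hb | hb
  · have hCB : C = B := by
      by_contra hCB
      have hDne : (C \ B).Nonempty := by
        rw [Set.nonempty_iff_ne_empty]
        intro h
        exact hCB (Set.Subset.antisymm (Set.sdiff_eq_empty.1 h) hBC)
      have hnD : nbs G (C \ B) ⊆ B := by
        rintro v ⟨hv, d, hd, hdv⟩
        rcases hCnbr d hd.1 v hdv with h | h
        · by_contra h'
          exact hv ⟨h, h'⟩
        · exact absurd ⟨hd.1, v, h, hdv⟩ hd.2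
      obtain ⟨f, hf⟩ := hne
      have hnot : ∀ v ∈ cn G u, v ∉ C \ B ∪ nbs G (C \ B) := by
        rintro v hv (h | h)
        · exact Set.disjoint_left.1 hC.2.1 h.1 hv
        · exact Set.disjoint_left.1 hC.2.1 (hnD h).1 hv
      have := eight_le_ncard_nbs hI hs (D := C \ B) (E := cn G u) hDne
        (hCs.mono_left Set.sdiff_subset) (conn_cn u)
        (hC.2.1.symm.mono_right Set.sdiff_subset) (hC.2.1.symm.mono_right (hnD.trans hBC))
        (fun b hb => by
          obtain ⟨-, f, hf, hbf⟩ := hnD hb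
          exact ⟨f, Or.inr hf, hbf⟩) (p := u) (q := f) hf.ne
        (hnot u (Or.inl rfl)) (hnot f (Or.inr hf))
      have := Set.ncard_le_ncard hnD
      omega
    have ht : ∀ d ∈ C, 13 - B.ncard ≤ (F ∩ G.neighborSet d).ncard := by
      intro d hd
      have h1 : G.neighborSet d ⊆ (C \ {d}) ∪ (F ∩ G.neighborSet d) := by
        intro v hv
        rcases hCnbr d hd v hv with h | h
        · exact Or.inl ⟨h, fun h' => hv.ne' h'⟩
        · exact Or.inr ⟨h, hv⟩
      have h2 := (Set.ncard_le_ncard h1).trans (Set.ncard_union_le _ _)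
      have h3 := Set.ncard_sdiff_singleton_add_one hd
      have h4 := hdeg d hd
      rw [← hCB]
      omega
    have h1 := mul_le_ec ht
    obtain ⟨d, hd⟩ : C.Nonempty := hC.1.1
    have h2 := ht d hd
    have h3 := Set.ncard_le_ncard (Set.inter_subset_left (s := F) (t := G.neighborSet d))
    rw [hCB] at h1
    rw [hCB] at hlt
    generalize B.ncard = b at *
    interval_cases b <;> omega
  · by_cases h2 : ∀ f ∈ nbs G C, 2 ≤ (C ∩ G.neighborSet f).ncard
    · obtain ⟨f, hf, hf3⟩ : ∃ f ∈ nbs G C, (C ∩ G.neighborSet f).ncard < 3 := by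
        by_contra! hcon
        have := mul_le_ec hcon
        omega
      obtain ⟨d1, d2, hne12, hd12⟩ := Set.ncard_eq_two.1 (le_antisymm (Nat.lt_succ_iff.1 hf3) (h2 f hf))
      have hd1 : d1 ∈ C ∩ G.neighborSet f := by rw [hd12]; exact Or.inl rfl
      have hd2 : d2 ∈ C ∩ G.neighborSet f := by rw [hd12]; exact Or.inr rfl
      have ht1 := hedge d1 hd1.1 f (hSF hf) hd1.2.symm
      have ht2 := hedge d2 hd2.1 f (hSF hf) hd2.2.symm
      have hB1 : d1 ∈ B := ⟨hd1.1, f, hSF hf, hd1.2.symm⟩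
      have hB2 : d2 ∈ B \ {d1} := ⟨⟨hd2.1, f, hSF hf, hd2.2.symm⟩, fun h => hne12 h.symm⟩
      have he1 := ec_eq_add (G := G) hB1 F
      have he2 := ec_eq_add (G := G) hB2 F
      have hn1 := Set.ncard_sdiff_singleton_add_one hB1
      have hn2 := Set.ncard_sdiff_singleton_add_one hB2
      obtain ⟨d3, hd3, ht3⟩ : ∃ d ∈ (B \ {d1}) \ {d2}, (F ∩ G.neighborSet d).ncard < 2 := by
        by_contra! hcon
        have := mul_le_ec hcon
        omega
      obtain ⟨hd3C, g, hg, hdg⟩ := hd3.1.1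
      have hgS : g ∈ nbs G C := ⟨fun h => Set.disjoint_left.1 hCF h hg, d3, hd3C, hdg⟩
      have hc3 := hedge d3 hd3C g hg hdg
      have he3 := ec_eq_add (G := G) hgS C
      have hn3 := Set.ncard_sdiff_singleton_add_one hgS
      have he4 := mul_le_ec (X := nbs G C \ {g}) (n := 2) fun f hf => h2 f hf.1
      omega
    · push Not at h2
      obtain ⟨f0, hf0, hc0⟩ := h2
      obtain ⟨hf0C, d0, hd0, hdf0⟩ := hf0
      have hf0F : f0 ∈ F := hSF ⟨hf0C, d0, hd0, hdf0⟩
      have honly : ∀ d ∈ C, G.Adj d f0 → d = d0 := by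
        intro d hd hdf
        by_contra hne
        have h1 : ({d, d0} : Set V) ⊆ C ∩ G.neighborSet f0 := by
          rintro v (rfl | rfl)
          · exact ⟨hd, hdf.symm⟩
          · exact ⟨hd0, hdf0.symm⟩
        have h2 := Set.ncard_le_ncard h1
        rw [Set.ncard_pair hne] at h2
        omega
      have ht0 := hedge d0 hd0 f0 hf0F hdf0
      have hB0 : d0 ∈ B := ⟨hd0, f0, hf0F, hdf0⟩
      have he0 := ec_eq_add (G := G) hB0 F
      have hn0 := Set.ncard_sdiff_singleton_add_one hB0
      have hother : ∀ d ∈ B \ {d0}, (F ∩ G.neighborSet d).ncard < 6 := by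
        by_contra! hcon
        obtain ⟨d1, hd1, ht1⟩ := hcon
        have he1 := ec_eq_add (G := G) hd1 F
        have hn1 := Set.ncard_sdiff_singleton_add_one hd1
        have he2 := mul_le_ec (X := (B \ {d0}) \ {d1}) (n := 1) fun d hd => hBt d hd.1.1
        omega
      set S' := {f | f ∈ F ∧ ∃ d ∈ C \ {d0}, G.Adj d f} with hS'
      have heS' : ec G S' C ≤ ec G C F := by
        rw [ec_comm]
        exact ec_mono le_rfl fun f hf => hf.1
      have h3 : ∀ f ∈ S', 3 ≤ (C ∩ G.neighborSet f).ncard := by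
        rintro f ⟨hf, d, hd, hdf⟩
        have h1 := hother d ⟨⟨hd.1, f, hf, hdf⟩, hd.2⟩
        have h2 := hedge d hd.1 f hf hdf
        omega
      have h4 := mul_le_ec h3
      have hnD : nbs G (C \ {d0}) ⊆ insert d0 S' := by
        rintro v ⟨hv, d, hd, hdv⟩
        rcases hCnbr d hd.1 v hdv with h | h
        · refine Or.inl ?_
          by_contra h'
          exact hv ⟨h, h'⟩
        · exact Or.inr ⟨h, d, hd, hdv⟩
      have hDne : (C \ {d0}).Nonempty := by
        refine (Set.nonempty_of_ncard_ne_zero (s := B \ {d0}) (by omega)).mono ?_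
        exact Set.sdiff_subset_sdiff_left hBC
      have hunot : u ∉ C \ {d0} ∪ nbs G (C \ {d0}) := by
        rintro (h | h)
        · exact huC h.1
        · rcases hnD h with rfl | h
          · exact huC hd0
          · exact huF h.1
      have hfnot : f0 ∉ C \ {d0} ∪ nbs G (C \ {d0}) := by
        rintro (h | h)
        · exact hf0C h.1
        · obtain ⟨-, d, hd, hdf⟩ := h
          exact hd.2 (honly d hd.1 hdf)
      have h5 := eight_le_ncard_nbs hI hs (D := C \ {d0}) (E := {u, f0}) hDne
        (hCs.mono_left Set.sdiff_subset) (conn_pair hf0F)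
        (by
          rw [Set.disjoint_left]
          rintro v (rfl | rfl) h
          · exact hunot (Or.inl h)
          · exact hfnot (Or.inl h))
        (by
          rw [Set.disjoint_left]
          rintro v (rfl | rfl) h
          · exact hunot (Or.inr h)
          · exact hfnot (Or.inr h))
        (fun b hb => by
          rcases hnD hb with rfl | h
          · exact ⟨f0, Or.inr rfl, hdf0⟩
          · exact ⟨u, Or.inl rfl, h.1.symm⟩) (p := u) (q := f0) hf0F.ne hunot hfnot
      have h6 := (Set.ncard_le_ncard hnD).trans (Set.ncard_insert_le _ _)
      omega

end

section
variable {V : Type} [Finite V] {G : SimpleGraph V} {s u : V} {C : Set V}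

lemma exists_low_of_isComp (hI : Inst G s) (hs : NoInst (Nat.card V))
    (H : ∀ X : Set V, s ∉ X → 5 ≤ X.ncard → ec G X X + 38 ≤ 12 * X.ncard) (hu : u ∉ cn G s)
    (hlow : (G.neighborSet u).ncard ≤ 11) (hC : IsComp G (cn G u) C) (hsC : s ∉ C) :
    ∃ d ∈ C, (G.neighborSet d).ncard ≤ 11 := by
  by_contra! hdeg
  have h19 := nineteen_le_ec hI hs hu hlow hC hsC hdeg
  have hcn : (cn G u).ncard = (G.neighborSet u).ncard + 1 := by
    have huF : u ∉ G.neighborSet u := fun h => G.loopless.irrefl u h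
    rw [← Set.ncard_insert_of_notMem huF]
    rfl
  have hX := Set.ncard_union_eq hC.2.1
  have h7 := hI.seven_le hu
  have hbound := H (C ∪ cn G u) (by
    rintro (h | h)
    · exact hsC h
    · exact not_mem_cn_comm hu h) (by omega)
  have h1 : 12 * C.ncard ≤ ec G C (C ∪ cn G u) := by
    refine mul_le_ec fun d hd => ?_
    rw [Set.inter_eq_right.2]
    · exact hdeg d hd
    · intro v hv
      by_cases h : v ∈ C
      · exact Or.inl h
      · exact Or.inr (hC.2.2 ⟨h, d, hd, hv⟩)
  have h2 : 7 * (G.neighborSet u).ncard ≤ ec G (G.neighborSet u) (cn G u) := by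
    refine mul_le_ec fun f hf => ?_
    have h3 := hI.tri u f hu hf
    have h4 : insert u (G.commonNeighbors u f) ⊆ cn G u ∩ G.neighborSet f := by
      rintro v (rfl | hv)
      · exact ⟨Or.inl rfl, hf.symm⟩
      · exact ⟨Or.inr hv.1, hv.2⟩
    have h5 := Set.ncard_le_ncard h4
    rw [Set.ncard_insert_of_notMem (fun h => G.loopless.irrefl u h.1)] at h5
    omega
  have h3 : ec G {u} (cn G u) = (G.neighborSet u).ncard := by
    have hsub : G.neighborSet u ⊆ cn G u := fun v hv => Or.inr hv
    rw [ec_singleton, Set.inter_eq_right.2 hsub]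
  have h4 : ec G (cn G u) (C ∪ cn G u) = ec G (cn G u) C +
      (ec G {u} (cn G u) + ec G (G.neighborSet u) (cn G u)) := by
    have hdis : Disjoint {u} (G.neighborSet u) :=
      Set.disjoint_singleton_left.2 fun h => G.loopless.irrefl u h
    rw [ec_union_right hC.2.1, ← ec_union_left hdis]
    rfl
  have h5 : ec G C (G.neighborSet u) ≤ ec G (cn G u) C := by
    rw [ec_comm]
    exact ec_mono (fun v hv => Or.inr hv) le_rfl
  have h6 := ec_union_left (G := G) hC.2.1 (C ∪ cn G u)
  omega

/-- There is no instance on a vertex set all of whose subsets are sparse, provided that there is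
none on fewer vertices. -/
theorem false_of_inst (hI : Inst G s) (hs : NoInst (Nat.card V))
    (H : ∀ X : Set V, s ∉ X → 5 ≤ X.ncard → ec G X X + 38 ≤ 12 * X.ncard) : False := by
  have hex := hI.exists_low hs H
  by_cases hA : ∃ C, ∃ u ∉ cn G s, (G.neighborSet u).ncard ≤ 11 ∧ IsComp G (cn G u) C ∧ s ∉ C
  · obtain ⟨C, ⟨u, hu, hlow, hC, hsC⟩, hmin⟩ := exists_minimal_set _ hA
    obtain ⟨d, hd, hdlow⟩ := exists_low_of_isComp hI hs H hu hlow hC hsC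
    obtain ⟨w, hw, hwmin⟩ := Set.exists_min_image C (fun v => (G.neighborSet v).ncard)
      C.toFinite ⟨d, hd⟩
    have hwlow := (hwmin d hd).trans hdlow
    have hCs := hC.disjoint_cn hu hsC
    have hws : w ∉ cn G s := fun h => Set.disjoint_left.1 hCs hw h
    have huw : u ∉ cn G w := not_mem_cn_comm fun h => Set.disjoint_left.1 hC.2.1 hw h
    obtain ⟨K, hK, huK⟩ := exists_isComp (G := G) huw
    refine hI.not_exc hs hws (exc_of_attached hI hws hwlow hK.1 hK.2.1 ?_)
    rintro f hf ⟨g, hg, hgf, hfg⟩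
    by_cases hfC : f ∈ C
    · obtain ⟨h, hh, hfh⟩ := exists_adj_not_mem_cn hf hg hgf hfg (hwmin f hfC)
      obtain ⟨J, hJ, hhJ⟩ := exists_isComp (G := G) hh
      suffices huJ : u ∈ J by
        have := hK.eq_of_inter hJ ⟨u, huK, huJ⟩
        subst this
        exact ⟨h, hhJ, hfh⟩
      by_contra huJ
      have hJu : ∀ v ∈ J, v ∉ cn G u := by
        rintro v hv (rfl | h')
        · exact huJ hv
        · exact huJ (hJ.mem_of_adj hv h'.symm huw)
      have hhC : h ∈ C := hC.mem_of_adj hfC hfh (hJu h hhJ)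
      have hJC : J ⊆ C := hC.subset_of_conn hJ.1
        (Set.disjoint_left.2 hJu) ⟨h, hhJ, hhC⟩
      refine hmin J hJC ?_ ⟨w, hws, hwlow, hJ, fun h => hsC (hJC h)⟩
      rintro rfl
      exact Set.disjoint_left.1 hJ.2.1 hw (Or.inl rfl)
    · have : f ∈ G.neighborSet u := hC.nbs_subset ⟨hfC, w, hw, hf⟩
      exact ⟨u, huK, this.symm⟩
  · push Not at hA
    obtain ⟨u, ⟨hu, hlow⟩, humin⟩ := Set.exists_min_image
      {u | u ∉ cn G s ∧ (G.neighborSet u).ncard ≤ 11} (fun v => (G.neighborSet v).ncard)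
      (Set.toFinite _) (by
        obtain ⟨u, hu, hlow⟩ := hex
        exact ⟨u, hu, hlow⟩)
    obtain ⟨C, hC, hsC⟩ := exists_isComp (G := G) (not_mem_cn_comm hu)
    refine hI.not_exc hs hu (exc_of_attached hI hu hlow hC.1 hC.2.1 ?_)
    rintro f hf ⟨g, hg, hgf, hfg⟩
    by_cases hfs : f ∈ cn G s
    · rcases hfs with rfl | hfs
      · exact absurd (Or.inr hf.symm) hu
      · exact ⟨s, hsC, hfs.symm⟩
    · have hd : (G.neighborSet u).ncard ≤ (G.neighborSet f).ncard := by
        by_cases h : (G.neighborSet f).ncard ≤ 11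
        · exact humin f ⟨hfs, h⟩
        · omega
      obtain ⟨h, hh, hfh⟩ := exists_adj_not_mem_cn hf hg hgf hfg hd
      obtain ⟨J, hJ, hhJ⟩ := exists_isComp (G := G) hh
      have := hC.eq_of_inter hJ ⟨s, hsC, hA J u hu hlow hJ⟩
      subst this
      exact ⟨h, hhJ, hfh⟩

end

/-- Graphs on `m` vertices without a `K_8` minor have at most `6 m - 20` edges. -/
def Sparse (m : ℕ) : Prop :=
  ∀ (V : Type) [Finite V] (G : SimpleGraph V), Nat.card V = m → 5 ≤ m →
    ¬ (⊤ : SimpleGraph (Fin 8)).MinorOf G → ec G Set.univ Set.univ + 40 ≤ 12 * m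

section
variable {V : Type} {G : SimpleGraph V}

lemma ec_congr {W : Type} {H : SimpleGraph W} {X Y : Set W} {X' Y' : Set V} (φ : W → V)
    (hφ : Function.Injective φ) (hX : ∀ v, v ∈ X' ↔ ∃ w ∈ X, φ w = v)
    (hY : ∀ v, v ∈ Y' ↔ ∃ w ∈ Y, φ w = v)
    (h : ∀ x ∈ X, ∀ y ∈ Y, H.Adj x y ↔ G.Adj (φ x) (φ y)) : ec H X Y = ec G X' Y' := by
  unfold ec
  rw [← Set.ncard_image_of_injective _ (Function.Injective.prodMap hφ hφ)]
  congr 1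
  ext ⟨a, b⟩
  simp only [Set.mem_image, Set.mem_ofPred_eq, Prod.exists, Prod.map_apply, Prod.mk.injEq]
  constructor
  · rintro ⟨x, y, ⟨hx, hy, hxy⟩, rfl, rfl⟩
    exact ⟨(hX _).2 ⟨x, hx, rfl⟩, (hY _).2 ⟨y, hy, rfl⟩, (h x hx y hy).1 hxy⟩
  · rintro ⟨ha, hb, hab⟩
    obtain ⟨x, hx, rfl⟩ := (hX a).1 ha
    obtain ⟨y, hy, rfl⟩ := (hY b).1 hb
    exact ⟨x, y, ⟨hx, hy, (h x hx y hy).2 hab⟩, rfl, rfl⟩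

variable [Finite V]

lemma Sparse.set_bound {X : Set V} (h : Sparse X.ncard) (h5 : 5 ≤ X.ncard)
    (hfree : ¬ (⊤ : SimpleGraph (Fin 8)).MinorOf (G.induce X)) :
    ec G X X + 40 ≤ 12 * X.ncard := by
  have h1 := h X (G.induce X) (Nat.card_coe_set_eq X) h5 hfree
  rwa [ec_congr (G := G) (X' := X) (Y' := X) Subtype.val Subtype.val_injective (by simp) (by simp)
    (by simp)] at h1

lemma ec_insert {a : V} {Y : Set V} (ha : a ∉ Y) :
    ec G (insert a Y) (insert a Y) = 2 * (Y ∩ G.neighborSet a).ncard + ec G Y Y := by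
  have hdis : Disjoint {a} Y := Set.disjoint_singleton_left.2 ha
  have h0 : ({a} : Set V) ∩ G.neighborSet a = ∅ := by
    ext v
    simp only [Set.mem_inter_iff, Set.mem_singleton_iff, mem_neighborSet, Set.mem_empty_iff_false,
      iff_false]
    rintro ⟨rfl, h⟩
    exact h.ne rfl
  rw [Set.insert_eq, ec_union_left hdis, ec_union_right hdis, ec_union_right hdis, ec_singleton,
    ec_singleton, ec_comm Y {a}, ec_singleton, h0, Set.ncard_empty]
  ring

lemma seven_le_of_sparse {v : V} (hsp : ∀ m < Nat.card V, Sparse m)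
    (hfree : ¬ (⊤ : SimpleGraph (Fin 8)).MinorOf G) (h6 : 6 ≤ Nat.card V)
    (hlt : 12 * Nat.card V < ec G Set.univ Set.univ + 40) : 7 ≤ (G.neighborSet v).ncard := by
  have huniv : (Set.univ : Set V) = insert v {v}ᶜ := by
    rw [Set.insert_eq, Set.union_compl_self]
  have hc : ({v}ᶜ : Set V).ncard + 1 = Nat.card V := by
    rw [← Set.ncard_univ, huniv, Set.ncard_insert_of_notMem (by simp)]
  have h1 := (hsp _ (by omega)).set_bound (G := G) (X := {v}ᶜ) (by omega)
    fun h => hfree (minorOf_induce h)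
  have h2 : {v}ᶜ ∩ G.neighborSet v = G.neighborSet v := by
    refine Set.inter_eq_right.2 fun w hw => ?_
    exact fun h => hw.ne' h
  rw [huniv, ec_insert (by simp), h2] at hlt
  omega

/-- Identify `v` with `u`. -/
def contract (G : SimpleGraph V) (u v : V) : SimpleGraph V where
  Adj a b := G.Adj a b ∨ (a = u ∧ b ≠ u ∧ G.Adj v b) ∨ (b = u ∧ a ≠ u ∧ G.Adj v a)
  symm := ⟨by
    rintro a b (h | h | h)
    · exact Or.inl h.symm
    · exact Or.inr (Or.inr h)
    · exact Or.inr (Or.inl h)⟩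
  loopless := ⟨by
    rintro a (h | h | h)
    · exact h.ne rfl
    · exact h.2.1 h.1
    · exact h.2.1 h.1⟩

omit [Finite V] in
lemma contract_minor {u v : V} (huv : G.Adj u v) {U : Type} {K : SimpleGraph U}
    (h : K.MinorOf ((contract G u v).induce {v}ᶜ)) : K.MinorOf G := by
  refine minorOf_trans (fun w : ({v}ᶜ : Set V) => {x | x = w.1 ∨ (w.1 = u ∧ x = v)}) ?_ ?_ ?_ h
  · rintro ⟨w, hw⟩
    by_cases hwu : w = u
    · subst hwu
      convert conn_pair huv using 1
      ext x
      simp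
    · convert conn_singleton (G := G) w using 1
      ext x
      simp [hwu]
  · rintro ⟨a, ha⟩ ⟨b, hb⟩ hab
    rw [ne_eq, Subtype.mk.injEq] at hab
    rw [Set.disjoint_left]
    rintro x (rfl | ⟨rfl, rfl⟩) (hx | ⟨hx, hx'⟩)
    · exact hab hx
    · exact ha hx'
    · exact hb hx.symm
    · exact hab hx.symm
  · rintro ⟨a, ha⟩ ⟨b, hb⟩ hab
    rcases (hab : (contract G u v).Adj a b) with h | ⟨h1, -, h⟩ | ⟨h1, -, h⟩
    · exact ⟨a, Or.inl rfl, b, Or.inl rfl, h⟩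
    · exact ⟨v, Or.inr ⟨h1, rfl⟩, b, Or.inl rfl, h⟩
    · exact ⟨a, Or.inl rfl, v, Or.inr ⟨h1, rfl⟩, h.symm⟩

lemma six_le_of_sparse {u v : V} (huv : G.Adj u v) (hsp : ∀ m < Nat.card V, Sparse m)
    (hfree : ¬ (⊤ : SimpleGraph (Fin 8)).MinorOf G) (h6 : 6 ≤ Nat.card V)
    (hlt : 12 * Nat.card V < ec G Set.univ Set.univ + 40) :
    6 ≤ (G.commonNeighbors u v).ncard := by
  have huniv : (Set.univ : Set V) = insert v {v}ᶜ := by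
    rw [Set.insert_eq, Set.union_compl_self]
  have hc : ({v}ᶜ : Set V).ncard + 1 = Nat.card V := by
    rw [← Set.ncard_univ, huniv, Set.ncard_insert_of_notMem (by simp)]
  set Y : Set V := {u, v}ᶜ with hY
  have huY : u ∉ Y := by simp [hY]
  have hX : ({v}ᶜ : Set V) = insert u Y := by
    ext x
    simp only [hY, Set.mem_compl_iff, Set.mem_singleton_iff, Set.mem_insert_iff, not_or]
    by_cases hx : x = u
    · subst hx
      simp [huv.ne]
    · simp [hx]
  have h1 := (hsp _ (by omega)).set_bound (G := contract G u v) (X := {v}ᶜ) (by omega)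
    fun h => hfree (contract_minor huv h)
  have h2 : {v}ᶜ ∩ G.neighborSet v = insert u (Y ∩ G.neighborSet v) := by
    ext x
    rw [hX]
    simp only [Set.mem_inter_iff, Set.mem_insert_iff, mem_neighborSet]
    constructor
    · rintro ⟨rfl | h, h'⟩
      · exact Or.inl rfl
      · exact Or.inr ⟨h, h'⟩
    · rintro (rfl | ⟨h, h'⟩)
      · exact ⟨Or.inl rfl, huv.symm⟩
      · exact ⟨Or.inr h, h'⟩
  rw [huniv, ec_insert (by simp), h2, Set.ncard_insert_of_notMem fun h => huY h.1, hX,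
    ec_insert huY] at hlt
  rw [hX, ec_insert huY] at h1
  rw [hX] at hc
  have h3 : Y ∩ (contract G u v).neighborSet u = Y ∩ G.neighborSet u ∪ Y ∩ G.neighborSet v := by
    ext x
    have hxu : x ∈ Y → x ≠ u := fun h h' => huY (h' ▸ h)
    simp only [Set.mem_inter_iff, mem_neighborSet, contract, Set.mem_union]
    tauto
  have h4 : (Y ∩ G.neighborSet u) ∩ (Y ∩ G.neighborSet v) = G.commonNeighbors u v := by
    ext x
    simp only [Set.mem_inter_iff, hY, Set.mem_compl_iff, Set.mem_insert_iff,
      Set.mem_singleton_iff, not_or]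
    constructor
    · rintro ⟨h, h'⟩
      exact ⟨h.2, h'.2⟩
    · rintro ⟨h, h'⟩
      exact ⟨⟨⟨h.ne', h'.ne'⟩, h⟩, ⟨h.ne', h'.ne'⟩, h'⟩
  have h5 := Set.ncard_union_add_ncard_inter (Y ∩ G.neighborSet u) (Y ∩ G.neighborSet v)
  rw [h4, ← h3] at h5
  have h6 : ec (contract G u v) Y Y = ec G Y Y := by
    refine ec_congr id Function.injective_id (by simp) (by simp) ?_
    intro x hx y hy
    have hxu : x ≠ u := fun h' => huY (h' ▸ hx)
    have hyu : y ≠ u := fun h' => huY (h' ▸ hy)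
    simp [contract, hxu, hyu]
  omega

end

section
variable {V : Type} {G : SimpleGraph V}

/-- The graph `G` with an additional isolated vertex. -/
def addIsolated (G : SimpleGraph V) : SimpleGraph (Option V) := G.map Function.Embedding.some

lemma not_adj_none (x : Option V) : ¬ (addIsolated G).Adj none x := by
  rintro ⟨-, a, b, -, h, -⟩
  exact absurd h (by simp)

lemma adj_some_some {a b : V} : (addIsolated G).Adj (some a) (some b) ↔ G.Adj a b :=
  SimpleGraph.map_adj_apply

lemma adj_some {a : V} {y : Option V} (h : (addIsolated G).Adj (some a) y) :
    ∃ b, y = some b ∧ G.Adj a b := by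
  cases y with
  | none => exact absurd h.symm (not_adj_none _)
  | some b => exact ⟨b, rfl, adj_some_some.1 h⟩

lemma minorOf_of_addIsolated
    (h : (⊤ : SimpleGraph (Fin 8)).MinorOf (addIsolated G)) :
    (⊤ : SimpleGraph (Fin 8)).MinorOf G := by
  obtain ⟨f, -, hc, hd, ht⟩ := h
  have hnone : ∀ w, none ∉ f w := by
    intro w hw
    obtain ⟨w', hw'⟩ := exists_ne w
    obtain ⟨x, hx, y, hy, hxy⟩ := ht w w' hw'.symm
    obtain ⟨a, -, b, -, ha, -, hab⟩ := (conn_of_connected (hc w)).2 {none} ⟨none, hw, rfl⟩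
      ⟨x, hx, by rintro rfl; exact not_adj_none _ hxy⟩
    rw [Set.mem_singleton_iff.1 ha] at hab
    exact not_adj_none _ hab
  have hex : ∀ w, ∀ x ∈ f w, ∃ a, x = some a := by
    intro w x hx
    cases x with
    | none => exact absurd hx (hnone w)
    | some a => exact ⟨a, rfl⟩
  refine minorOf_of_conn (fun w => some ⁻¹' f w) ?_ ?_ ?_
  · intro w
    have hw := conn_of_connected (hc w)
    constructor
    · obtain ⟨x, hx⟩ := hw.1
      obtain ⟨a, rfl⟩ := hex w x hx
      exact ⟨a, hx⟩
    · rintro T ⟨a, ha, haT⟩ ⟨b, hb, hbT⟩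
      obtain ⟨x, hx, y, hy, hxT, hyT, hxy⟩ := hw.2 (some '' T) ⟨some a, ha, a, haT, rfl⟩
        ⟨some b, hb, by
          rintro ⟨c, hc, hcb⟩
          exact hbT (Option.some.inj hcb ▸ hc)⟩
      obtain ⟨c, hcT, rfl⟩ := hxT
      obtain ⟨d, rfl, hcd⟩ := adj_some hxy
      exact ⟨c, hx, d, hy, hcT, fun h => hyT ⟨d, h, rfl⟩, hcd⟩
  · intro w w' hw
    have := hd w w' hw
    rw [Set.disjoint_left] at this ⊢
    exact fun a ha ha' => this ha ha'
  · intro w w' hw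
    obtain ⟨x, hx, y, hy, hxy⟩ := ht w w' hw
    obtain ⟨a, rfl⟩ := hex w x hx
    obtain ⟨b, rfl, hab⟩ := adj_some hxy
    exact ⟨a, hx, b, hy, hab⟩

lemma nonempty_embedding_of_addIsolated (φ : K22222 ↪g addIsolated G) :
    Nonempty (K22222 ↪g G) := by
  have hex : ∀ w, ∃ a, some a = φ w := by
    intro w
    obtain ⟨w', hw'⟩ : ∃ w', K22222.Adj w w' := by
      have h : (K22222.neighborSet w).ncard ≠ 0 := by
        rw [K22222_degree]
        norm_num
      exact Set.nonempty_of_ncard_ne_zero h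
    have h := φ.map_rel_iff.2 hw'
    cases hw : φ w with
    | none =>
      rw [hw] at h
      exact absurd h (not_adj_none _)
    | some a => exact ⟨a, rfl⟩
  choose ψ hψ using hex
  refine ⟨⟨⟨ψ, ?_⟩, ?_⟩⟩
  · intro w w' hw
    apply φ.injective
    rw [← hψ, ← hψ, hw]
  · intro w w'
    change G.Adj (ψ w) (ψ w') ↔ _
    rw [← adj_some_some, hψ, hψ]
    exact φ.map_rel_iff

variable [Finite V]

lemma inst_addIsolated (hfree : ¬ (⊤ : SimpleGraph (Fin 8)).MinorOf G)
    (hK : IsEmpty (K22222 ↪g G)) (v : V) (h7 : ∀ v, 7 ≤ (G.neighborSet v).ncard)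
    (h6 : ∀ u v, G.Adj u v → 6 ≤ (G.commonNeighbors u v).ncard) :
    Inst (addIsolated G) none where
  free h := hfree (minorOf_of_addIsolated h)
  noK := ⟨fun φ => (nonempty_embedding_of_addIsolated φ).elim hK.elim⟩
  deg := by
    have : (addIsolated G).neighborSet none = ∅ := by
      ext x
      simpa using not_adj_none x
    simp [this]
  far := ⟨some v, by
    rintro (h | h)
    · exact absurd h (by simp)
    · exact not_adj_none _ h⟩
  tri := by
    intro x y hx hxy
    cases x with
    | none => exact absurd (Or.inl rfl) hx
    | some a =>
      obtain ⟨b, rfl, hab⟩ := adj_some hxy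
      refine (h6 a b hab).trans ?_
      rw [← Set.ncard_image_of_injective _ (Option.some_injective V)]
      refine Set.ncard_le_ncard ?_
      rintro _ ⟨c, hc, rfl⟩
      exact ⟨adj_some_some.2 hc.1, adj_some_some.2 hc.2⟩
  nbr := by
    intro x hx
    cases x with
    | none => exact absurd (Or.inl rfl) hx
    | some a =>
      have h := h7 a
      obtain ⟨b, hb⟩ := Set.nonempty_of_ncard_ne_zero (s := G.neighborSet a) (by omega)
      exact ⟨some b, adj_some_some.2 hb⟩

lemma nonempty_embedding_of_sparse (hsp : ∀ m < Nat.card V, Sparse m)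
    (hno : NoInst (Nat.card V + 1)) (hfree : ¬ (⊤ : SimpleGraph (Fin 8)).MinorOf G)
    (h6 : 6 ≤ Nat.card V) (hlt : 12 * Nat.card V < ec G Set.univ Set.univ + 40)
    (hle : ec G Set.univ Set.univ + 38 ≤ 12 * Nat.card V) : Nonempty (K22222 ↪g G) := by
  by_contra hK
  rw [not_nonempty_iff] at hK
  have : Nonempty V := (Nat.card_pos_iff.1 (by omega)).1
  have hI := inst_addIsolated hfree hK (Classical.arbitrary V)
    (fun v => seven_le_of_sparse hsp hfree h6 hlt)
    fun u v huv => six_le_of_sparse huv hsp hfree h6 hlt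
  refine false_of_inst hI (by rwa [Finite.card_option]) fun X hX h5 => ?_
  have hXY : some '' (some ⁻¹' X) = X := by
    refine Set.image_preimage_eq_of_subset fun x hx => ?_
    cases x with
    | none => exact absurd hx hX
    | some a => exact ⟨a, rfl⟩
  set Y : Set V := some ⁻¹' X with hY
  have hc : Y.ncard = X.ncard := by
    rw [← hXY, Set.ncard_image_of_injective _ (Option.some_injective V)]
  have he : ec G Y Y = ec (addIsolated G) X X :=
    ec_congr some (Option.some_injective V) (fun v => by rw [← hXY]; rfl)
      (fun v => by rw [← hXY]; rfl) fun x _ y _ => adj_some_some.symm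
  rw [← he, ← hc]
  by_cases hu : Y = Set.univ
  · rwa [hu, Set.ncard_univ]
  · have h1 : Y.ncard < Nat.card V := by
      rw [← Set.ncard_univ]
      exact Set.ncard_lt_ncard (Set.ssubset_univ_iff.2 hu)
    have h2 := (hsp _ h1).set_bound (G := G) (by omega) fun h => hfree (minorOf_induce h)
    omega

end

/-- Labels of eight branch sets in `K_{2,2,2,2,2}` plus an edge. -/
def bagLabel : Fin 5 × Fin 2 → Fin 8
  | (0, 0) => 0
  | (0, 1) => 1
  | (1, 0) => 2
  | (2, 0) => 3
  | (3, 0) => 4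
  | (4, 0) => 5
  | (1, 1) => 6
  | (2, 1) => 6
  | (3, 1) => 7
  | (4, 1) => 7

section
variable {V : Type} {G : SimpleGraph V} {D : Set V}

lemma Clq.conn {S : Set V} (h : Clq G S) (hS : S.Nonempty) : Conn G S := by
  refine ⟨hS, ?_⟩
  rintro T ⟨a, ha, haT⟩ ⟨b, hb, hbT⟩
  exact ⟨a, ha, b, hb, haT, hbT, h a ha b hb fun h => hbT (h ▸ haT)⟩

/-- Joining two nonadjacent vertices of an induced `K_{2,2,2,2,2}` by a path creates a `K_8`
minor. -/
lemma minorOf_of_path (φ : K22222 ↪g G) (hD : Conn G D) (hDK : Disjoint D (Set.range φ)) (i : Fin 5)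
    (h0 : φ ⟨i, 0⟩ ∈ nbs G D) (h1 : φ ⟨i, 1⟩ ∈ nbs G D) :
    (⊤ : SimpleGraph (Fin 8)).MinorOf G := by
  let v : Fin 5 × Fin 2 → V := fun p => φ ⟨i + p.1, p.2⟩
  have hv : Function.Injective v := by
    rintro ⟨a, b⟩ ⟨c, d⟩ h
    have := φ.injective h
    rw [Sigma.mk.injEq] at this
    obtain ⟨h1, h2⟩ := this
    exact Prod.ext (add_left_cancel h1) (eq_of_heq h2)
  have hadj : ∀ p q, p.1 ≠ q.1 → G.Adj (v p) (v q) := by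
    intro p q hpq
    exact φ.map_rel_iff.2 (show i + p.1 ≠ i + q.1 from fun h => hpq (add_left_cancel h))
  have hvD : ∀ p, v p ∉ D := fun p hp => Set.disjoint_left.1 hDK hp ⟨_, rfl⟩
  have hv0 : v (0, 0) ∈ nbs G D := by simpa [v] using h0
  have hv1 : v (0, 1) ∈ nbs G D := by simpa [v] using h1
  obtain ⟨-, d0, hd0, hvd0⟩ := hv0
  obtain ⟨-, d1, hd1, hvd1⟩ := hv1
  refine minorOf_of_conn (fun k => {x | (k = 1 ∧ x ∈ D) ∨ ∃ p, bagLabel p = k ∧ v p = x}) ?_ ?_ ?_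
  · intro k
    by_cases hk : k = 1
    · subst hk
      convert hD.insert ⟨d1, hd1, hvd1.symm⟩ using 1
      ext x
      simp only [true_and, Set.mem_ofPred_eq, Set.mem_insert_iff]
      rw [or_comm]
      refine or_congr_left ⟨?_, ?_⟩
      · rintro ⟨p, hp, rfl⟩
        have : ∀ p, bagLabel p = 1 → p = (0, 1) := by decide
        rw [this p hp]
      · rintro rfl
        exact ⟨(0, 1), rfl, rfl⟩
    · refine Clq.conn ?_ ?_
      · rintro x (⟨h, -⟩ | ⟨p, hp, rfl⟩) y (⟨h', -⟩ | ⟨q, hq, rfl⟩) hxy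
        · exact absurd h hk
        · exact absurd h hk
        · exact absurd h' hk
        · refine hadj p q ?_
          have : ∀ p q, bagLabel p = bagLabel q → p ≠ q → p.1 ≠ q.1 := by decide
          exact this p q (hp.trans hq.symm) fun h => hxy (by rw [h])
      · have : ∀ k, ∃ p, bagLabel p = k := by decide
        obtain ⟨p, hp⟩ := this k
        exact ⟨v p, Or.inr ⟨p, hp, rfl⟩⟩
  · intro k l hkl
    rw [Set.disjoint_left]
    rintro x (⟨rfl, hx⟩ | ⟨p, rfl, rfl⟩) (⟨h, h'⟩ | ⟨q, rfl, h⟩)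
    · exact hkl h.symm
    · exact hvD q (h ▸ hx)
    · exact hvD p h'
    · exact hkl (by rw [hv h])
  · intro k l hkl
    have : ∀ k l, k ≠ l → (k = 0 ∧ l = 1) ∨ (k = 1 ∧ l = 0) ∨
        ∃ p q, bagLabel p = k ∧ bagLabel q = l ∧ p.1 ≠ q.1 := by decide
    rcases this k l hkl with ⟨rfl, rfl⟩ | ⟨rfl, rfl⟩ | ⟨p, q, rfl, rfl, hpq⟩
    · exact ⟨v (0, 0), Or.inr ⟨_, rfl, rfl⟩, d0, Or.inl ⟨rfl, hd0⟩, hvd0.symm⟩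
    · exact ⟨d0, Or.inl ⟨rfl, hd0⟩, v (0, 0), Or.inr ⟨_, rfl, rfl⟩, hvd0⟩
    · exact ⟨v p, Or.inr ⟨p, rfl, rfl⟩, v q, Or.inr ⟨q, rfl, rfl⟩, hadj p q hpq⟩

variable [Finite V]

omit [Finite V] in
lemma ncard_range_K22222 (φ : K22222 ↪g G) : (Set.range φ).ncard = 10 := by
  rw [← Set.image_univ, Set.ncard_image_of_injective _ φ.injective, Set.ncard_univ,
    Nat.card_eq_fintype_card]
  decide

lemma ec_add_ec_of_separation (D : Set V) :
    ec G Set.univ Set.univ + ec G (nbs G D) (nbs G D) =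
      ec G (D ∪ nbs G D) (D ∪ nbs G D) + ec G Dᶜ Dᶜ := by
  have hDN : Disjoint D (nbs G D) := by
    rw [Set.disjoint_left]
    exact fun v hv h => h.1 hv
  have h1 : ec G D Set.univ = ec G D (D ∪ nbs G D) := by
    unfold ec
    congr 1
    ext ⟨a, b⟩
    simp only [Set.mem_univ, true_and, Set.mem_ofPred_eq]
    constructor
    · rintro ⟨h, h'⟩
      by_cases hb : b ∈ D
      · exact ⟨h, Or.inl hb, h'⟩
      · exact ⟨h, Or.inr ⟨hb, a, h, h'⟩, h'⟩
    · rintro ⟨h, -, h'⟩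
      exact ⟨h, h'⟩
  have h2 : ec G Dᶜ D = ec G (nbs G D) D := by
    unfold ec
    congr 1
    ext ⟨a, b⟩
    simp only [Set.mem_compl_iff, Set.mem_ofPred_eq]
    constructor
    · rintro ⟨h, hb, h'⟩
      exact ⟨⟨h, b, hb, h'.symm⟩, hb, h'⟩
    · rintro ⟨h, hb, h'⟩
      exact ⟨h.1, hb, h'⟩
  have h3 : ec G Set.univ Set.univ = ec G D Set.univ + ec G Dᶜ Set.univ := by
    rw [← ec_union_left disjoint_compl_right, Set.union_compl_self]
  have h4 : ec G Dᶜ Set.univ = ec G Dᶜ D + ec G Dᶜ Dᶜ := by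
    rw [← ec_union_right disjoint_compl_right, Set.union_compl_self]
  have h5 := ec_union_left (G := G) hDN (D ∪ nbs G D)
  have h6 := ec_union_right (G := G) hDN (nbs G D)
  omega

lemma sparse_of_embedding (φ : K22222 ↪g G) (hsp : ∀ m < Nat.card V, Sparse m)
    (hfree : ¬ (⊤ : SimpleGraph (Fin 8)).MinorOf G) (h7 : ∀ v, 7 ≤ (G.neighborSet v).ncard) :
    ec G Set.univ Set.univ + 40 ≤ 12 * Nat.card V := by
  have h10 := ncard_range_K22222 φ
  by_cases hK : ∃ v, v ∉ Set.range φ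
  · obtain ⟨v, hv⟩ := hK
    obtain ⟨D, hD, hvD⟩ := exists_isComp (G := G) hv
    have hpart : ∀ p q, φ p ∈ nbs G D → φ q ∈ nbs G D → p.1 = q.1 → p = q := by
      rintro ⟨i, a⟩ ⟨j, b⟩ hp hq hij
      obtain rfl : i = j := hij
      by_contra hne
      have hab : a ≠ b := fun h => hne (by rw [h])
      have : ∀ a b : Fin 2, a ≠ b → (a = 0 ∧ b = 1) ∨ (a = 1 ∧ b = 0) := by decide
      rcases this a b hab with ⟨rfl, rfl⟩ | ⟨rfl, rfl⟩
      · exact hfree (minorOf_of_path φ hD.1 hD.2.1 i hp hq)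
      · exact hfree (minorOf_of_path φ hD.1 hD.2.1 i hq hp)
    have h5 : (nbs G D).ncard ≤ 5 := by
      have : ∀ x ∈ nbs G D, ∃ p, φ p = x := fun x hx => hD.2.2 hx
      choose! ψ hψ using this
      have h := Set.ncard_le_ncard_of_injOn (s := nbs G D) (t := (Set.univ : Set (Fin 5)))
        (fun x => (ψ x).1) (fun _ _ => trivial) (by
          intro x hx y hy hxy
          have := hpart (ψ x) (ψ y) (by rwa [hψ x hx]) (by rwa [hψ y hy]) hxy
          rw [← hψ x hx, ← hψ y hy, this])
      simpa [Set.ncard_univ] using h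
    have hclq : Clq G (nbs G D) := by
      intro x hx y hy hxy
      obtain ⟨p, rfl⟩ := hD.2.2 hx
      obtain ⟨q, rfl⟩ := hD.2.2 hy
      exact φ.map_rel_iff.2 (show p.1 ≠ q.1 from fun h => hxy (by rw [hpart p q hx hy h]))
    have hNN : ((nbs G D).ncard - 1) * (nbs G D).ncard ≤ ec G (nbs G D) (nbs G D) := by
      refine mul_le_ec fun x hx => ?_
      rw [← Set.ncard_sdiff_singleton_of_mem hx]
      refine Set.ncard_le_ncard fun y hy => ⟨hy.1, hclq x hx y hy.1 fun h => hy.2 h.symm⟩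
    have hDN : Disjoint D (nbs G D) := by
      rw [Set.disjoint_left]
      exact fun v hv h => h.1 hv
    have hc1 := Set.ncard_union_eq hDN
    have hc2 := Set.ncard_add_ncard_compl D
    have hc3 : 7 ≤ (D ∪ nbs G D).ncard := by
      refine (h7 v).trans (Set.ncard_le_ncard fun w hw => ?_)
      by_cases h : w ∈ D
      · exact Or.inl h
      · exact Or.inr ⟨h, v, hvD, hw⟩
    have hc4 : 10 ≤ Dᶜ.ncard := by
      rw [← h10]
      exact Set.ncard_le_ncard fun x hx h => Set.disjoint_left.1 hD.2.1 h hx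
    have hc5 : 0 < D.ncard := (Set.ncard_pos).2 ⟨v, hvD⟩
    have he1 := (hsp (D ∪ nbs G D).ncard (by omega)).set_bound (G := G) (by omega)
      fun h => hfree (minorOf_induce h)
    have he2 := (hsp Dᶜ.ncard (by omega)).set_bound (G := G) (by omega)
      fun h => hfree (minorOf_induce h)
    have he3 := ec_add_ec_of_separation (G := G) D
    generalize (nbs G D).ncard = j at *
    interval_cases j <;> omega
  · push Not at hK
    have huniv : Set.range φ = Set.univ := Set.eq_univ_of_forall hK
    rw [huniv, Set.ncard_univ] at h10
    have h8 : ec G Set.univ Set.univ ≤ 8 * (Set.univ : Set V).ncard := by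
      refine ec_le_mul fun x _ => ?_
      obtain ⟨p, rfl⟩ := hK x
      rw [Set.univ_inter, ← K22222_degree p, ← Set.ncard_image_of_injective _ φ.injective]
      refine Set.ncard_le_ncard fun y hy => ?_
      obtain ⟨q, rfl⟩ := hK y
      exact ⟨q, φ.map_rel_iff.1 hy, rfl⟩
    rw [Set.ncard_univ, h10] at h8
    omega

lemma exists_le_ec_add_two {u v : V} (huv : G.Adj u v) : ∃ H ≤ G,
    ec H Set.univ Set.univ < ec G Set.univ Set.univ ∧
      ec G Set.univ Set.univ ≤ ec H Set.univ Set.univ + 2 := by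
  refine ⟨G.deleteEdges {s(u, v)}, deleteEdges_le _, Set.ncard_lt_ncard ?_, ?_⟩
  · refine ⟨fun p hp => ⟨trivial, trivial, deleteEdges_le _ hp.2.2⟩, fun h => ?_⟩
    have := (h (show (u, v) ∈ _ from ⟨trivial, trivial, huv⟩)).2.2
    simp at this
  · unfold ec
    refine (Set.ncard_le_ncard (t := {p : V × V | p.1 ∈ Set.univ ∧ p.2 ∈ Set.univ ∧
      (G.deleteEdges {s(u, v)}).Adj p.1 p.2} ∪ {(u, v), (v, u)}) ?_).trans
      ((Set.ncard_union_le _ _).trans (Nat.add_le_add_left (Set.ncard_pair fun h => huv.ne (congrArg Prod.fst h)).le _))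
    rintro ⟨a, b⟩ ⟨-, -, hab⟩
    by_cases h : s(a, b) = s(u, v)
    · rw [Sym2.eq_iff] at h
      refine Or.inr ?_
      rcases h with ⟨rfl, rfl⟩ | ⟨rfl, rfl⟩
      · exact Or.inl rfl
      · exact Or.inr rfl
    · exact Or.inl ⟨trivial, trivial, by simpa using ⟨hab, by simpa using h⟩⟩

end

lemma sparse_of_noInst {n : ℕ} (hsp : ∀ m < n, Sparse m) (hno : NoInst (n + 1)) : Sparse n := by
  intro V _ G hV h5 hfree
  subst hV
  induction h : ec G Set.univ Set.univ using Nat.strong_induction_on generalizing G with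
  | _ e ih =>
  subst h
  by_contra! hlt
  have h9 : 9 ≤ Nat.card V := by
    by_contra! h9
    have h1 : ec G Set.univ Set.univ ≤ (Nat.card V - 1) * (Set.univ : Set V).ncard := by
      refine ec_le_mul fun x _ => ?_
      rw [← Set.ncard_univ, ← Set.ncard_sdiff_singleton_of_mem (Set.mem_univ x)]
      exact Set.ncard_le_ncard fun y hy => ⟨trivial, fun h => hy.2.ne' h⟩
    rw [Set.ncard_univ] at h1
    generalize Nat.card V = n at *
    interval_cases n <;> omega
  have h7 : ∀ v, 7 ≤ (G.neighborSet v).ncard :=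
    fun v => seven_le_of_sparse hsp hfree (by omega) hlt
  obtain ⟨u⟩ : Nonempty V := (Nat.card_pos_iff.1 (by omega)).1
  obtain ⟨v, huv⟩ := Set.nonempty_of_ncard_ne_zero (s := G.neighborSet u)
    (by have := h7 u; omega)
  obtain ⟨H, hHG, h1, h2⟩ := exists_le_ec_add_two huv
  have h3 := ih _ h1 H (fun h => hfree (minorOf_trans (fun v => {v}) (fun v => conn_singleton v)
    (by simp) (fun a b hab => ⟨a, rfl, b, rfl, hHG hab⟩) h)) rfl
  obtain ⟨φ⟩ := nonempty_embedding_of_sparse hsp hno hfree (by omega) hlt (by omega)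
  have := sparse_of_embedding φ hsp hfree h7
  omega

lemma sparse_and_noInst (n : ℕ) : (∀ m < n, Sparse m) ∧ NoInst (n + 1) := by
  induction n with
  | zero =>
    refine ⟨fun m hm => absurd hm (by omega), fun W _ H t hW _ => ?_⟩
    have : Nonempty W := ⟨t⟩
    have := Nat.card_pos (α := W)
    omega
  | succ n ih =>
    have hsp : ∀ m < n + 1, Sparse m := by
      intro m hm
      rcases Nat.lt_succ_iff_lt_or_eq.1 hm with h | rfl
      · exact ih.1 m h
      · exact sparse_of_noInst ih.1 ih.2
    refine ⟨hsp, fun W _ H t hW hI => ?_⟩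
    rcases Nat.lt_succ_iff_lt_or_eq.1 hW with h | h
    · exact ih.2 W H t h hI
    · refine false_of_inst hI (h ▸ ih.2) fun X hX h5 => ?_
      have h1 : X.ncard < Nat.card W := by
        rw [← Set.ncard_univ]
        exact Set.ncard_lt_ncard (Set.ssubset_univ_iff.2 fun h => hX (h ▸ trivial))
      have := (hsp X.ncard (by omega)).set_bound (G := H) h5 fun h => hI.free (minorOf_induce h)
      omega

/-- No graph satisfies `Inst`. -/
theorem not_inst {V : Type} [Finite V] (G : SimpleGraph V) (s : V) : ¬ Inst G s :=
  (sparse_and_noInst (Nat.card V)).2 V G s (Nat.lt_succ_self _)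

end TriangleMinor

/-- Let `G` be a connected finite simple graph with no `K_8`-minor, with a
vertex `s` of degree at most 7 whose closed neighborhood `N[s]` is a proper
subset of `V(G)`. If every edge of `G` that is not an edge of `G[N[s]]`
belongs to at least 6 triangles, then `G` contains an induced subgraph
isomorphic to `K_{2,2,2,2,2}`. -/
theorem statement4 {V : Type} [Fintype V] (G : SimpleGraph V) [DecidableRel G.Adj]
    (hconn : G.Connected)
    (hfree : ¬ (⊤ : SimpleGraph (Fin 8)).MinorOf G)
    (s : V) (hdeg : G.degree s ≤ 7)
    (hproper : (insert s (G.neighborSet s) : Set V) ≠ Set.univ)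
    (htri : ∀ u v : V, G.Adj u v →
      ¬ (u ∈ (insert s (G.neighborSet s) : Set V) ∧
         v ∈ (insert s (G.neighborSet s) : Set V)) →
      6 ≤ (G.neighborSet u ∩ G.neighborSet v).ncard) :
    Nonempty (K22222 ↪g G) := by
  by_contra hK
  rw [not_nonempty_iff] at hK
  refine TriangleMinor.not_inst G s ⟨hfree, hK, ?_, (Set.ne_univ_iff_exists_notMem _).1 hproper,
    fun u v hu huv => htri u v huv fun h => hu h.1, fun u hu => ?_⟩
  · rw [← Nat.card_coe_set_eq, Nat.card_eq_fintype_card, card_neighborSet_eq_degree]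
    exact hdeg
  · have : Nontrivial V := ⟨u, s, fun h => hu (Or.inl h)⟩
    exact hconn.preconnected.exists_adj_of_nontrivial u
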